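/- Let N ≥ 1, m > 1, q ∈ (0,1), σ > 0 and let u_0 ∈ L^∞(ℝ^N) be non-negative. Then there exists a non-negative weak solution u of ∂_t u = Δ(u^m) − |x|^σ u^q with u(0) = u_0, it is unique (any two non-negative weak solutions coincide a.e. on (0,∞)×ℝ^N), and it satisfies ‖u(t)‖_∞ ≤ ‖u_0‖_∞ for a.e. t ≥ 0. -/

import Mathlib

open MeasureTheory Set

noncomputable section

/-- A non-negative weak solution of `∂ₜ u = Δ(uᵐ) − w(x) u^q` on `(0,∞)×ℝᴺ`
with initial condition `u₀`, in the sense of Definition 1.1 of the paper: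
`u` is a bounded non-negative measurable function, and there is a measurable
vector field `g` (the weak spatial gradient of `uᵐ`) which is locally square
integrable on `(0,T)×ℝᴺ`, satisfies the weak derivative identity against test
functions in `C_c^1((0,T)×ℝᴺ)`, and satisfies the weak formulation of the
equation against test functions in `C_c^1([0,T)×ℝᴺ)`. -/
def IsWeakSolution (N : ℕ) (m q : ℝ) (w : EuclideanSpace ℝ (Fin N) → ℝ)
    (u0 : EuclideanSpace ℝ (Fin N) → ℝ)
    (u : ℝ → EuclideanSpace ℝ (Fin N) → ℝ) : Prop :=
  Measurable (Function.uncurry u) ∧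
  (∀ t x, 0 ≤ u t x) ∧
  (∃ C : ℝ, ∀ t x, u t x ≤ C) ∧
  ∃ g : ℝ → EuclideanSpace ℝ (Fin N) → EuclideanSpace ℝ (Fin N),
    Measurable (Function.uncurry g) ∧
    ∀ T > (0:ℝ),
      (∀ K : Set (EuclideanSpace ℝ (Fin N)), IsCompact K →
        ∫⁻ s in Ioo (0:ℝ) T, ∫⁻ x in K, ENNReal.ofReal (‖g s x‖ ^ 2) < ⊤) ∧
      (∀ ζ : ℝ × EuclideanSpace ℝ (Fin N) → ℝ, ContDiff ℝ 1 ζ →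
        HasCompactSupport ζ → (∀ s x, s ∉ Ioo (0:ℝ) T → ζ (s, x) = 0) →
        ∀ i : Fin N,
          (∫ s in Ioo (0:ℝ) T, ∫ x,
              (u s x) ^ m * fderiv ℝ ζ (s, x) (0, EuclideanSpace.single i 1))
            = - ∫ s in Ioo (0:ℝ) T, ∫ x, g s x i * ζ (s, x)) ∧
      (∀ ζ : ℝ × EuclideanSpace ℝ (Fin N) → ℝ, ContDiff ℝ 1 ζ →
        HasCompactSupport ζ → (∀ s x, T ≤ s → ζ (s, x) = 0) →
        ∫ s in Ioo (0:ℝ) T, ∫ x,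
            ((u0 x - u s x) * fderiv ℝ ζ (s, x) (1, 0)
              + fderiv ℝ ζ (s, x) (0, g s x)
              + w x * (u s x) ^ q * ζ (s, x)) = 0)

/-- `u₀` is a non-negative function in `L^∞(ℝᴺ)`. -/
def IsBddNonneg (N : ℕ) (u0 : EuclideanSpace ℝ (Fin N) → ℝ) : Prop :=
  Measurable u0 ∧ (∀ x, 0 ≤ u0 x) ∧ ∃ C : ℝ, ∀ x, u0 x ≤ C

/-- The solution `u` vanishes in finite time. -/
def VanishesInFiniteTime (N : ℕ) (u : ℝ → EuclideanSpace ℝ (Fin N) → ℝ) : Prop :=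
  ∃ Te : ℝ, 0 < Te ∧ ∀ᵐ t : ℝ, Te ≤ t → ∀ᵐ x : EuclideanSpace ℝ (Fin N), u t x = 0

/-- The support of `u(t)` is contained in `B(0,R)` for a.e. `t > 0`. -/
def SupportLocalized (N : ℕ) (R : ℝ) (u : ℝ → EuclideanSpace ℝ (Fin N) → ℝ) : Prop :=
  ∀ᵐ t : ℝ, 0 < t → ∀ᵐ x : EuclideanSpace ℝ (Fin N), R ≤ ‖x‖ → u t x = 0

section
open Filter Topology
set_option linter.all false
section
section generic
variable {Q : Type*} [NormedAddCommGroup Q] [NormedSpace ℝ Q] [FiniteDimensional ℝ Q]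
  [MeasureSpace Q] [BorelSpace Q] [(volume : Measure Q).IsAddHaarMeasure]
lemma trans_cont {r : ENNReal} [Fact (1 ≤ r)] [Fact (r ≠ ⊤)] {f : Q → ℝ} (hf : MemLp f r volume) :
    Continuous (fun y : Q => DomAddAct.mk y +ᵥ hf.toLp f) := by
  have := (Lp.instContinuousVAddDomAddAct (M := Q) (X := Q) (E := ℝ) (μ := (volume : Measure Q)) (p := r))
  exact Continuous.vadd (DomAddAct.mkHomeomorph.continuous) continuous_const
lemma trans_coe {r : ENNReal} [Fact (1 ≤ r)] [Fact (r ≠ ⊤)] {f : Q → ℝ} (hf : MemLp f r volume) (y : Q) :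
    ((DomAddAct.mk y +ᵥ hf.toLp f : Lp ℝ r volume) : Q → ℝ) =ᵐ[volume] fun p => f (p + y) := by
  have := Lp.coeFn_compMeasurePreserving (hf.toLp f) (measurePreserving_add_left (volume : Measure Q) y)
  refine EventuallyEq.trans this ?_
  refine ((measurePreserving_add_left (volume : Measure Q) y).quasiMeasurePreserving.ae_eq_comp hf.coeFn_toLp).trans ?_
  exact Eventually.of_forall fun p => by simp [add_comm]
lemma trans_Lp {r : ENNReal} [Fact (1 ≤ r)] [Fact (r ≠ ⊤)] {f : Q → ℝ} (hf : MemLp f r volume) :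
    Tendsto (fun y : Q => eLpNorm (fun p => f (p + y) - f p) r volume) (𝓝 0) (𝓝 0) := by
  have h2 := ((trans_cont hf).tendsto 0)
  rw [tendsto_iff_edist_tendsto_0] at h2
  refine h2.congr fun y => ?_
  rw [Lp.edist_def]
  apply eLpNorm_congr_ae
  filter_upwards [trans_coe hf y, trans_coe hf 0] with p h3 h4
  rw [Pi.sub_apply, h3, h4, add_zero]
lemma trans_L1 {f : Q → ℝ} (hf : Integrable f) :
    Tendsto (fun y : Q => ∫ p, |f (p + y) - f p|) (𝓝 0) (𝓝 0) := by
  haveI : Fact ((1:ENNReal) ≠ ⊤) := ⟨by simp⟩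
  have h := trans_Lp (memLp_one_iff_integrable.2 hf)
  have h2 := (ENNReal.tendsto_toReal (by simp : (0:ENNReal) ≠ ⊤)).comp h
  simp only [ENNReal.toReal_zero] at h2
  refine h2.congr fun y => ?_
  have hi : Integrable (fun p => f (p + y) - f p) := (hf.comp_add_right y).sub hf
  simp only [Function.comp]
  rw [eLpNorm_one_eq_lintegral_enorm, ← integral_norm_eq_lintegral_enorm hi.aestronglyMeasurable]
  rfl
lemma trans_L2_pair {f h : Q → ℝ} (hf : MemLp f 2) (hh : MemLp h 2) :
    Continuous (fun y : Q => ∫ p, f (p + y) * h p) := by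
  haveI : Fact ((2:ENNReal) ≠ ⊤) := ⟨by simp⟩
  have h1 : Continuous (fun y : Q => inner ℝ (hh.toLp h) (DomAddAct.mk y +ᵥ hf.toLp f)) :=
    continuous_const.inner (trans_cont hf)
  convert h1 using 2 with y
  rw [L2.inner_def]
  apply integral_congr_ae
  filter_upwards [trans_coe hf y, hh.coeFn_toLp] with p h3 h4
  rw [h3, h4]; simp
/-- Kolmogorov-Riesz type compactness. -/
lemma compactness_ae (u : ℕ → Q → ℝ) (M : ℝ) (hum : ∀ n, Measurable (u n))
    (hub : ∀ n p, |u n p| ≤ M) (W : Q → ℝ) (hW : Integrable W) (hW0 : ∀ p, 0 < W p)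
    (hWm : Measurable W)
    (htr : ∀ η > 0, ∃ δ > 0, ∃ n0 : ℕ, ∀ n ≥ n0, ∀ y : Q, ‖y‖ < δ →
      ∫ p, |u n (p + y) - u n p| * W p ≤ η) :
    ∃ ns : ℕ → ℕ, StrictMono ns ∧ ∃ v : Q → ℝ, Measurable v ∧
      ∀ᵐ p, Tendsto (fun j => u (ns j) p) atTop (𝓝 (v p)) := by
  have hM : 0 ≤ M := (abs_nonneg _).trans (hub 0 0)
  haveI : Fact ((1:ENNReal) ≠ ⊤) := ⟨by simp⟩
  have hint : ∀ n (f : Q → ℝ), Integrable f → Integrable (fun p => u n p * f p) := fun n f hf =>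
    hf.bdd_mul (hum n).aestronglyMeasurable (Eventually.of_forall fun p => hub n p)
  let L : ℕ → (Lp ℝ 1 (volume : Measure Q)) →L[ℝ] ℝ := fun n =>
    LinearMap.mkContinuous
      { toFun := fun f => ∫ p, u n p * f p
        map_add' := by
          intro f g
          rw [← integral_add (hint n _ (L1.integrable_coeFn f)) (hint n _ (L1.integrable_coeFn g))]
          apply integral_congr_ae
          filter_upwards [Lp.coeFn_add f g] with p hp
          rw [hp, Pi.add_apply]; ring
        map_smul' := by
          intro c f
          simp only [RingHom.id_apply, smul_eq_mul]
          rw [← integral_const_mul]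
          apply integral_congr_ae
          filter_upwards [Lp.coeFn_smul c f] with p hp
          rw [hp, Pi.smul_apply, smul_eq_mul]; ring } M (by
        intro f
        simp only [LinearMap.coe_mk, AddHom.coe_mk]
        rw [L1.norm_eq_integral_norm, ← integral_const_mul]
        refine (norm_integral_le_integral_norm _).trans ?_
        apply integral_mono_of_nonneg (Eventually.of_forall fun p => norm_nonneg _)
          ((L1.integrable_coeFn f).norm.const_mul M)
        exact Eventually.of_forall fun p => by
          simp only [norm_mul]
          exact mul_le_mul_of_nonneg_right (hub n p) (norm_nonneg _))
  have hsep : TopologicalSpace.SeparableSpace (Lp ℝ 1 (volume : Measure Q)) := inferInstance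
  obtain ⟨ℓ, -, ns, hns, hlim⟩ := WeakDual.isSeqCompact_closedBall (𝕜 := ℝ)
    (E := Lp ℝ 1 (volume : Measure Q)) 0 M (x := fun n => StrongDual.toWeakDual (L n)) (by
      intro n
      simp only [mem_preimage, mem_closedBall_zero_iff]
      change ‖L n‖ ≤ M
      exact LinearMap.mkContinuous_norm_le _ hM _)
  have hlim2 : ∀ f : Q → ℝ, Integrable f → ∃ a, Tendsto (fun j => ∫ p, u (ns j) p * f p) atTop (𝓝 a) := by
    intro f hf
    have h1 := ((WeakDual.eval_continuous (𝕜 := ℝ) (hf.toL1 f)).tendsto ℓ).comp hlim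
    refine ⟨_, h1.congr fun j => ?_⟩
    change ∫ p, u (ns j) p * hf.toL1 f p = _
    apply integral_congr_ae
    filter_upwards [hf.coeFn_toL1] with p hp
    rw [hp]
  have hdiff : ∀ n k, Integrable (fun p => |u n p - u k p| * W p) := fun n k => by
    refine hW.bdd_mul (c := 2 * M) ((hum n).sub (hum k)).abs.aestronglyMeasurable
      (Eventually.of_forall fun p => ?_)
    rw [Real.norm_eq_abs, abs_abs]
    exact (abs_sub _ _).trans (by linarith [hub n p, hub k p])
  have hcau : ∀ η > 0, ∃ j0, ∀ j ≥ j0, ∀ k ≥ j0, ∫ p, |u (ns j) p - u (ns k) p| * W p ≤ 3 * η := by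
    intro η hη
    obtain ⟨δ, hδ, n0, hn0⟩ := htr η hη
    set B : Set Q := Metric.ball 0 δ with hB
    have hBm : MeasurableSet B := Metric.isOpen_ball.measurableSet
    have hBf : volume B ≠ ⊤ := (measure_ball_lt_top).ne
    have hBp : 0 < (volume : Measure Q).real B :=
      ENNReal.toReal_pos (Metric.measure_ball_pos _ _ hδ).ne' hBf
    set c := (volume : Measure Q).real B with hc
    set A : ℕ → Q → ℝ := fun n p => c⁻¹ * ∫ y in B, u n (p + y) with hA
    have huB : ∀ n p, IntegrableOn (fun y => u n (p + y)) B := fun n p =>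
      Measure.integrableOn_of_bounded (M := M) hBf
        ((hum n).comp (measurable_const_add p)).aestronglyMeasurable
        (Eventually.of_forall fun y => hub n (p + y))
    have hAb : ∀ n p, |A n p| ≤ M := fun n p => by
      rw [hA]; simp only [abs_mul, abs_inv, abs_of_pos hBp]
      rw [inv_mul_le_iff₀ hBp]
      have := norm_setIntegral_le_of_norm_le_const (μ := (volume : Measure Q)) (s := B) (C := M) (f := fun y => u n (p + y)) hBf.lt_top
        (fun y _ => hub n (p + y))
      rw [Real.norm_eq_abs] at this; linarith
    have hAm : ∀ n, Measurable (A n) := fun n => by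
      refine Measurable.const_mul ?_ _
      exact (StronglyMeasurable.integral_prod_right (f := fun p y => u n (p + y))
        (((hum n).comp (measurable_fst.add measurable_snd)).stronglyMeasurable)).measurable
    have herr : ∀ n ≥ n0, ∫ p, |u n p - A n p| * W p ≤ η := by
      intro n hn
      have hI : Integrable (fun z : Q × Q => |u n (z.1 + z.2) - u n z.1| * W z.1)
          (volume.prod (volume.restrict B)) := by
        have hWB : Integrable (fun z : Q × Q => W z.1) (volume.prod (volume.restrict B)) := by
          haveI : IsFiniteMeasure ((volume : Measure Q).restrict B) := ⟨by simpa using hBf.lt_top⟩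
          exact hW.comp_fst _
        refine hWB.bdd_mul (c := 2 * M) ?_ (Eventually.of_forall fun z => ?_)
        · exact (((hum n).comp (measurable_fst.add measurable_snd)).sub
            ((hum n).comp measurable_fst)).abs.aestronglyMeasurable
        · rw [Real.norm_eq_abs, abs_abs]
          exact (abs_sub _ _).trans (by linarith [hub n (z.1 + z.2), hub n z.1])
      have h1 : ∀ p, |u n p - A n p| * W p ≤ c⁻¹ * ∫ y in B, |u n (p + y) - u n p| * W p := by
        intro p
        have e1 : A n p - u n p = c⁻¹ * ∫ y in B, (u n (p + y) - u n p) := by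
          rw [integral_sub (huB n p) (integrableOn_const hBf), setIntegral_const, mul_sub]
          rw [hA, smul_eq_mul, ← hc, ← mul_assoc, inv_mul_cancel₀ hBp.ne', one_mul]
        rw [abs_sub_comm, e1, abs_mul, abs_inv, abs_of_pos hBp, integral_mul_const, mul_assoc]
        refine mul_le_mul_of_nonneg_left ?_ (inv_nonneg.2 hBp.le)
        exact mul_le_mul_of_nonneg_right (abs_integral_le_integral_abs) (hW0 p).le
      have h2 : ∫ p, |u n p - A n p| * W p ≤ ∫ p, c⁻¹ * ∫ y in B, |u n (p + y) - u n p| * W p := by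
        apply integral_mono_of_nonneg (Eventually.of_forall fun p => mul_nonneg (abs_nonneg _) (hW0 p).le)
        · exact hI.integral_prod_left.const_mul _
        · exact Eventually.of_forall h1
      refine h2.trans ?_
      rw [integral_const_mul, inv_mul_le_iff₀ hBp]
      rw [integral_integral_swap hI]
      have h3 : ∫ y in B, ∫ p, |u n (p + y) - u n p| * W p ≤ ∫ y in B, η := by
        apply setIntegral_mono_on hI.integral_prod_right (integrableOn_const hBf) hBm
        intro y hy
        exact hn0 n hn y (by simpa [hB] using hy)
      refine h3.trans ?_
      rw [setIntegral_const, smul_eq_mul]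
    have hAlim : ∀ p, ∃ a, Tendsto (fun j => A (ns j) p) atTop (𝓝 a) := by
      intro p
      obtain ⟨a, ha⟩ := hlim2 ((Metric.ball p δ).indicator 1)
        ((integrable_indicator_iff Metric.isOpen_ball.measurableSet).2
          (integrableOn_const (measure_ball_lt_top).ne))
      refine ⟨c⁻¹ * a, (ha.const_mul c⁻¹).congr fun j => ?_⟩
      rw [hA]; simp only
      congr 1
      rw [← integral_indicator hBm, ← integral_add_left_eq_self _ p]
      congr 1; ext y
      by_cases hy : y ∈ B
      · have : p + y ∈ Metric.ball p δ := by simpa [hB] using hy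
        simp [hy, this]
      · have : p + y ∉ Metric.ball p δ := by simpa [hB] using hy
        simp [hy, this]
    have hAc : Tendsto (fun jk : ℕ × ℕ => ∫ p, |A (ns jk.1) p - A (ns jk.2) p| * W p) atTop (𝓝 (∫ p : Q, 0)) := by
      apply tendsto_integral_filter_of_dominated_convergence (fun p => 2 * M * W p)
      · exact Eventually.of_forall fun jk => (((hAm _).sub (hAm _)).abs.mul hWm).aestronglyMeasurable
      · refine Eventually.of_forall fun jk => Eventually.of_forall fun p => ?_
        rw [Real.norm_eq_abs, abs_mul, abs_abs, abs_of_pos (hW0 p)]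
        exact mul_le_mul_of_nonneg_right ((abs_sub _ _).trans (by linarith [hAb (ns jk.1) p, hAb (ns jk.2) p])) (hW0 p).le
      · exact hW.const_mul _
      · refine Eventually.of_forall fun p => ?_
        obtain ⟨a, ha⟩ := hAlim p
        rw [← prod_atTop_atTop_eq]
        have := (((ha.comp tendsto_fst).sub (ha.comp tendsto_snd)).abs.mul_const (W p) :
          Tendsto _ (atTop ×ˢ atTop) _)
        simpa using this
    rw [integral_zero] at hAc
    have hev := (hAc.eventually (gt_mem_nhds hη))
    obtain ⟨⟨j0, j1⟩, hj1⟩ := eventually_atTop.1 hev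
    refine ⟨max (max j0 j1) n0, fun j hj k hk => ?_⟩
    have hjn : n0 ≤ ns j := ((le_max_right _ _).trans hj).trans (hns.id_le j)
    have hkn : n0 ≤ ns k := ((le_max_right _ _).trans hk).trans (hns.id_le k)
    have hAi : ∀ n, Integrable (fun p => |u n p - A n p| * W p) := fun n => by
      refine hW.bdd_mul (c := 2 * M) ((hum n).sub (hAm n)).abs.aestronglyMeasurable
        (Eventually.of_forall fun p => ?_)
      rw [Real.norm_eq_abs, abs_abs]
      exact (abs_sub _ _).trans (by linarith [hub n p, hAb n p])
    have hAAi : Integrable (fun p => |A (ns j) p - A (ns k) p| * W p) := by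
      refine hW.bdd_mul (c := 2 * M) ((hAm _).sub (hAm _)).abs.aestronglyMeasurable
        (Eventually.of_forall fun p => ?_)
      rw [Real.norm_eq_abs, abs_abs]
      exact (abs_sub _ _).trans (by linarith [hAb (ns j) p, hAb (ns k) p])
    have h5 := hj1 (j, k) ⟨((le_max_left _ _).trans (le_max_left _ _)).trans hj, ((le_max_right _ _).trans (le_max_left _ _)).trans hk⟩
    simp only at h5
    have h6 := herr _ hjn
    have h7 := herr _ hkn
    calc ∫ p, |u (ns j) p - u (ns k) p| * W p
        ≤ ∫ p, (|u (ns j) p - A (ns j) p| * W p + |u (ns k) p - A (ns k) p| * W p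
          + |A (ns j) p - A (ns k) p| * W p) := by
          apply integral_mono (hdiff _ _) (((hAi _).add (hAi _)).add hAAi)
          intro p
          simp only [Pi.add_apply, ← add_mul]
          refine mul_le_mul_of_nonneg_right ?_ (hW0 p).le
          have := abs_add_three (u (ns j) p - A (ns j) p) (-(u (ns k) p - A (ns k) p)) (A (ns j) p - A (ns k) p)
          rw [abs_neg] at this
          refine le_trans (le_of_eq ?_) this
          congr 1; ring
      _ ≤ 3 * η := by
          rw [integral_add ((hAi (ns j)).fun_add (hAi (ns k))) hAAi, integral_add (hAi _) (hAi _)]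
          linarith
  have hUi : ∀ n, Integrable (fun p => u n p * W p) := fun n => hint n W hW
  let U : ℕ → Lp ℝ 1 (volume : Measure Q) := fun j => (hUi (ns j)).toL1 _
  have hUdist : ∀ j k, dist (U j) (U k) = ∫ p, |u (ns j) p - u (ns k) p| * W p := by
    intro j k
    rw [dist_eq_norm, L1.norm_eq_integral_norm]
    apply integral_congr_ae
    filter_upwards [Lp.coeFn_sub (U j) (U k), (hUi (ns j)).coeFn_toL1, (hUi (ns k)).coeFn_toL1] with p h1 h2 h3
    rw [h1, Pi.sub_apply, h2, h3, ← sub_mul, norm_mul, Real.norm_eq_abs, Real.norm_eq_abs, abs_of_pos (hW0 p)]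
  have hUc : CauchySeq U := by
    rw [Metric.cauchySeq_iff]
    intro ε hε
    obtain ⟨j0, hj0⟩ := hcau (ε / 6) (by positivity)
    refine ⟨j0, fun j hj k hk => ?_⟩
    rw [hUdist]
    linarith [hj0 j hj k hk]
  obtain ⟨F, hF⟩ := cauchySeq_tendsto_of_complete hUc
  have hmeas := tendstoInMeasure_of_tendsto_Lp hF
  obtain ⟨ks, hks, hae⟩ := hmeas.exists_seq_tendsto_ae
  refine ⟨ns ∘ ks, hns.comp hks, fun p => F p / W p, (Lp.stronglyMeasurable F).measurable.div hWm, ?_⟩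
  have hall : ∀ᵐ p, ∀ j, U j p = u (ns j) p * W p := ae_all_iff.2 fun j => (hUi (ns j)).coeFn_toL1
  filter_upwards [hae, hall] with p hp hp2
  refine (hp.div_const (W p)).congr fun j => ?_
  rw [hp2, mul_div_cancel_right₀ _ (hW0 p).ne']
  rfl
end generic
end

section
section A2
variable {Q : Type*} [MeasureSpace Q] [MeasurableSpace.CountablyGenerated Q] [SigmaFinite (volume : Measure Q)]
variable {F : Type*} [NormedAddCommGroup F] [InnerProductSpace ℝ F] [FiniteDimensional ℝ F] [MeasurableSpace F] [BorelSpace F]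
theorem weak_L2 (Z : ℕ → Q → F) (hZ : ∀ n, MemLp (Z n) 2) (C : ℝ)
    (hC : ∀ n, ∫ p, ‖Z n p‖ ^ 2 ≤ C) :
    ∃ ns : ℕ → ℕ, StrictMono ns ∧ ∃ z : Q → F, Measurable z ∧ MemLp z 2 ∧
      ∀ h : Q → F, MemLp h 2 → Tendsto (fun j => ∫ p, inner ℝ (Z (ns j) p) (h p)) atTop (𝓝 (∫ p, inner ℝ (z p) (h p))) := by
  haveI : Fact ((1:ENNReal) ≤ 2) := ⟨by norm_num⟩
  haveI : Fact ((2:ENNReal) ≠ ⊤) := ⟨by norm_num⟩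
  let H := Lp F 2 (volume : Measure Q)
  have hsep : TopologicalSpace.SeparableSpace (Lp F 2 (volume : Measure Q)) := inferInstance
  let y : ℕ → Lp F 2 (volume : Measure Q) := fun n => (hZ n).toLp (Z n)
  have hy : ∀ n, ‖y n‖ ≤ Real.sqrt C := by
    intro n
    apply Real.le_sqrt_of_sq_le
    rw [← real_inner_self_eq_norm_sq, L2.inner_def]
    refine le_trans (le_of_eq ?_) (hC n)
    apply integral_congr_ae
    filter_upwards [(hZ n).coeFn_toLp] with p hp
    simp only [y]
    rw [hp, real_inner_self_eq_norm_sq]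
  let L : ℕ → WeakDual ℝ (Lp F 2 (volume : Measure Q)) := fun n =>
    StrongDual.toWeakDual (InnerProductSpace.toDual ℝ _ (y n))
  obtain ⟨ℓ, -, ns, hns, hlim⟩ := WeakDual.isSeqCompact_closedBall ℝ (Lp F 2 (volume : Measure Q)) 0 (Real.sqrt C)
    (x := L) (fun n => by
      simp only [mem_preimage, Metric.mem_closedBall, dist_zero_right, L]
      have : ‖(InnerProductSpace.toDual ℝ (Lp F 2 (volume : Measure Q))) (y n)‖ ≤ √C := by
        rw [LinearIsometryEquiv.norm_map]; exact hy n
      exact this)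
  let z0 := (InnerProductSpace.toDual ℝ (Lp F 2 (volume : Measure Q))).symm (WeakDual.toStrongDual ℓ)
  refine ⟨ns, hns, z0, (Lp.stronglyMeasurable z0).measurable, Lp.memLp z0, ?_⟩
  · intro h hh
    have h1 := ((WeakBilin.eval_continuous _ (hh.toLp h)).tendsto ℓ).comp hlim
    have e1 : ∀ n, ∫ p, inner ℝ (Z n p) (h p) = inner ℝ (y n) (hh.toLp h) := by
      intro n
      rw [L2.inner_def]
      apply integral_congr_ae
      filter_upwards [(hZ n).coeFn_toLp, hh.coeFn_toLp] with p hp hp2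
      simp only [y]
      rw [hp, hp2]
    have e2 : ∫ p, inner ℝ (z0 p) (h p) = inner ℝ z0 (hh.toLp h) := by
      rw [L2.inner_def]
      apply integral_congr_ae
      filter_upwards [hh.coeFn_toLp] with p hp2
      rw [hp2]
    rw [e2]
    simp only [e1]
    have e3 : inner ℝ z0 (hh.toLp h) = ℓ (hh.toLp h) := by
      rw [InnerProductSpace.toDual_symm_apply]; rfl
    rw [e3]
    exact h1
end A2
end

section
abbrev EE (N : ℕ) := EuclideanSpace ℝ (Fin N)
def ee {N : ℕ} (i : Fin N) : EE N := EuclideanSpace.single i (1:ℝ)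
def xi {N : ℕ} (x : EE N) : ℝ := ∏ i, (Real.cosh (x i))⁻¹
def Dl {N : ℕ} (ε : ℝ) (f : EE N → ℝ) (x : EE N) : ℝ := ∑ i, (f (x + ε • ee i) + f (x - ε • ee i) - 2 * f x)
section B1
variable {N : ℕ}
theorem xi_pos (x : EE N) : 0 < xi x := Finset.prod_pos fun i _ => inv_pos.2 (Real.cosh_pos _)
theorem xi_cont : Continuous (xi : EE N → ℝ) := by
  unfold xi
  refine continuous_finset_prod _ fun i _ => Continuous.inv₀ (by fun_prop) fun x => (Real.cosh_pos _).ne'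
theorem xi_meas : Measurable (xi : EE N → ℝ) := xi_cont.measurable
theorem sech_le (r : ℝ) : (Real.cosh r)⁻¹ ≤ 2 * Real.exp (-|r|) := by
  rw [Real.exp_neg, ← div_eq_mul_inv, inv_eq_one_div, div_le_div_iff₀ (Real.cosh_pos _) (Real.exp_pos _), ← Real.cosh_abs, Real.cosh_eq]
  linarith [Real.exp_pos (-|r|)]
theorem integrable_exp_abs {a : ℝ} (ha : 0 < a) : Integrable (fun r : ℝ => Real.exp (-a * |r|)) := by
  rw [← integrableOn_univ, ← Iic_union_Ioi (a := (0:ℝ))]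
  refine IntegrableOn.union ?_ ?_
  · refine (integrableOn_exp_mul_Iic ha 0).congr_fun (fun r hr => ?_) measurableSet_Iic
    simp only [abs_of_nonpos (show r ≤ 0 from hr)]; ring_nf
  · refine (integrableOn_exp_mul_Ioi (a := -a) (by linarith) 0).congr_fun (fun r hr => ?_) measurableSet_Ioi
    simp only [abs_of_pos (show 0 < r from hr)]
theorem prod_int {f : Fin N → ℝ → ℝ} (hf : ∀ i, Integrable (f i)) : Integrable (fun x : EE N => ∏ i, f i (x i)) := by
  have h := Integrable.fintype_prod hf
  rw [← volume_pi] at h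
  exact ((EuclideanSpace.volume_preserving_symm_measurableEquiv_toLp (Fin N)).integrable_comp_emb (MeasurableEquiv.measurableEmbedding _)).2 h
theorem pow_exp (p : ℝ) (hp : 0 ≤ p) : ∃ C : ℝ, ∀ s : ℝ, 0 ≤ s → (1 + s) ^ p ≤ C * Real.exp (s / 2) := by
  obtain ⟨n, hn⟩ := exists_nat_ge p
  refine ⟨(n.factorial : ℝ) * 2 ^ n * Real.exp (1/2), fun s hs => ?_⟩
  have h1 : (1 + s) ^ p ≤ (1 + s) ^ n := by
    rw [← Real.rpow_natCast]
    exact Real.rpow_le_rpow_of_exponent_le (by linarith) hn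
  have h2 := Real.pow_div_factorial_le_exp ((1 + s) / 2) (by linarith) n
  rw [div_le_iff₀ (by positivity), div_pow, div_le_iff₀ (by positivity)] at h2
  have h3 : Real.exp ((1 + s)/2) = Real.exp (1/2) * Real.exp (s/2) := by rw [← Real.exp_add]; ring_nf
  rw [h3] at h2
  linarith
theorem norm_le_sum (x : EE N) : ‖x‖ ≤ ∑ i, |x i| := by
  rw [EuclideanSpace.norm_eq]
  apply Real.sqrt_le_iff.2 ⟨Finset.sum_nonneg fun i _ => abs_nonneg _, ?_⟩
  simpa using Finset.sum_sq_le_sq_sum_of_nonneg (s := Finset.univ) (f := fun i => |x i|) (fun i _ => abs_nonneg _)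
theorem xi_int (p : ℝ) (hp : 0 ≤ p) : Integrable (fun x : EE N => (1 + ‖x‖) ^ p * xi x) := by
  obtain ⟨C, hC⟩ := pow_exp p hp
  have hC0 : 0 ≤ C := by have := hC 0 le_rfl; simp at this; linarith
  have h1 : Integrable (fun x : EE N => C * ∏ i, (2 * Real.exp (-(1/2) * |x i|))) :=
    (prod_int (f := fun i r => 2 * Real.exp (-(1/2) * |r|)) fun i => (integrable_exp_abs (by norm_num)).const_mul 2).const_mul C
  refine h1.mono' ?_ (Eventually.of_forall fun x => ?_)
  · refine (Continuous.mul (Continuous.rpow_const (by fun_prop) fun x => Or.inr hp) xi_cont).aestronglyMeasurable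
  · have hx := xi_pos x
    rw [Real.norm_of_nonneg (by positivity)]
    calc (1 + ‖x‖) ^ p * xi x ≤ (C * Real.exp (‖x‖/2)) * ∏ i, (2 * Real.exp (-|x i|)) := by
          refine mul_le_mul (hC _ (norm_nonneg _)) ?_ hx.le (by positivity)
          exact Finset.prod_le_prod (fun i _ => (inv_pos.2 (Real.cosh_pos _)).le) fun i _ => sech_le _
      _ ≤ (C * ∏ i, Real.exp (|x i|/2)) * ∏ i, (2 * Real.exp (-|x i|)) := by
          gcongr
          rw [← Real.exp_sum, ← Finset.sum_div]
          gcongr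
          exact norm_le_sum x
      _ = _ := by
          rw [mul_assoc, ← Finset.prod_mul_distrib]
          congr 1
          refine Finset.prod_congr rfl fun i _ => ?_
          rw [mul_left_comm, ← Real.exp_add]; ring_nf
theorem xi_int0 : Integrable (xi : EE N → ℝ) := by simpa using xi_int (N := N) 0 le_rfl
theorem xi_shift (x : EE N) (i : Fin N) (s : ℝ) :
    xi (x + s • ee i) = (Real.cosh (x i + s))⁻¹ * ∏ j ∈ Finset.univ.erase i, (Real.cosh (x j))⁻¹ := by
  unfold xi
  rw [← Finset.mul_prod_erase _ _ (Finset.mem_univ i)]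
  congr 1
  · simp [ee]
  · refine Finset.prod_congr rfl fun j hj => ?_
    have : j ≠ i := Finset.ne_of_mem_erase hj
    simp [ee, this]
theorem sech_two (r s : ℝ) : (Real.cosh (r+s))⁻¹ + (Real.cosh (r + -s))⁻¹ ≤ 2 * Real.cosh s * (Real.cosh r)⁻¹ := by
  have h1 := Real.cosh_pos (r+s)
  have h2 := Real.cosh_pos (r+-s)
  have h3 := Real.cosh_pos r
  have h4 := Real.cosh_pos s
  rw [inv_add_inv h1.ne' h2.ne', ← div_eq_mul_inv, div_le_div_iff₀ (by positivity) h3]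
  have e1 : Real.cosh (r+s) * Real.cosh (r+-s) = Real.cosh r ^ 2 + Real.sinh s ^ 2 := by
    rw [Real.cosh_add, Real.cosh_add, Real.cosh_neg, Real.sinh_neg]
    have a := Real.cosh_sq r; have b := Real.cosh_sq s
    linear_combination Real.cosh r ^ 2 * b + Real.sinh s ^ 2 * a
  rw [e1, Real.cosh_add, Real.cosh_add, Real.cosh_neg, Real.sinh_neg]
  nlinarith [mul_nonneg h4.le (sq_nonneg (Real.sinh s))]
theorem cosh_sub_one {ε : ℝ} (h : |ε| ≤ 1) : Real.cosh ε - 1 ≤ ε ^ 2 := by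
  have h1 := Real.cosh_le_exp_half_sq ε
  have h2 : |ε^2/2| ≤ 1 := by rw [abs_of_nonneg (by positivity)]; nlinarith [sq_abs ε, abs_nonneg ε]
  have h3 := Real.abs_exp_sub_one_le h2
  rw [abs_of_nonneg (by positivity : 0 ≤ ε^2/2)] at h3
  linarith [le_abs_self (Real.exp (ε^2/2) - 1)]
theorem xi_Dl {ε : ℝ} (h : |ε| ≤ 1) (x : EE N) : Dl ε xi x ≤ 2 * N * ε ^ 2 * xi x := by
  have : ∀ i : Fin N, xi (x + ε • ee i) + xi (x - ε • ee i) - 2 * xi x ≤ 2 * ε ^ 2 * xi x := by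
    intro i
    have e0 := xi_shift x i 0
    simp only [zero_smul, add_zero] at e0
    rw [sub_eq_add_neg x, ← neg_smul, xi_shift, xi_shift, e0]
    set P := ∏ j ∈ Finset.univ.erase i, (Real.cosh (x j))⁻¹
    have hP : 0 ≤ P := Finset.prod_nonneg fun j _ => (inv_pos.2 (Real.cosh_pos _)).le
    have h1 := mul_le_mul_of_nonneg_right (sech_two (x i) ε) hP
    have h2 := mul_le_mul_of_nonneg_right (cosh_sub_one h) (mul_nonneg (inv_pos.2 (Real.cosh_pos (x i))).le hP)
    linarith
  calc Dl ε xi x ≤ ∑ i : Fin N, 2 * ε ^ 2 * xi x := Finset.sum_le_sum fun i _ => this i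
    _ = _ := by simp; ring
theorem sech_tr (r s : ℝ) : (Real.cosh (r+s))⁻¹ ≤ Real.exp |s| * (Real.cosh r)⁻¹ := by
  rw [← div_eq_mul_inv, inv_eq_one_div, div_le_div_iff₀ (Real.cosh_pos _) (Real.cosh_pos _), one_mul]
  rw [Real.cosh_eq r, Real.cosh_eq (r+s)]
  have h1 : Real.exp r ≤ Real.exp |s| * Real.exp (r+s) := by
    rw [← Real.exp_add]; gcongr; linarith [neg_abs_le s]
  have h2 : Real.exp (-r) ≤ Real.exp |s| * Real.exp (-(r+s)) := by
    rw [← Real.exp_add]; gcongr; linarith [le_abs_self s]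
  linarith
theorem xi_tr (x y : EE N) : xi (x + y) ≤ Real.exp (∑ i, |y i|) * xi x := by
  unfold xi
  rw [Real.exp_sum, ← Finset.prod_mul_distrib]
  exact Finset.prod_le_prod (fun i _ => (inv_pos.2 (Real.cosh_pos _)).le) fun i _ => sech_tr _ _
/-- shift invariance of the weighted integral -/
theorem int_shift (f g : EE N → ℝ) (y : EE N) : ∫ x, f (x + y) * g x = ∫ x, f x * g (x - y) := by
  rw [← integral_add_right_eq_self (fun x => f x * g (x - y)) y]
  simp
end B1
end

section
open Classical in
def Gs (q lam a : ℝ) : ℝ := if h : ∃ v : ℝ, 0 ≤ v ∧ v + lam * v ^ q = a then h.choose else 0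
theorem Gs_spec {q lam a : ℝ} (hq : 0 < q) (hl : 0 ≤ lam) (ha : 0 ≤ a) :
    0 ≤ Gs q lam a ∧ Gs q lam a + lam * (Gs q lam a) ^ q = a := by
  have h : ∃ v : ℝ, 0 ≤ v ∧ v + lam * v ^ q = a := by
    have hc : ContinuousOn (fun v : ℝ => v + lam * v ^ q) (Icc 0 a) :=
      (continuous_id.add (continuous_const.mul (Real.continuous_rpow_const hq.le))).continuousOn
    have := intermediate_value_Icc ha hc
    obtain ⟨v, hv, hv2⟩ := this (show a ∈ _ from ⟨by simp [Real.zero_rpow hq.ne', ha], by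
      have : 0 ≤ lam * a ^ q := by positivity
      linarith⟩)
    exact ⟨v, hv.1, hv2⟩
  unfold Gs; rw [dif_pos h]; exact h.choose_spec
theorem Gs_le {q lam a : ℝ} (hq : 0 < q) (hl : 0 ≤ lam) (ha : 0 ≤ a) : Gs q lam a ≤ a := by
  obtain ⟨h1, h2⟩ := Gs_spec hq hl ha
  have : 0 ≤ lam * (Gs q lam a) ^ q := by positivity
  linarith
theorem Gs_ge_iff {q lam a c : ℝ} (hq : 0 < q) (hl : 0 ≤ lam) (ha : 0 ≤ a) (hc : 0 ≤ c) :
    c ≤ Gs q lam a ↔ c + lam * c ^ q ≤ a := by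
  obtain ⟨h1, h2⟩ := Gs_spec hq hl ha
  constructor
  · intro h
    have := mul_le_mul_of_nonneg_left (Real.rpow_le_rpow hc h hq.le) hl
    linarith
  · intro h
    by_contra h3
    push Not at h3
    have := mul_le_mul_of_nonneg_left (Real.rpow_le_rpow h1 h3.le hq.le) hl
    linarith
theorem Gs_meas {α : Type*} [MeasurableSpace α] {q : ℝ} (hq : 0 < q) {lam a : α → ℝ} (hl : ∀ x, 0 ≤ lam x) (ha : ∀ x, 0 ≤ a x)
    (hlm : Measurable lam) (ham : Measurable a) : Measurable (fun x => Gs q (lam x) (a x)) := by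
  apply measurable_of_Ici
  intro c
  rcases le_or_gt c 0 with hc | hc
  · convert MeasurableSet.univ
    ext x; simp; exact hc.trans (Gs_spec hq (hl x) (ha x)).1
  · have : (fun x => Gs q (lam x) (a x)) ⁻¹' Ici c = {x | c + lam x * c ^ q ≤ a x} := by
      ext x; simp [Gs_ge_iff hq (hl x) (ha x) hc.le]
    rw [this]
    exact measurableSet_le (by fun_prop) ham
theorem Gs_contr {q lam a lam' a' K : ℝ} (hq : 0 < q) (hl : 0 ≤ lam) (ha : 0 ≤ a) (hl' : 0 ≤ lam') (ha' : 0 ≤ a')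
    (haK : a ≤ K) (haK' : a' ≤ K) :
    |Gs q lam a - Gs q lam' a'| ≤ |a - a'| + |lam - lam'| * K ^ q := by
  obtain ⟨h1, h2⟩ := Gs_spec hq hl ha
  obtain ⟨h1', h2'⟩ := Gs_spec hq hl' ha'
  have h3 := (Gs_le hq hl ha).trans haK
  have h3' := (Gs_le hq hl' ha').trans haK'
  set v := Gs q lam a
  set v' := Gs q lam' a'
  have k1 : v ^ q ≤ K ^ q := Real.rpow_le_rpow h1 h3 hq.le
  have k1' : v' ^ q ≤ K ^ q := Real.rpow_le_rpow h1' h3' hq.le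
  have p1 := Real.rpow_nonneg h1 q
  have p1' := Real.rpow_nonneg h1' q
  have e1 := le_abs_self (a - a')
  have e2 := neg_abs_le (a - a')
  have f1 : |(lam - lam') * v' ^ q| ≤ |lam - lam'| * K ^ q := by
    rw [abs_mul, abs_of_nonneg p1']; gcongr
  have f2 : |(lam - lam') * v ^ q| ≤ |lam - lam'| * K ^ q := by
    rw [abs_mul, abs_of_nonneg p1]; gcongr
  have f1' := abs_le.1 f1
  have f2' := abs_le.1 f2
  rcases le_total v v' with h | h
  · have g := mul_le_mul_of_nonneg_left (Real.rpow_le_rpow h1 h hq.le) hl'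
    rw [abs_of_nonpos (by linarith)]
    nlinarith
  · have g := mul_le_mul_of_nonneg_left (Real.rpow_le_rpow h1' h hq.le) hl
    rw [abs_of_nonneg (by linarith)]
    nlinarith
structure Par (N : ℕ) where
  m : ℝ
  q : ℝ
  M : ℝ
  L : ℝ
  c : ℝ
  hN : 1 ≤ N
  hm : 1 < m
  hq0 : 0 < q
  hq1 : q < 1
  hM : 0 ≤ M
  hL : 0 ≤ L
  hLip : ∀ a b, 0 ≤ a → a ≤ M → 0 ≤ b → b ≤ M → |a ^ m - b ^ m| ≤ L * |a - b|
  hc : 0 < c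
  hcfl : 16 * N * (L + 1) * c = 1
theorem pow_lip {m M : ℝ} (hm : 1 < m) (a b : ℝ) (ha : 0 ≤ a) (haM : a ≤ M) (hb : 0 ≤ b) (hbM : b ≤ M) :
    |a ^ m - b ^ m| ≤ m * M ^ (m-1) * |a - b| := by
  have := Convex.norm_image_sub_le_of_norm_hasDerivWithin_le (f := fun r : ℝ => r ^ m) (f' := fun r => m * r ^ (m-1))
    (s := Icc 0 M) (C := m * M ^ (m-1)) (x := b) (y := a)
    (fun x hx => (Real.hasDerivAt_rpow_const (Or.inr hm.le)).hasDerivWithinAt)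
    (fun x hx => by
      have := Real.rpow_nonneg hx.1 (m-1)
      rw [Real.norm_of_nonneg (by positivity)]
      gcongr
      · exact hx.1
      · exact hx.2) (convex_Icc 0 M) ⟨hb, hbM⟩ ⟨ha, haM⟩
  simpa using this
theorem Par_exists {N : ℕ} (hN : 1 ≤ N) {m q M : ℝ} (hm : 1 < m) (hq0 : 0 < q) (hq1 : q < 1) (hM : 0 ≤ M) :
    ∃ P : Par N, P.m = m ∧ P.q = q ∧ P.M = M := by
  have hL : 0 ≤ m * M ^ (m-1) := by have := Real.rpow_nonneg hM (m-1); positivity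
  have hN' : (0:ℝ) < N := by exact_mod_cast hN
  refine ⟨⟨m, q, M, m * M ^ (m-1), (16 * N * (m * M ^ (m-1) + 1))⁻¹, hN, hm, hq0, hq1, hM, hL, pow_lip hm, by positivity, ?_⟩, rfl, rfl, rfl⟩
  exact mul_inv_cancel₀ (by positivity)
namespace Par
variable {N : ℕ} (P : Par N)
/-- the class of admissible data -/
def Adm (u : EE N → ℝ) : Prop := Measurable u ∧ ∀ x, 0 ≤ u x ∧ u x ≤ P.M
def tau (ε : ℝ) : ℝ := P.c * ε ^ 2
def pre (ε : ℝ) (u : EE N → ℝ) (x : EE N) : ℝ := u x + P.c * Dl ε (fun y => u y ^ P.m) x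
def St (V : EE N → ℝ) (ε : ℝ) (u : EE N → ℝ) (x : EE N) : ℝ := Gs P.q (P.tau ε * V x) (P.pre ε u x)
/-- admissible potentials -/
def AdmV (V : EE N → ℝ) : Prop := Measurable V ∧ (∀ x, 0 ≤ V x) ∧ Integrable (fun x => V x * xi x) ∧ Integrable (fun x => V x ^ 2 * xi x)
variable {P}
theorem tau_nonneg (ε : ℝ) : 0 ≤ P.tau ε := mul_nonneg P.hc.le (sq_nonneg _)
theorem tau_pos {ε : ℝ} (h : 0 < ε) : 0 < P.tau ε := mul_pos P.hc (by positivity)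
theorem NL : 2 * N * P.L * P.c ≤ 1 / 8 := by
  have := P.hcfl
  have h1 : (0:ℝ) ≤ N * P.c := mul_nonneg (Nat.cast_nonneg _) P.hc.le
  nlinarith
theorem Adm.pow {u : EE N → ℝ} (h : P.Adm u) : Measurable (fun x => u x ^ P.m) := h.1.pow_const _
theorem Adm.pow_nonneg {u : EE N → ℝ} (h : P.Adm u) (x) : 0 ≤ u x ^ P.m := Real.rpow_nonneg (h.2 x).1 _
theorem Adm.pow_le {u : EE N → ℝ} (h : P.Adm u) (x) : u x ^ P.m ≤ P.M ^ P.m := Real.rpow_le_rpow (h.2 x).1 (h.2 x).2 (by linarith [P.hm])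
theorem Dl_meas {f : EE N → ℝ} (hf : Measurable f) (ε) : Measurable (Dl ε f) := by
  unfold Dl; fun_prop
theorem Dl_eq (ε : ℝ) (f : EE N → ℝ) (x) : Dl ε f x = (∑ i, (f (x + ε • ee i) + f (x - ε • ee i))) - 2 * N * f x := by
  unfold Dl; rw [Finset.sum_sub_distrib]; simp; ring
theorem mono_lip {a b : ℝ} (ha : 0 ≤ a) (haM : a ≤ P.M) (hb : 0 ≤ b) (hbM : b ≤ P.M) :
    |(a - b) - 2 * N * P.c * (a ^ P.m - b ^ P.m)| ≤ |a - b| - 2 * N * P.c * |a ^ P.m - b ^ P.m| := by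
  have h1 := P.hLip a b ha haM hb hbM
  have h2 := P.NL
  have h3 : (0:ℝ) ≤ 2 * N * P.c := mul_nonneg (by positivity) P.hc.le
  have h4 := mul_le_mul_of_nonneg_left h1 h3
  have h5 : 2 * N * P.c * (P.L * |a - b|) ≤ |a - b| := by nlinarith [abs_nonneg (a - b)]
  rcases le_total a b with h | h
  · have := Real.rpow_le_rpow ha h (by linarith [P.hm] : 0 ≤ P.m)
    rw [abs_of_nonpos (sub_nonpos.2 h)] at *
    rw [abs_of_nonpos (sub_nonpos.2 this)] at *
    rw [abs_of_nonpos (by linarith)]; linarith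
  · have := Real.rpow_le_rpow hb h (by linarith [P.hm] : 0 ≤ P.m)
    rw [abs_of_nonneg (sub_nonneg.2 h)] at *
    rw [abs_of_nonneg (sub_nonneg.2 this)] at *
    rw [abs_of_nonneg (by linarith)]
theorem pre_diff {u v : EE N → ℝ} (hu : P.Adm u) (hv : P.Adm v) (ε : ℝ) (x) :
    |P.pre ε u x - P.pre ε v x| ≤ |u x - v x| + P.c * Dl ε (fun y => |u y ^ P.m - v y ^ P.m|) x := by
  unfold pre
  rw [Dl_eq, Dl_eq, Dl_eq]
  have h1 := mono_lip (hu.2 x).1 (hu.2 x).2 (hv.2 x).1 (hv.2 x).2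
  set S := ∑ i, ((u (x + ε • ee i) ^ P.m - v (x + ε • ee i) ^ P.m) + (u (x - ε • ee i) ^ P.m - v (x - ε • ee i) ^ P.m)) with hS
  have e1 : (u x + P.c * (∑ i, (u (x + ε • ee i) ^ P.m + u (x - ε • ee i) ^ P.m) - 2 * ↑N * u x ^ P.m) -
        (v x + P.c * (∑ i, (v (x + ε • ee i) ^ P.m + v (x - ε • ee i) ^ P.m) - 2 * ↑N * v x ^ P.m)))
      = ((u x - v x) - 2 * N * P.c * (u x ^ P.m - v x ^ P.m)) + P.c * S := by
    have : S = (∑ i, (u (x + ε • ee i) ^ P.m + u (x - ε • ee i) ^ P.m)) - ∑ i, (v (x + ε • ee i) ^ P.m + v (x - ε • ee i) ^ P.m) := by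
      rw [hS, ← Finset.sum_sub_distrib]; exact Finset.sum_congr rfl fun i _ => by ring
    rw [this]; ring
  rw [e1]
  have h2 : |S| ≤ ∑ i, (|u (x + ε • ee i) ^ P.m - v (x + ε • ee i) ^ P.m| + |u (x - ε • ee i) ^ P.m - v (x - ε • ee i) ^ P.m|) :=
    (Finset.abs_sum_le_sum_abs _ _).trans (Finset.sum_le_sum fun i _ => abs_add_le _ _)
  have h3 := mul_le_mul_of_nonneg_left h2 P.hc.le
  have h4 := abs_add_le ((u x - v x) - 2 * N * P.c * (u x ^ P.m - v x ^ P.m)) (P.c * S)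
  rw [abs_mul P.c, abs_of_pos P.hc] at h4
  linarith
theorem pre_nonneg {u : EE N → ℝ} (hu : P.Adm u) (ε : ℝ) (x) : 0 ≤ P.pre ε u x ∧ P.pre ε u x ≤ P.M := by
  unfold pre
  rw [Dl_eq]
  have hS0 : 0 ≤ ∑ i, (u (x + ε • ee i) ^ P.m + u (x - ε • ee i) ^ P.m) :=
    Finset.sum_nonneg fun i _ => add_nonneg (hu.pow_nonneg _) (hu.pow_nonneg _)
  have hS1 : ∑ i, (u (x + ε • ee i) ^ P.m + u (x - ε • ee i) ^ P.m) ≤ 2 * N * P.M ^ P.m := by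
    calc _ ≤ ∑ i : Fin N, (P.M ^ P.m + P.M ^ P.m) := Finset.sum_le_sum fun i _ => add_le_add (hu.pow_le _) (hu.pow_le _)
      _ = _ := by simp; ring
  have hm : P.m ≠ 0 := by linarith [P.hm]
  have h0 := mono_lip (P := P) (hu.2 x).1 (hu.2 x).2 le_rfl P.hM
  have h1 := mono_lip (P := P) P.hM le_rfl (hu.2 x).1 (hu.2 x).2
  rw [Real.zero_rpow hm] at h0
  have k0 := hu.pow_nonneg x
  have k1 := hu.pow_le x
  obtain ⟨l0, l1⟩ := hu.2 x
  rw [sub_zero, sub_zero, abs_of_nonneg l0, abs_of_nonneg k0] at h0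
  rw [abs_of_nonneg (sub_nonneg.2 l1), abs_of_nonneg (sub_nonneg.2 k1)] at h1
  have h0' := (abs_nonneg _).trans h0
  have h1' := (abs_nonneg _).trans h1
  have a1 := mul_nonneg P.hc.le hS0
  have a2 := mul_le_mul_of_nonneg_left hS1 P.hc.le
  constructor <;> nlinarith
theorem pre_meas {u : EE N → ℝ} (hu : P.Adm u) (ε : ℝ) : Measurable (P.pre ε u) :=
  hu.1.add ((Dl_meas hu.pow ε).const_mul _)
theorem St_adm {u V : EE N → ℝ} (hu : P.Adm u) (hV : Measurable V) (hV0 : ∀ x, 0 ≤ V x) (ε : ℝ) : P.Adm (P.St V ε u) := by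
  have h : ∀ x, 0 ≤ P.tau ε * V x := fun x => mul_nonneg (tau_nonneg _) (hV0 x)
  refine ⟨Gs_meas P.hq0 h (fun x => (pre_nonneg hu ε x).1) (hV.const_mul _) (pre_meas hu ε), fun x => ⟨?_, ?_⟩⟩
  · exact (Gs_spec P.hq0 (h x) (pre_nonneg hu ε x).1).1
  · exact (Gs_le P.hq0 (h x) (pre_nonneg hu ε x).1).trans (pre_nonneg hu ε x).2
theorem St_eq {u V : EE N → ℝ} (hu : P.Adm u) (hV0 : ∀ x, 0 ≤ V x) (ε : ℝ) (x) :
    P.St V ε u x = u x + P.c * Dl ε (fun y => u y ^ P.m) x - P.tau ε * V x * (P.St V ε u x) ^ P.q := by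
  have := (Gs_spec P.hq0 (mul_nonneg (tau_nonneg (P := P) ε) (hV0 x)) (pre_nonneg hu ε x).1).2
  unfold St pre at *
  linarith
theorem bdd_int {f : EE N → ℝ} (hf : Measurable f) {C : ℝ} (hC : ∀ x, |f x| ≤ C) : Integrable (fun x => f x * xi x) :=
  xi_int0.bdd_mul hf.aestronglyMeasurable (Eventually.of_forall hC)
theorem int_Dl {f : EE N → ℝ} (hf : Measurable f) {C : ℝ} (hC : ∀ x, |f x| ≤ C) (ε : ℝ) :
    ∫ x, Dl ε f x * xi x = ∫ x, f x * Dl ε xi x := by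
  have i1 : ∀ y, Integrable (fun x => f (x + y) * xi x) := fun y => bdd_int (by fun_prop) fun x => hC _
  have i2 : ∀ y, Integrable (fun x => f x * xi (x + y)) := fun y => (xi_int0.comp_add_right y).bdd_mul hf.aestronglyMeasurable (Eventually.of_forall hC)
  have e1 : ∀ x, Dl ε f x * xi x = ∑ i, (f (x + ε • ee i) * xi x + f (x + (-ε) • ee i) * xi x - 2 * (f x * xi x)) := by
    intro x; unfold Dl; rw [Finset.sum_mul]; refine Finset.sum_congr rfl fun i _ => ?_
    rw [sub_eq_add_neg x, neg_smul]; ring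
  have e2 : ∀ x, f x * Dl ε xi x = ∑ i, (f x * xi (x + ε • ee i) + f x * xi (x + (-ε) • ee i) - 2 * (f x * xi x)) := by
    intro x; unfold Dl; rw [Finset.mul_sum]; refine Finset.sum_congr rfl fun i _ => ?_
    rw [sub_eq_add_neg x, neg_smul]; ring
  have i0 : Integrable (fun x => f x * xi x) := bdd_int hf hC
  simp only [e1, e2]
  have j1 : ∀ i : Fin N, Integrable (fun x => f (x + ε • ee i) * xi x + f (x + (-ε) • ee i) * xi x - 2 * (f x * xi x)) :=
    fun i => ((i1 _).fun_add (i1 _)).sub (i0.const_mul 2)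
  have j2 : ∀ i : Fin N, Integrable (fun x => f x * xi (x + ε • ee i) + f x * xi (x + (-ε) • ee i) - 2 * (f x * xi x)) :=
    fun i => ((i2 _).fun_add (i2 _)).sub (i0.const_mul 2)
  rw [integral_finset_sum _ (fun i _ => j1 i), integral_finset_sum _ (fun i _ => j2 i)]
  refine Finset.sum_congr rfl fun i _ => ?_
  rw [integral_sub ((i1 _).fun_add (i1 _)) (i0.const_mul 2), integral_add (i1 _) (i1 _), integral_sub ((i2 _).fun_add (i2 _)) (i0.const_mul 2), integral_add (i2 _) (i2 _), int_shift, int_shift]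
  congr 1
  rw [add_comm]; congr 1 <;> · congr 1; ext x; congr 2; simp [sub_eq_add_neg]
theorem int_Dl_le {f : EE N → ℝ} (hf : Measurable f) {C : ℝ} (hC : ∀ x, |f x| ≤ C) (h0 : ∀ x, 0 ≤ f x) {ε : ℝ} (hε : |ε| ≤ 1) :
    ∫ x, Dl ε f x * xi x ≤ 2 * N * ε ^ 2 * ∫ x, f x * xi x := by
  rw [int_Dl hf hC, ← integral_const_mul]
  apply integral_mono
  · have : ∀ x, f x * Dl ε xi x = f x * ∑ i, (xi (x + ε • ee i) + xi (x - ε • ee i) - 2 * xi x) := fun x => rfl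
    simp only [this]
    refine Integrable.bdd_mul ?_ hf.aestronglyMeasurable (Eventually.of_forall hC)
    refine integrable_finset_sum _ fun i _ => ((xi_int0.comp_add_right _).fun_add (xi_int0.comp_sub_right _)).sub (xi_int0.const_mul 2)
  · exact (bdd_int hf hC).const_mul _
  · intro x
    have := mul_le_mul_of_nonneg_left (xi_Dl hε x) (h0 x)
    simp only; linarith
end Par
end

section
namespace Par
variable {N : ℕ} {P : Par N}
def nd (u v : EE N → ℝ) : ℝ := ∫ x, |u x - v x| * xi x
theorem Adm.int_sub {u v : EE N → ℝ} (hu : P.Adm u) (hv : P.Adm v) : Integrable (fun x => |u x - v x| * xi x) :=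
  bdd_int (C := P.M) (hu.1.sub hv.1).abs fun x => by
    rw [abs_abs, abs_le]; constructor <;> linarith [hu.2 x, hv.2 x]
theorem nd_nonneg (u v : EE N → ℝ) : 0 ≤ nd u v := integral_nonneg fun x => mul_nonneg (abs_nonneg _) (xi_pos x).le
theorem nd_comm (u v : EE N → ℝ) : nd u v = nd v u := by unfold nd; simp only [abs_sub_comm]
theorem nd_tri {u v w : EE N → ℝ} (hu : P.Adm u) (hv : P.Adm v) (hw : P.Adm w) : nd u w ≤ nd u v + nd v w := by
  unfold nd
  rw [← integral_add (hu.int_sub hv) (hv.int_sub hw)]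
  apply integral_mono (hu.int_sub hw) ((hu.int_sub hv).fun_add (hv.int_sub hw))
  intro x
  simp only [← add_mul]
  exact mul_le_mul_of_nonneg_right (abs_sub_le _ _ _) (xi_pos x).le
variable (P) in
def K : ℝ := 2 * N * P.L
theorem K_nonneg : 0 ≤ P.K := mul_nonneg (by positivity) P.hL
theorem contr {u v V V' : EE N → ℝ} (hu : P.Adm u) (hv : P.Adm v) (hV : AdmV V) (hV' : AdmV V') {ε : ℝ} (hε : |ε| ≤ 1) :
    nd (P.St V ε u) (P.St V' ε v) ≤ (1 + P.K * P.tau ε) * nd u v + P.tau ε * (P.M ^ P.q * ∫ x, |V x - V' x| * xi x) := by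
  have hVi : Integrable (fun x => |V x - V' x| * xi x) := by
    refine ((hV.2.2.1.sub hV'.2.2.1).abs).congr (Eventually.of_forall fun x => ?_)
    simp only [Pi.sub_apply]
    rw [← sub_mul, abs_mul, abs_of_pos (xi_pos x)]
  let f : EE N → ℝ := fun y => |u y ^ P.m - v y ^ P.m|
  have hfm : Measurable f := (hu.pow.sub hv.pow).abs
  have hfb : ∀ x, |f x| ≤ P.M ^ P.m := fun x => by
    simp only [f, abs_abs]; rw [abs_le]
    constructor <;> linarith [hu.pow_nonneg x, hv.pow_nonneg x, hu.pow_le x, hv.pow_le x]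
  have hDi : Integrable (fun x => Dl ε f x * xi x) := by
    have : ∀ x, Dl ε f x * xi x = ∑ i, (f (x + ε • ee i) + f (x - ε • ee i) - 2 * f x) * xi x := fun x => by
      unfold Dl; rw [Finset.sum_mul]
    simp only [this]
    refine integrable_finset_sum _ fun i _ => bdd_int (C := P.M ^ P.m + P.M ^ P.m + 2 * P.M ^ P.m) (by fun_prop) fun x => ?_
    refine (abs_sub _ _).trans (add_le_add ((abs_add_le _ _).trans (add_le_add (hfb _) (hfb _))) ?_)
    rw [abs_mul]; simpa using hfb x
  have h1 : ∀ x, |P.St V ε u x - P.St V' ε v x| * xi x ≤ (|u x - v x| * xi x + P.c * (Dl ε f x * xi x)) + P.tau ε * P.M ^ P.q * (|V x - V' x| * xi x) := by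
    intro x
    have h := Gs_contr P.hq0 (mul_nonneg (tau_nonneg (P := P) ε) (hV.2.1 x)) (pre_nonneg hu ε x).1
      (mul_nonneg (tau_nonneg (P := P) ε) (hV'.2.1 x)) (pre_nonneg hv ε x).1 (pre_nonneg hu ε x).2 (pre_nonneg hv ε x).2
    have h2 := pre_diff hu hv ε x
    rw [← mul_sub, abs_mul, abs_of_nonneg (tau_nonneg ε)] at h
    have := mul_le_mul_of_nonneg_right (h.trans (add_le_add_left h2 _)) (xi_pos x).le
    unfold St
    refine this.trans (le_of_eq ?_)
    simp only [f]; ring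
  have h2 := integral_mono ((St_adm hu hV.1 hV.2.1 ε).int_sub (St_adm hv hV'.1 hV'.2.1 ε))
    (((hu.int_sub hv).fun_add (hDi.const_mul P.c)).fun_add (hVi.const_mul _)) h1
  rw [integral_add ((hu.int_sub hv).fun_add (hDi.const_mul P.c)) (hVi.const_mul _), integral_add (hu.int_sub hv) (hDi.const_mul P.c),
    integral_const_mul, integral_const_mul] at h2
  have h3 := int_Dl_le hfm hfb (fun x => abs_nonneg _) hε
  have h4 : ∫ x, f x * xi x ≤ P.L * nd u v := by
    unfold nd; rw [← integral_const_mul]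
    apply integral_mono (bdd_int hfm hfb) ((hu.int_sub hv).const_mul _)
    intro x
    have := mul_le_mul_of_nonneg_right (P.hLip _ _ (hu.2 x).1 (hu.2 x).2 (hv.2 x).1 (hv.2 x).2) (xi_pos x).le
    simp only [f]; linarith
  have h5 := mul_le_mul_of_nonneg_left (h3.trans (mul_le_mul_of_nonneg_left h4 (by positivity))) P.hc.le
  have h6 : nd (P.St V ε u) (P.St V' ε v) = ∫ x, |P.St V ε u x - P.St V' ε v x| * xi x := rfl
  have h7 : nd u v = ∫ x, |u x - v x| * xi x := rfl
  rw [h6]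
  refine h2.trans ?_
  rw [← h7]
  unfold K tau at *
  linarith
variable (P) in
def it (V : EE N → ℝ) (ε : ℝ) (u : EE N → ℝ) (k : ℕ) : EE N → ℝ := (P.St V ε)^[k] u
theorem it_succ (V : EE N → ℝ) (ε : ℝ) (u : EE N → ℝ) (k : ℕ) : P.it V ε u (k+1) = P.St V ε (P.it V ε u k) :=
  Function.iterate_succ_apply' _ _ _
theorem it_add (V : EE N → ℝ) (ε : ℝ) (u : EE N → ℝ) (k l : ℕ) : P.it V ε u (k+l) = P.it V ε (P.it V ε u l) k :=
  Function.iterate_add_apply _ _ _ _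
theorem it_adm {u V : EE N → ℝ} (hu : P.Adm u) (hV : AdmV V) (ε : ℝ) (k : ℕ) : P.Adm (P.it V ε u k) := by
  induction k with
  | zero => exact hu
  | succ k ih => rw [it_succ]; exact St_adm ih hV.1 hV.2.1 ε
theorem it_contr {u v V V' : EE N → ℝ} (hu : P.Adm u) (hv : P.Adm v) (hV : AdmV V) (hV' : AdmV V') {ε : ℝ} (hε : |ε| ≤ 1) (k : ℕ) :
    nd (P.it V ε u k) (P.it V' ε v k) ≤ Real.exp (P.K * (k * P.tau ε)) * (nd u v + k * P.tau ε * (P.M ^ P.q * ∫ x, |V x - V' x| * xi x)) := by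
  have hA : 0 ≤ P.M ^ P.q * ∫ x, |V x - V' x| * xi x :=
    mul_nonneg (Real.rpow_nonneg P.hM _) (integral_nonneg fun x => mul_nonneg (abs_nonneg _) (xi_pos x).le)
  set A := P.M ^ P.q * ∫ x, |V x - V' x| * xi x
  have hK := P.K_nonneg
  have ht := tau_nonneg (P := P) ε
  induction k with
  | zero => simp [it]
  | succ k ih =>
    rw [it_succ, it_succ]
    have h1 := contr (it_adm hu hV ε k) (it_adm hv hV' ε k) hV hV' hε
    have h2 : 1 + P.K * P.tau ε ≤ Real.exp (P.K * P.tau ε) := by linarith [Real.add_one_le_exp (P.K * P.tau ε)]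
    have h3 : Real.exp (P.K * ((k+1:ℕ) * P.tau ε)) = Real.exp (P.K * P.tau ε) * Real.exp (P.K * (k * P.tau ε)) := by
      rw [← Real.exp_add]; push_cast; ring_nf
    have h4 : (1:ℝ) ≤ Real.exp (P.K * P.tau ε) * Real.exp (P.K * (k * P.tau ε)) := by
      rw [← Real.exp_add]; exact Real.one_le_exp (by positivity)
    have n0 := nd_nonneg (P.it V ε u k) (P.it V' ε v k)
    calc _ ≤ _ := h1
      _ ≤ Real.exp (P.K * P.tau ε) * (Real.exp (P.K * (k * P.tau ε)) * (nd u v + k * P.tau ε * A)) + (Real.exp (P.K * P.tau ε) * Real.exp (P.K * (k * P.tau ε))) * (P.tau ε * A) := by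
        refine add_le_add (mul_le_mul h2 ih n0 (Real.exp_pos _).le) ?_
        exact le_mul_of_one_le_left (by positivity) h4
      _ = _ := by rw [h3]; push_cast; ring
theorem it_contr0 {u v V : EE N → ℝ} (hu : P.Adm u) (hv : P.Adm v) (hV : AdmV V) {ε : ℝ} (hε : |ε| ≤ 1) (k : ℕ) :
    nd (P.it V ε u k) (P.it V ε v k) ≤ Real.exp (P.K * (k * P.tau ε)) * nd u v := by
  simpa using it_contr hu hv hV hV hε k
def tr (y : EE N) (f : EE N → ℝ) : EE N → ℝ := fun x => f (x + y)
theorem St_tr (V : EE N → ℝ) (ε : ℝ) (u : EE N → ℝ) (y : EE N) : P.St (tr y V) ε (tr y u) = tr y (P.St V ε u) := by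
  ext x
  simp only [St, tr, pre, Dl]
  have : ∀ z : EE N, x + z + y = x + y + z := fun z => by abel
  have h2 : ∀ z : EE N, x - z + y = x + y - z := fun z => by abel
  simp only [this, h2]
theorem it_tr (V : EE N → ℝ) (ε : ℝ) (u : EE N → ℝ) (y : EE N) (k : ℕ) : P.it (tr y V) ε (tr y u) k = tr y (P.it V ε u k) := by
  induction k with
  | zero => rfl
  | succ k ih => rw [it_succ, it_succ, ih, St_tr]
theorem Adm.tr {u : EE N → ℝ} (hu : P.Adm u) (y) : P.Adm (tr y u) := ⟨hu.1.comp (measurable_add_const y), fun x => hu.2 _⟩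
theorem it_space {u V : EE N → ℝ} (hu : P.Adm u) (hV : AdmV V) (y : EE N) (hV' : AdmV (Par.tr y V)) {ε : ℝ} (hε : |ε| ≤ 1) (k : ℕ) :
    nd (Par.tr y (P.it V ε u k)) (P.it V ε u k) ≤ Real.exp (P.K * (k * P.tau ε)) * (nd (Par.tr y u) u + k * P.tau ε * (P.M ^ P.q * ∫ x, |V (x + y) - V x| * xi x)) := by
  rw [← it_tr]
  exact it_contr (hu.tr y) hu hV' hV hε k
theorem it_time0 {v V : EE N → ℝ} (hv : P.Adm v) (hV : AdmV V) {C : ℝ} {ε : ℝ} (hε : |ε| ≤ 1)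
    (hC : ∀ x, |Dl ε (fun y => v y ^ P.m) x| ≤ C * ε ^ 2) (l : ℕ) :
    nd (P.it V ε v l) v ≤ Real.exp (P.K * (l * P.tau ε)) * (l * P.tau ε * (C * (∫ x, xi (x : EE N)) + P.M ^ P.q * ∫ x, V x * xi x)) := by
  have h1 : nd (P.St V ε v) v ≤ P.tau ε * (C * (∫ x, xi (x : EE N)) + P.M ^ P.q * ∫ x, V x * xi x) := by
    have : ∀ x, |P.St V ε v x - v x| * xi x ≤ P.tau ε * (C * xi x + P.M ^ P.q * (V x * xi x)) := by
      intro x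
      have h := Gs_contr (lam := P.tau ε * V x) (lam' := 0) P.hq0 (mul_nonneg (tau_nonneg (P := P) ε) (hV.2.1 x)) (pre_nonneg hv ε x).1 le_rfl (hv.2 x).1 (pre_nonneg hv ε x).2 (hv.2 x).2
      have e0 : Gs P.q 0 (v x) = v x := by
        have := (Gs_spec (lam := 0) P.hq0 le_rfl (hv.2 x).1).2
        linarith
      rw [e0, sub_zero, abs_of_nonneg (mul_nonneg (tau_nonneg ε) (hV.2.1 x))] at h
      have h2 : |P.pre ε v x - v x| ≤ P.c * (C * ε ^ 2) := by
        unfold pre; rw [add_sub_cancel_left, abs_mul, abs_of_pos P.hc]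
        exact mul_le_mul_of_nonneg_left (hC x) P.hc.le
      have h3 := mul_le_mul_of_nonneg_right (h.trans (add_le_add_left h2 _)) (xi_pos x).le
      refine h3.trans (le_of_eq ?_)
      unfold tau; ring
    have i1 : Integrable (fun x => C * xi x + P.M ^ P.q * (V x * xi x)) := (xi_int0.const_mul C).fun_add (hV.2.2.1.const_mul _)
    have := integral_mono ((St_adm hv hV.1 hV.2.1 ε).int_sub hv) (i1.const_mul _) this
    rwa [integral_const_mul, integral_add (xi_int0.const_mul C) (hV.2.2.1.const_mul _), integral_const_mul, integral_const_mul] at this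
  set B := C * (∫ x, xi (x : EE N)) + P.M ^ P.q * ∫ x, V x * xi x
  have hK := P.K_nonneg
  have ht := tau_nonneg (P := P) ε
  have hB : 0 ≤ P.tau ε * B := (nd_nonneg _ _).trans h1
  induction l with
  | zero => simp [it, nd]
  | succ l ih =>
    have h2 : nd (P.it V ε v (l+1)) (P.it V ε v l) ≤ Real.exp (P.K * (l * P.tau ε)) * (P.tau ε * B) := by
      have h := it_contr0 (St_adm hv hV.1 hV.2.1 ε) hv hV hε l
      exact h.trans (mul_le_mul_of_nonneg_left h1 (Real.exp_pos _).le)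
    have h3 := nd_tri (it_adm hv hV ε (l+1)) (it_adm hv hV ε l) hv
    have h4 : Real.exp (P.K * (l * P.tau ε)) ≤ Real.exp (P.K * ((l+1:ℕ) * P.tau ε)) := by
      gcongr; simp
    calc _ ≤ _ := h3
      _ ≤ Real.exp (P.K * (l * P.tau ε)) * (P.tau ε * B) + Real.exp (P.K * (l * P.tau ε)) * (l * P.tau ε * B) := add_le_add h2 ih
      _ = Real.exp (P.K * (l * P.tau ε)) * ((l+1) * (P.tau ε * B)) := by ring
      _ ≤ Real.exp (P.K * ((l+1:ℕ) * P.tau ε)) * ((l+1) * (P.tau ε * B)) := mul_le_mul_of_nonneg_right h4 (by positivity)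
      _ = _ := by push_cast; ring
theorem it_time {u v V : EE N → ℝ} (hu : P.Adm u) (hv : P.Adm v) (hV : AdmV V) {C : ℝ} {ε : ℝ} (hε : |ε| ≤ 1)
    (hC : ∀ x, |Dl ε (fun y => v y ^ P.m) x| ≤ C * ε ^ 2) (k l : ℕ) :
    nd (P.it V ε u (k+l)) (P.it V ε u k) ≤ Real.exp (P.K * ((k+l:ℕ) * P.tau ε)) *
      (2 * nd u v + l * P.tau ε * (C * (∫ x, xi (x : EE N)) + P.M ^ P.q * ∫ x, V x * xi x)) := by
  have hK := P.K_nonneg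
  have ht := tau_nonneg (P := P) ε
  rw [it_add]
  have h1 := it_contr0 (it_adm hu hV ε l) hu hV hε k
  have h2 := nd_tri (it_adm hu hV ε l) (it_adm hv hV ε l) hu
  have h3 := nd_tri (it_adm hv hV ε l) hv hu
  have h4 := it_contr0 hu hv hV hε l
  have h5 := it_time0 hv hV hε hC l
  rw [nd_comm v u] at h3
  set B := C * (∫ x, xi (x : EE N)) + P.M ^ P.q * ∫ x, V x * xi x
  have h6 : 1 ≤ Real.exp (P.K * (l * P.tau ε)) := Real.one_le_exp (by positivity)
  have h7 : Real.exp (P.K * ((k+l:ℕ) * P.tau ε)) = Real.exp (P.K * (k * P.tau ε)) * Real.exp (P.K * (l * P.tau ε)) := by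
    rw [← Real.exp_add]; push_cast; ring_nf
  rw [h7, mul_assoc]
  refine h1.trans (mul_le_mul_of_nonneg_left ?_ (Real.exp_pos _).le)
  have h8 := le_mul_of_one_le_left (nd_nonneg u v) h6
  linarith
end Par
end

section
namespace Par
variable {N : ℕ} {P : Par N}
theorem growth_int {f : EE N → ℝ} (hf : Measurable f) {C p : ℝ} (hp : 0 ≤ p) (h : ∀ x, |f x| ≤ C * (1 + ‖x‖) ^ p) :
    Integrable (fun x => f x * xi x) := by
  refine ((xi_int (N := N) p hp).const_mul C).mono' (hf.mul xi_meas).aestronglyMeasurable (Eventually.of_forall fun x => ?_)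
  rw [norm_mul, Real.norm_eq_abs, Real.norm_of_nonneg (xi_pos x).le, ← mul_assoc]
  exact mul_le_mul_of_nonneg_right (h x) (xi_pos x).le
def Vp (N : ℕ) (σ : ℝ) : EE N → ℝ := fun x => ‖x‖ ^ σ
theorem Vp_le {σ : ℝ} (hσ : 0 < σ) (x y : EE N) : Vp N σ (x + y) ≤ (1 + ‖y‖) ^ σ * (1 + ‖x‖) ^ σ := by
  unfold Vp
  rw [← Real.mul_rpow (by positivity) (by positivity)]
  refine Real.rpow_le_rpow (norm_nonneg _) ?_ hσ.le
  nlinarith [norm_add_le x y, norm_nonneg x, norm_nonneg y]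
theorem Vp_cont {σ : ℝ} (hσ : 0 < σ) : Continuous (Vp N σ) := continuous_norm.rpow_const fun x => Or.inr hσ.le
theorem Vp_nonneg {σ : ℝ} (x) : 0 ≤ Vp N σ x := Real.rpow_nonneg (norm_nonneg _) _
theorem Vp_tr_adm {σ : ℝ} (hσ : 0 < σ) (y : EE N) : AdmV (tr y (Vp N σ)) := by
  have hm : Measurable (tr y (Vp N σ)) := (Vp_cont hσ).measurable.comp (measurable_add_const y)
  refine ⟨hm, fun x => Vp_nonneg _, growth_int hm (C := (1 + ‖y‖) ^ σ) hσ.le fun x => ?_, growth_int (hm.pow_const 2) (p := 2 * σ) (C := ((1 + ‖y‖) ^ σ) ^ 2) (by linarith) fun x => ?_⟩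
  · rw [tr, abs_of_nonneg (Vp_nonneg _)]; exact Vp_le hσ x y
  · rw [tr, abs_of_nonneg (by positivity)]
    calc _ ≤ ((1 + ‖y‖) ^ σ * (1 + ‖x‖) ^ σ) ^ 2 := pow_le_pow_left₀ (Vp_nonneg _) (Vp_le hσ x y) 2
      _ = _ := by rw [mul_pow]; congr 1; rw [← Real.rpow_natCast, ← Real.rpow_mul (by positivity)]; congr 1; push_cast; ring
theorem tr_zero (f : EE N → ℝ) : tr 0 f = f := by ext x; simp [tr]
theorem Vp_adm {σ : ℝ} (hσ : 0 < σ) : AdmV (Vp N σ) := by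
  have := Vp_tr_adm (N := N) hσ 0
  rwa [tr_zero] at this
theorem omega_V {σ : ℝ} (hσ : 0 < σ) : Tendsto (fun y : EE N => ∫ x, |Vp N σ (x + y) - Vp N σ x| * xi x) (𝓝 0) (𝓝 0) := by
  have h0 : (0:ℝ) = ∫ x : EE N, |Vp N σ (x + 0) - Vp N σ x| * xi x := by simp
  rw [h0]
  have hc := Vp_cont (N := N) hσ
  apply tendsto_integral_filter_of_dominated_convergence (fun x => (2 ^ σ * (1 + ‖x‖) ^ σ + (1 + ‖x‖) ^ σ) * xi x)
  · refine Eventually.of_forall fun y => ?_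
    exact Continuous.aestronglyMeasurable (by have := xi_cont (N := N); fun_prop)
  · filter_upwards [Metric.ball_mem_nhds (0 : EE N) one_pos] with y hy
    refine Eventually.of_forall fun x => ?_
    rw [norm_mul, Real.norm_eq_abs, abs_abs, Real.norm_of_nonneg (xi_pos x).le]
    refine mul_le_mul_of_nonneg_right ?_ (xi_pos x).le
    refine (abs_sub _ _).trans (add_le_add ?_ ?_)
    · rw [abs_of_nonneg (Vp_nonneg _)]
      refine (Vp_le hσ x y).trans (mul_le_mul_of_nonneg_right (Real.rpow_le_rpow (by positivity) ?_ hσ.le) (by positivity))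
      simp at hy; linarith
    · rw [abs_of_nonneg (Vp_nonneg _)]
      simpa using Vp_le hσ x 0
  · simp only [add_mul, mul_assoc]
    exact ((xi_int σ hσ.le).const_mul _).add (xi_int σ hσ.le)
  · refine Eventually.of_forall fun x => Continuous.tendsto (by fun_prop) 0
theorem omega_u {u : EE N → ℝ} (hu : P.Adm u) : Tendsto (fun y : EE N => nd (tr y u) u) (𝓝 0) (𝓝 0) := by
  have hi : Integrable (fun x => u x * xi x) := bdd_int hu.1 (C := P.M) fun x => by
    rw [abs_of_nonneg (hu.2 x).1]; exact (hu.2 x).2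
  have h1 := trans_L1 hi
  have h2 := trans_L1 (xi_int0 (N := N))
  have h3 := h1.add (h2.const_mul P.M)
  rw [mul_zero, add_zero] at h3
  refine squeeze_zero (fun y => nd_nonneg _ _) (fun y => ?_) h3
  unfold nd
  have j1 : Integrable (fun x => |u (x+y) * xi (x+y) - u x * xi x|) := ((hi.comp_add_right y).sub hi).abs
  have j2 : Integrable (fun x => |xi (x+y) - xi (x : EE N)|) := ((xi_int0.comp_add_right y).sub xi_int0).abs
  rw [← integral_const_mul, ← integral_add j1 (j2.const_mul _)]
  apply integral_mono ((hu.tr y).int_sub hu) (j1.fun_add (j2.const_mul _))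
  intro x
  simp only [tr]
  have e : (u (x+y) - u x) * xi x = (u (x+y) * xi (x+y) - u x * xi x) - u (x+y) * (xi (x+y) - xi x) := by ring
  rw [← abs_of_pos (xi_pos x), ← abs_mul, abs_of_pos (xi_pos x), e]
  refine (abs_sub _ _).trans (add_le_add_right ?_ _)
  rw [abs_mul, abs_of_nonneg (hu.2 _).1]
  exact mul_le_mul_of_nonneg_right (hu.2 _).2 (abs_nonneg _)
theorem second_diff {ρ : EE N → ℝ} (h1 : ContDiff ℝ 2 ρ) (h2 : HasCompactSupport ρ) :
    ∃ C : ℝ, 0 ≤ C ∧ ∀ y h : EE N, |ρ (y + h) + ρ (y - h) - 2 * ρ y| ≤ C * ‖h‖ ^ 2 := by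
  obtain ⟨K, hK⟩ := ContDiff.lipschitzWith_of_hasCompactSupport (h2.fderiv ℝ) (h1.fderiv_right (m := 1) le_rfl) one_ne_zero
  refine ⟨2 * K, by positivity, fun y h => ?_⟩
  have hd : ∀ x, HasFDerivAt ρ (fderiv ℝ ρ x) x := fun x => (h1.differentiable (by norm_num) x).hasFDerivAt
  have hg : ∀ s : ℝ, HasDerivAt (fun s : ℝ => ρ (y + s • h) + ρ (y - s • h)) (fderiv ℝ ρ (y + s • h) h - fderiv ℝ ρ (y - s • h) h) s := by
    intro s
    have a1 : HasDerivAt (fun s : ℝ => y + s • h) h s := by simpa using ((hasDerivAt_id s).smul_const h).const_add y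
    have a2 : HasDerivAt (fun s : ℝ => y - s • h) (-h) s := by simpa using ((hasDerivAt_id s).smul_const h).const_sub y
    have b1 := (hd (y + s • h)).comp_hasDerivAt s a1
    have b2 := (hd (y - s • h)).comp_hasDerivAt s a2
    have := b1.add b2
    rw [map_neg, ← sub_eq_add_neg] at this
    exact this
  have := Convex.norm_image_sub_le_of_norm_hasDerivWithin_le (s := Icc (0:ℝ) 1) (C := 2 * K * ‖h‖ ^ 2) (x := 0) (y := 1)
    (fun s hs => (hg s).hasDerivWithinAt) (fun s hs => by
      rw [← ContinuousLinearMap.sub_apply]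
      refine (ContinuousLinearMap.le_opNorm _ _).trans ?_
      have := hK.dist_le_mul (y + s • h) (y - s • h)
      rw [dist_eq_norm, dist_eq_norm] at this
      have e : y + s • h - (y - s • h) = (2 * s) • h := by rw [mul_smul, two_smul]; abel
      rw [e, norm_smul, Real.norm_of_nonneg (by linarith [hs.1])] at this
      have h3 : 2 * s * ‖h‖ ≤ 2 * ‖h‖ := by nlinarith [hs.2, norm_nonneg h]
      calc _ ≤ (K * (2 * ‖h‖)) * ‖h‖ := mul_le_mul_of_nonneg_right (this.trans (mul_le_mul_of_nonneg_left h3 K.2)) (norm_nonneg _)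
        _ = _ := by ring) (convex_Icc 0 1) ⟨le_rfl, zero_le_one⟩ ⟨zero_le_one, le_rfl⟩
  simp only [one_smul, zero_smul, add_zero, sub_zero, norm_one, mul_one, Real.norm_eq_abs] at this
  convert this using 2; ring
theorem ee_norm (i : Fin N) : ‖(ee i : EE N)‖ = 1 := by simp [ee]
open Convolution in
theorem approx {u : EE N → ℝ} (hu : P.Adm u) {η : ℝ} (hη : 0 < η) :
    ∃ v : EE N → ℝ, P.Adm v ∧ (∃ C : ℝ, ∀ ε : ℝ, |ε| ≤ 1 → ∀ x, |Dl ε (fun y => v y ^ P.m) x| ≤ C * ε ^ 2) ∧ nd u v ≤ η := by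
  let w : EE N → ℝ := fun x => u x ^ P.m
  have hm0 : 0 < P.m := by linarith [P.hm]
  have hMm : 0 ≤ P.M ^ P.m := Real.rpow_nonneg P.hM _
  let φ : ℕ → ContDiffBump (0 : EE N) := fun n => ⟨1 / (2 * ((n:ℝ) + 1)), 1 / ((n:ℝ)+1), by positivity, by
    apply one_div_lt_one_div_of_lt <;> linarith [(Nat.cast_nonneg n : (0:ℝ) ≤ n)]⟩
  have hφ0 : Tendsto (fun n => (φ n).rOut) atTop (𝓝 0) := tendsto_one_div_add_atTop_nhds_zero_nat
  have hwb : ∀ x, ‖w x‖ ≤ P.M ^ P.m := fun x => by rw [Real.norm_of_nonneg (hu.pow_nonneg x)]; exact hu.pow_le x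
  have hwl : LocallyIntegrable w := by
    apply (locallyIntegrable_const (P.M ^ P.m)).mono hu.pow.aestronglyMeasurable
    exact Eventually.of_forall fun x => by rw [Real.norm_of_nonneg hMm]; exact hwb x
  have hae := ContDiffBump.ae_convolution_tendsto_right_of_locallyIntegrable (μ := (volume : Measure (EE N))) (φ := φ) (K := 2) hφ0
    (Eventually.of_forall fun n => by simp only [φ]; exact le_of_eq (by field_simp)) hwl
  let f : ℕ → EE N → ℝ := fun n x => ∫ t, (φ n).normed volume t * w (x - t)
  have hρi : ∀ n, Integrable ((φ n).normed volume) := fun n => (φ n).integrable_normed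
  have hfi : ∀ n x, Integrable (fun t => (φ n).normed volume t * w (x - t)) := fun n x =>
    (hρi n).mul_bdd (c := P.M ^ P.m) (hu.pow.comp (measurable_const_sub x)).aestronglyMeasurable (Eventually.of_forall fun t => hwb _)
  have hf0 : ∀ n x, 0 ≤ f n x := fun n x => integral_nonneg fun t => mul_nonneg ((φ n).nonneg_normed t) (hu.pow_nonneg _)
  have hf1 : ∀ n x, f n x ≤ P.M ^ P.m := fun n x => by
    calc f n x ≤ ∫ t, (φ n).normed volume t * P.M ^ P.m := integral_mono (hfi n x) ((hρi n).mul_const _) fun t =>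
          mul_le_mul_of_nonneg_left (hu.pow_le _) ((φ n).nonneg_normed t)
      _ = _ := by rw [integral_mul_const, (φ n).integral_normed, one_mul]
  have hfm : ∀ n, Measurable (f n) := fun n => by
    have : StronglyMeasurable (Function.uncurry fun x t => (φ n).normed volume t * w (x - t)) := by
      apply Measurable.stronglyMeasurable
      have h1 : Measurable ((φ n).normed volume) := (φ n).continuous_normed.measurable
      have h2 : Measurable w := hu.pow
      simp only [Function.uncurry_def]
      fun_prop
    exact this.integral_prod_right.measurable
  let v : ℕ → EE N → ℝ := fun n x => f n x ^ (P.m)⁻¹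
  have hv : ∀ n, P.Adm (v n) := fun n => by
    refine ⟨(hfm n).pow_const _, fun x => ⟨Real.rpow_nonneg (hf0 n x) _, ?_⟩⟩
    calc _ ≤ (P.M ^ P.m) ^ (P.m)⁻¹ := Real.rpow_le_rpow (hf0 n x) (hf1 n x) (by positivity)
      _ = P.M := Real.rpow_rpow_inv P.hM hm0.ne'
  have hlim : Tendsto (fun n => nd u (v n)) atTop (𝓝 0) := by
    have : (0:ℝ) = ∫ x : EE N, (0:ℝ) := by simp
    rw [this]
    apply tendsto_integral_of_dominated_convergence (fun x => P.M * xi x)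
    · exact fun n => (hu.int_sub (hv n)).aestronglyMeasurable
    · exact xi_int0.const_mul _
    · refine fun n => Eventually.of_forall fun x => ?_
      rw [norm_mul, Real.norm_eq_abs, abs_abs, Real.norm_of_nonneg (xi_pos x).le]
      refine mul_le_mul_of_nonneg_right ?_ (xi_pos x).le
      rw [abs_le]; constructor <;> linarith [hu.2 x, (hv n).2 x]
    · filter_upwards [hae] with x hx
      have h1 : Tendsto (fun n => f n x) atTop (𝓝 (w x)) := by
        refine hx.congr fun n => ?_
        rw [convolution_def]; simp [f]
      have h2 := h1.rpow_const (p := (P.m)⁻¹) (Or.inr (by positivity))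
      have h3 : w x ^ (P.m)⁻¹ = u x := Real.rpow_rpow_inv (hu.2 x).1 hm0.ne'
      rw [h3] at h2
      have h4 := ((tendsto_const_nhds (x := u x)).sub h2).abs.mul_const (xi x)
      simpa using h4
  obtain ⟨n, hn⟩ := (hlim.eventually (gt_mem_nhds hη)).exists
  refine ⟨v n, hv n, ?_, hn.le⟩
  have hvf : ∀ x, v n x ^ P.m = f n x := fun x => Real.rpow_inv_rpow (hf0 n x) hm0.ne'
  simp only [hvf]
  set ρ := (φ n).normed volume
  obtain ⟨C, hC0, hC⟩ := second_diff (ρ := ρ) ((φ n).contDiff_normed (n := 2)) (φ n).hasCompactSupport_normed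
  let R := (φ n).rOut + 1
  have hDρ : ∀ ε : ℝ, |ε| ≤ 1 → ∀ y, |Dl ε ρ y| ≤ (Metric.closedBall (0 : EE N) R).indicator (fun _ => N * C * ε ^ 2) y := by
    intro ε hε y
    have hs : ∀ z : EE N, (φ n).rOut < ‖z‖ → ρ z = 0 := fun z hz => by
      have : z ∉ Function.support ρ := by
        rw [(φ n).support_normed_eq]; simp; exact hz.le
      simpa using this
    by_cases hy : y ∈ Metric.closedBall (0 : EE N) R
    · rw [indicator_of_mem hy]
      refine (Finset.abs_sum_le_sum_abs _ _).trans ?_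
      refine (Finset.sum_le_sum fun i _ => hC y (ε • ee i)).trans ?_
      simp [norm_smul, ee_norm]; linarith
    · rw [indicator_of_notMem hy]
      have hy' : R < ‖y‖ := by simpa using hy
      have k : ∀ i : Fin N, ‖ε • (ee i : EE N)‖ ≤ 1 := fun i => by rw [norm_smul, ee_norm, mul_one]; exact hε
      unfold Dl
      rw [Finset.sum_eq_zero, abs_zero]
      intro i _
      have q1 := norm_sub_norm_le y (-(ε • ee i))
      have q2 := norm_sub_norm_le y ((ε • ee i))
      rw [sub_neg_eq_add, norm_neg] at q1
      rw [hs _ (by have := k i; simp only [R] at hy'; linarith), hs _ (by have := k i; simp only [R] at hy'; linarith), hs _ (by simp only [R] at hy'; linarith)]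
      simp
  refine ⟨N * C * volume.real (Metric.closedBall (0 : EE N) R) * P.M ^ P.m, fun ε hε x => ?_⟩
  have hf' : ∀ z, f n z = ∫ t, ρ (z - t) * w t := fun z => by
    simp only [f]
    rw [← integral_sub_left_eq_self _ volume z]
    simp; rfl
  have hji : ∀ z, Integrable (fun t => ρ (z - t) * w t) := fun z => by
    have := (hfi n z).comp_sub_left z
    simpa using this
  have e1 : Dl ε (f n) x = ∫ t, Dl ε ρ (x - t) * w t := by
    have : ∀ t, Dl ε ρ (x - t) * w t = ∑ i, (ρ (x + ε • ee i - t) * w t + ρ (x - ε • ee i - t) * w t - 2 * (ρ (x - t) * w t)) := by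
      intro t; unfold Dl; rw [Finset.sum_mul]; refine Finset.sum_congr rfl fun i _ => ?_
      have a1 : x - t + ε • ee i = x + ε • ee i - t := by abel
      have a2 : x - t - ε • ee i = x - ε • ee i - t := by abel
      rw [a1, a2]; ring
    simp only [this]
    have j1 : ∀ i : Fin N, Integrable (fun t => ρ (x + ε • ee i - t) * w t + ρ (x - ε • ee i - t) * w t - 2 * (ρ (x - t) * w t)) :=
      fun i => ((hji _).fun_add (hji _)).sub ((hji _).const_mul 2)
    rw [integral_finset_sum _ fun i _ => j1 i]
    unfold Dl
    refine Finset.sum_congr rfl fun i _ => ?_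
    rw [integral_sub ((hji _).fun_add (hji _)) ((hji _).const_mul 2), integral_add (hji _) (hji _), integral_const_mul, hf', hf', hf']
  rw [show Dl ε (fun y => f n y) x = Dl ε (f n) x from rfl, e1]
  have hind : Integrable ((Metric.closedBall (0 : EE N) R).indicator (fun _ => N * C * ε ^ 2)) :=
    (integrable_indicator_iff Metric.isClosed_closedBall.measurableSet).2 (integrableOn_const measure_closedBall_lt_top.ne)
  have := norm_integral_le_of_norm_le (f := fun t => Dl ε ρ (x - t) * w t) ((hind.comp_sub_left x).mul_const (P.M ^ P.m))
    (Eventually.of_forall fun t => by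
      rw [norm_mul, Real.norm_eq_abs]
      exact mul_le_mul (hDρ ε hε _) (hwb t) (norm_nonneg _) ((abs_nonneg _).trans (hDρ ε hε _)))
  rw [Real.norm_eq_abs] at this
  refine this.trans (le_of_eq ?_)
  rw [integral_mul_const, integral_sub_left_eq_self, integral_indicator Metric.isClosed_closedBall.measurableSet, setIntegral_const]
  simp only [smul_eq_mul]; ring
end Par
end

section
namespace Par
variable {N : ℕ} {P : Par N}
def Sq (ε : ℝ) (w : EE N → ℝ) (x : EE N) : ℝ := ∑ i, ((w (x + ε • ee i) - w x) ^ 2 + (w (x - ε • ee i) - w x) ^ 2)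
variable (P) in
def Phi (r : ℝ) : ℝ := r ^ (P.m + 1) / (P.m + 1)
theorem Phi_ineq {a b : ℝ} (ha : 0 ≤ a) (hb : 0 ≤ b) : P.Phi b ≤ P.Phi a + b ^ P.m * (b - a) := by
  have hm := P.hm
  have hpq : (P.m + 1).HolderConjugate ((P.m + 1) / P.m) := by
    rw [Real.holderConjugate_iff]; constructor
    · linarith
    · field_simp; ring
  have := Real.young_inequality_of_nonneg ha (Real.rpow_nonneg hb P.m) hpq
  rw [← Real.rpow_mul hb, mul_div_cancel₀ _ (by linarith : P.m ≠ 0)] at this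
  have e : b ^ P.m * b = b ^ (P.m + 1) := by rw [Real.rpow_add_one' hb (by linarith)]
  unfold Phi
  have e2 : b ^ (P.m + 1) / ((P.m + 1) / P.m) = b ^ (P.m+1) - b ^ (P.m+1) / (P.m+1) := by field_simp; ring
  rw [e2] at this
  rw [mul_sub, e]; linarith
theorem Dl_sq (ε : ℝ) (w : EE N → ℝ) (x) : Dl ε (fun y => w y ^ 2) x = Sq ε w x + 2 * (w x * Dl ε w x) := by
  unfold Dl Sq
  rw [Finset.mul_sum, Finset.mul_sum, ← Finset.sum_add_distrib]
  exact Finset.sum_congr rfl fun i _ => by ring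
theorem Dl_cs (ε : ℝ) (w : EE N → ℝ) (x) : (Dl ε w x) ^ 2 ≤ 2 * N * Sq ε w x := by
  unfold Dl Sq
  refine (sq_sum_le_card_mul_sum_sq).trans ?_
  simp only [Finset.card_univ, Fintype.card_fin]
  have hi : ∀ i : Fin N, (w (x + ε • ee i) + w (x - ε • ee i) - 2 * w x) ^ 2 ≤ 2 * ((w (x + ε • ee i) - w x) ^ 2 + (w (x - ε • ee i) - w x) ^ 2) := fun i => by
    nlinarith [sq_nonneg ((w (x + ε • ee i) - w x) - (w (x - ε • ee i) - w x))]
  have h2 := Finset.sum_le_sum fun i (_ : i ∈ Finset.univ) => hi i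
  rw [← Finset.mul_sum] at h2
  have := mul_le_mul_of_nonneg_left h2 (Nat.cast_nonneg (α := ℝ) N)
  linarith
theorem Sq_nonneg (ε : ℝ) (w : EE N → ℝ) (x) : 0 ≤ Sq ε w x := Finset.sum_nonneg fun i _ => by positivity
theorem Phi_nonneg {a : ℝ} (ha : 0 ≤ a) : 0 ≤ P.Phi a := by
  have := P.hm; have := Real.rpow_nonneg ha (P.m+1); unfold Phi; positivity
theorem Phi_le {a b : ℝ} (ha : 0 ≤ a) (h : a ≤ b) : P.Phi a ≤ P.Phi b := by
  have := P.hm; unfold Phi; gcongr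
theorem energy_pt {u V : EE N → ℝ} (hu : P.Adm u) (hV : AdmV V) (ε : ℝ) (x) :
    P.Phi (P.St V ε u x) + P.c / 4 * Sq ε (fun y => u y ^ P.m) x ≤
      P.Phi (u x) + P.c / 2 * Dl ε (fun y => (u y ^ P.m) ^ 2) x + 2 * P.L * (P.tau ε * P.M ^ P.q) ^ 2 * V x ^ 2 := by
  have hs := St_adm hu hV.1 hV.2.1 ε
  have h1 := Phi_ineq (P := P) (hu.2 x).1 (hs.2 x).1
  have h2 := P.hLip _ _ (hs.2 x).1 (hs.2 x).2 (hu.2 x).1 (hu.2 x).2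
  have h3 := St_eq hu hV.2.1 ε x
  have h4 := Dl_cs ε (fun y => u y ^ P.m) x
  have h5 := Sq_nonneg ε (fun y => u y ^ P.m) x
  rw [Dl_sq ε (fun y => u y ^ P.m) x]
  have hVq : 0 ≤ P.tau ε * V x * (P.St V ε u x) ^ P.q := mul_nonneg (mul_nonneg (tau_nonneg ε) (hV.2.1 x)) (Real.rpow_nonneg (hs.2 x).1 _)
  have hVq2 : P.tau ε * V x * (P.St V ε u x) ^ P.q ≤ (P.tau ε * P.M ^ P.q) * V x := by
    have := mul_le_mul_of_nonneg_left (Real.rpow_le_rpow (hs.2 x).1 (hs.2 x).2 P.hq0.le) (mul_nonneg (tau_nonneg (P := P) ε) (hV.2.1 x))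
    linarith
  have hw := hu.pow_nonneg x
  have hNL := P.NL
  have hc := P.hc
  have hL := P.hL
  set s := P.St V ε u x
  set D := Dl ε (fun y => u y ^ P.m) x
  set S := Sq ε (fun y => u y ^ P.m) x
  set F := P.tau ε * V x * s ^ P.q
  set B := (P.tau ε * P.M ^ P.q) * V x
  have hB : 2 * P.L * (P.tau ε * P.M ^ P.q) ^ 2 * V x ^ 2 = 2 * P.L * B ^ 2 := by simp only [B]; ring
  rw [hB]
  set w := u x ^ P.m
  have hd : s - u x = P.c * D - F := by linarith
  have k1 : (s ^ P.m - w) * (s - u x) ≤ P.L * (s - u x) ^ 2 := by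
    calc _ ≤ |(s ^ P.m - w) * (s - u x)| := le_abs_self _
      _ ≤ (P.L * |s - u x|) * |s - u x| := by rw [abs_mul]; exact mul_le_mul_of_nonneg_right h2 (abs_nonneg _)
      _ = _ := by rw [mul_assoc, ← abs_mul, abs_of_nonneg (mul_self_nonneg _)]; ring
  have k2 : (s - u x) ^ 2 ≤ 2 * (P.c * D) ^ 2 + 2 * B ^ 2 := by
    rw [hd]; have : F ^ 2 ≤ B ^ 2 := pow_le_pow_left₀ hVq hVq2 2
    nlinarith [sq_nonneg (P.c * D + F)]
  have k3 : P.L * (2 * (P.c * D) ^ 2) ≤ P.c / 4 * S := by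
    have a : P.L * (2 * (P.c * D) ^ 2) = (2 * P.L * P.c ^ 2) * D ^ 2 := by ring
    rw [a]
    have b := mul_le_mul_of_nonneg_left h4 (by positivity : 0 ≤ 2 * P.L * P.c ^ 2)
    have cc := mul_le_mul_of_nonneg_right hNL (mul_nonneg hc.le h5)
    nlinarith
  have k4 := mul_le_mul_of_nonneg_left k2 hL
  have k5 : w * (s - u x) ≤ P.c * (w * D) := by rw [hd]; nlinarith [mul_nonneg hw hVq]
  nlinarith
variable (P) in
def Y (u : EE N → ℝ) : ℝ := ∫ x, P.Phi (u x) * xi x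
theorem Phi_int {u : EE N → ℝ} (hu : P.Adm u) : Integrable (fun x => P.Phi (u x) * xi x) := by
  refine bdd_int (C := P.Phi P.M) ?_ fun x => ?_
  · exact (hu.1.pow_const _).div_const _
  · rw [abs_of_nonneg (Phi_nonneg (hu.2 x).1)]; exact Phi_le (hu.2 x).1 (hu.2 x).2
theorem Y_nonneg {u : EE N → ℝ} (hu : P.Adm u) : 0 ≤ P.Y u := integral_nonneg fun x => mul_nonneg (Phi_nonneg (hu.2 x).1) (xi_pos x).le
theorem Y_le {u : EE N → ℝ} (hu : P.Adm u) : P.Y u ≤ P.Phi P.M * ∫ x : EE N, xi x := by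
  unfold Y; rw [← integral_const_mul]
  exact integral_mono (Phi_int hu) (xi_int0.const_mul _) fun x => mul_le_mul_of_nonneg_right (Phi_le (hu.2 x).1 (hu.2 x).2) (xi_pos x).le
theorem Sq_meas {w : EE N → ℝ} (hw : Measurable w) (ε) : Measurable (Sq ε w) := by unfold Sq; fun_prop
theorem Sq_le {w : EE N → ℝ} {C : ℝ} (h0 : ∀ x, 0 ≤ w x) (h1 : ∀ x, w x ≤ C) (ε x) : Sq ε w x ≤ 2 * N * C ^ 2 := by
  unfold Sq
  calc _ ≤ ∑ i : Fin N, (C ^ 2 + C ^ 2) := Finset.sum_le_sum fun i _ => by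
        apply add_le_add <;> · rw [sq_le_sq]; apply abs_le_abs <;> linarith [h0 x, h1 x, h0 (x + ε • ee i), h1 (x + ε • ee i), h0 (x - ε • ee i), h1 (x - ε • ee i)]
    _ = _ := by simp; ring
theorem energy_step {u V : EE N → ℝ} (hu : P.Adm u) (hV : AdmV V) {ε : ℝ} (hε : |ε| ≤ 1) :
    P.c / 4 * ∫ x, Sq ε (fun y => u y ^ P.m) x * xi x ≤ P.Y u - P.Y (P.St V ε u) +
      P.tau ε * (N * (P.M ^ P.m) ^ 2 * (∫ x : EE N, xi x) + 2 * P.L * P.c * (P.M ^ P.q) ^ 2 * ∫ x, V x ^ 2 * xi x) := by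
  have hs := St_adm hu hV.1 hV.2.1 ε
  have iS : Integrable (fun x => Sq ε (fun y => u y ^ P.m) x * xi x) :=
    bdd_int (Sq_meas hu.pow ε) fun x => by
      rw [abs_of_nonneg (Sq_nonneg _ _ _)]; exact Sq_le hu.pow_nonneg hu.pow_le ε x
  have w2m : Measurable (fun y => (u y ^ P.m) ^ 2) := hu.pow.pow_const 2
  have w2b : ∀ y, |(u y ^ P.m) ^ 2| ≤ (P.M ^ P.m) ^ 2 := fun y => by
    rw [abs_of_nonneg (sq_nonneg _)]; exact pow_le_pow_left₀ (hu.pow_nonneg y) (hu.pow_le y) 2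
  have iD : Integrable (fun x => Dl ε (fun y => (u y ^ P.m) ^ 2) x * xi x) := by
    refine bdd_int (C := ∑ i : Fin N, ((P.M ^ P.m) ^ 2 + (P.M ^ P.m) ^ 2 + 2 * (P.M ^ P.m) ^ 2)) (Dl_meas w2m ε) fun x => ?_
    refine (Finset.abs_sum_le_sum_abs _ _).trans (Finset.sum_le_sum fun i _ => ?_)
    refine (abs_sub _ _).trans (add_le_add ((abs_add_le _ _).trans (add_le_add (w2b _) (w2b _))) ?_)
    rw [abs_mul, abs_two]; exact mul_le_mul_of_nonneg_left (w2b x) two_pos.le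
  have hD := int_Dl_le w2m w2b (fun x => sq_nonneg _) hε
  have hw2 : ∫ x, (u x ^ P.m) ^ 2 * xi x ≤ (P.M ^ P.m) ^ 2 * ∫ x : EE N, xi x := by
    rw [← integral_const_mul]
    exact integral_mono (bdd_int w2m w2b) (xi_int0.const_mul _) fun x => mul_le_mul_of_nonneg_right ((le_abs_self _).trans (w2b x)) (xi_pos x).le
  have hp : ∀ x, P.Phi (P.St V ε u x) * xi x + P.c / 4 * (Sq ε (fun y => u y ^ P.m) x * xi x) ≤
      P.Phi (u x) * xi x + P.c / 2 * (Dl ε (fun y => (u y ^ P.m) ^ 2) x * xi x) + 2 * P.L * (P.tau ε * P.M ^ P.q) ^ 2 * (V x ^ 2 * xi x) := fun x => by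
    have := mul_le_mul_of_nonneg_right (energy_pt hu hV ε x) (xi_pos x).le
    linarith
  have h := integral_mono ((Phi_int hs).fun_add (iS.const_mul _)) (((Phi_int hu).fun_add (iD.const_mul _)).fun_add (hV.2.2.2.const_mul _)) hp
  rw [integral_add (Phi_int hs) (iS.const_mul _), integral_add ((Phi_int hu).fun_add (iD.const_mul _)) (hV.2.2.2.const_mul _),
    integral_add (Phi_int hu) (iD.const_mul _), integral_const_mul, integral_const_mul, integral_const_mul] at h
  have hV2 : 0 ≤ ∫ x, V x ^ 2 * xi x := integral_nonneg fun x => mul_nonneg (sq_nonneg _) (xi_pos x).le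
  have hc := P.hc
  have hL := P.hL
  have hA := mul_le_mul_of_nonneg_left (hD.trans (mul_le_mul_of_nonneg_left hw2 (by positivity))) (by positivity : 0 ≤ P.c / 2)
  have htc : P.tau ε ^ 2 ≤ P.tau ε * P.c := by
    have : P.tau ε ≤ P.c := by
      unfold tau; have : ε ^ 2 ≤ 1 := by rw [← sq_abs]; exact pow_le_one₀ (abs_nonneg _) hε
      nlinarith
    rw [sq]; exact mul_le_mul_of_nonneg_left this (tau_nonneg ε)
  have hB := mul_le_mul_of_nonneg_right htc (by positivity : 0 ≤ 2 * P.L * (P.M ^ P.q) ^ 2 * ∫ x, V x ^ 2 * xi x)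
  unfold Y
  have ht : P.tau ε = P.c * ε ^ 2 := rfl
  have hA' : P.c / 2 * (2 * ↑N * ε ^ 2 * ((P.M ^ P.m) ^ 2 * ∫ (x : EE N), xi x)) = P.tau ε * (N * (P.M ^ P.m) ^ 2 * ∫ x : EE N, xi x) := by rw [ht]; ring
  rw [hA'] at hA
  nlinarith
end Par
end

section
namespace Par
variable {N : ℕ} {P : Par N}
variable (P) in
def un (V : EE N → ℝ) (ε : ℝ) (u : EE N → ℝ) (t : ℝ) : EE N → ℝ := P.it V ε u ⌊t / P.tau ε⌋₊
theorem un_adm {u V : EE N → ℝ} (hu : P.Adm u) (hV : AdmV V) (ε t : ℝ) : P.Adm (P.un V ε u t) := it_adm hu hV _ _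
theorem un_meas {u V : EE N → ℝ} (hu : P.Adm u) (hV : AdmV V) (ε : ℝ) : Measurable (fun p : ℝ × EE N => P.un V ε u p.1 p.2) := by
  have h1 : Measurable (fun p : ℕ × EE N => P.it V ε u p.1 p.2) := measurable_from_prod_countable_right fun k => (it_adm hu hV ε k).1
  have h2 : Measurable (fun p : ℝ × EE N => ((⌊p.1 / P.tau ε⌋₊ : ℕ), p.2)) := by
    refine Measurable.prodMk ?_ measurable_snd
    exact Nat.measurable_floor.comp (measurable_fst.div_const _)
  exact h1.comp h2
theorem un_step (u V : EE N → ℝ) {ε t : ℝ} (hε : 0 < ε) (ht : 0 ≤ t) : P.un V ε u (t + P.tau ε) = P.St V ε (P.un V ε u t) := by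
  unfold un
  have h := tau_pos (P := P) hε
  rw [add_div, div_self h.ne', Nat.floor_add_one (by positivity), it_succ]
theorem un_neg (u V : EE N → ℝ) {ε t : ℝ} (hε : 0 < ε) (ht : t < P.tau ε) : P.un V ε u t = u := by
  unfold un
  have h := tau_pos (P := P) hε
  rw [Nat.floor_eq_zero.2 ((div_lt_one h).2 ht)]; rfl
theorem floor_le {τ t : ℝ} (h : 0 < τ) : (⌊t / τ⌋₊ : ℝ) * τ ≤ |t| := by
  rcases le_total 0 t with h0 | h0
  · rw [abs_of_nonneg h0, ← le_div_iff₀ h]; exact Nat.floor_le (by positivity)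
  · rw [Nat.floor_of_nonpos (div_nonpos_of_nonpos_of_nonneg h0 h.le)]; simp
theorem un_space {u V : EE N → ℝ} (hu : P.Adm u) (hV : AdmV V) (y : EE N) (hV' : AdmV (Par.tr y V)) {ε : ℝ} (h0 : 0 < ε) (hε : ε ≤ 1) (t : ℝ) :
    nd (Par.tr y (P.un V ε u t)) (P.un V ε u t) ≤ Real.exp (P.K * |t|) * (nd (Par.tr y u) u + |t| * (P.M ^ P.q * ∫ x, |V (x + y) - V x| * xi x)) := by
  refine (it_space hu hV y hV' (by rwa [abs_of_pos h0]) _).trans ?_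
  have h1 := floor_le (t := t) (tau_pos (P := P) h0)
  have h2 : 0 ≤ ∫ x, |V (x + y) - V x| * xi x := integral_nonneg fun x => mul_nonneg (abs_nonneg _) (xi_pos x).le
  have h3 := nd_nonneg (Par.tr y u) u
  have h4 := P.K_nonneg
  have h5 := Real.rpow_nonneg P.hM P.q
  have h6 := tau_nonneg (P := P) ε
  gcongr
theorem un_time {u v V : EE N → ℝ} (hu : P.Adm u) (hv : P.Adm v) (hV : AdmV V) {C : ℝ} {ε : ℝ} (h0 : 0 < ε) (hε : ε ≤ 1) (hC0 : 0 ≤ C)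
    (hC : ∀ x, |Dl ε (fun y => v y ^ P.m) x| ≤ C * ε ^ 2) {a b : ℝ} (hab : a ≤ b) :
    nd (P.un V ε u b) (P.un V ε u a) ≤ Real.exp (P.K * |b|) *
      (2 * nd u v + (b - a + P.tau ε) * (C * (∫ x, xi (x : EE N)) + P.M ^ P.q * ∫ x, V x * xi x)) := by
  have ht := tau_pos (P := P) h0
  have hle : ⌊a / P.tau ε⌋₊ ≤ ⌊b / P.tau ε⌋₊ := Nat.floor_le_floor (by gcongr)
  obtain ⟨l, hl⟩ := Nat.exists_eq_add_of_le hle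
  unfold un
  have h := it_time hu hv hV (by rwa [abs_of_pos h0]) hC ⌊a / P.tau ε⌋₊ l
  rw [← hl] at h
  refine h.trans ?_
  have h1 := floor_le (t := b) ht
  have h4 := P.K_nonneg
  have h5 := Real.rpow_nonneg P.hM P.q
  have h2 : 0 ≤ ∫ x, V x * xi x := integral_nonneg fun x => mul_nonneg (hV.2.1 x) (xi_pos x).le
  have h3 : 0 ≤ ∫ x : EE N, xi x := integral_nonneg fun x => (xi_pos x).le
  have h7 := nd_nonneg u v
  have hl2 : (l : ℝ) * P.tau ε ≤ b - a + P.tau ε := by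
    have e : (l:ℝ) = (⌊b / P.tau ε⌋₊ : ℝ) - ⌊a / P.tau ε⌋₊ := by rw [hl]; push_cast; ring
    rcases le_total 0 b with hb | hb
    · have e1 := Nat.floor_le (div_nonneg hb ht.le)
      have e2 := Nat.lt_floor_add_one (a / P.tau ε)
      have : (l:ℝ) ≤ b / P.tau ε - a / P.tau ε + 1 := by linarith
      calc _ ≤ (b / P.tau ε - a / P.tau ε + 1) * P.tau ε := by gcongr
        _ = _ := by field_simp
    · rw [Nat.floor_of_nonpos (div_nonpos_of_nonpos_of_nonneg hb ht.le)] at hl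
      have : l = 0 := by omega
      rw [this]; simp; linarith
  gcongr
theorem un_time' {u v V : EE N → ℝ} (hu : P.Adm u) (hv : P.Adm v) (hV : AdmV V) {C : ℝ} {ε : ℝ} (h0 : 0 < ε) (hε : ε ≤ 1) (hC0 : 0 ≤ C)
    (hC : ∀ x, |Dl ε (fun y => v y ^ P.m) x| ≤ C * ε ^ 2) (a s : ℝ) :
    nd (P.un V ε u (a + s)) (P.un V ε u a) ≤ Real.exp (P.K * (|a| + |s|)) *
      (2 * nd u v + (|s| + P.tau ε) * (C * (∫ x, xi (x : EE N)) + P.M ^ P.q * ∫ x, V x * xi x)) := by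
  have h4 := P.K_nonneg
  have h5 := Real.rpow_nonneg P.hM P.q
  have h2 : 0 ≤ ∫ x, V x * xi x := integral_nonneg fun x => mul_nonneg (hV.2.1 x) (xi_pos x).le
  have h3 : 0 ≤ ∫ x : EE N, xi x := integral_nonneg fun x => (xi_pos x).le
  have h7 := nd_nonneg u v
  have ht := tau_nonneg (P := P) ε
  rcases le_total 0 s with hs | hs
  · refine (un_time hu hv hV h0 hε hC0 hC (by linarith : a ≤ a + s)).trans ?_
    have : a + s - a ≤ |s| := by rw [abs_of_nonneg hs]; linarith
    have := abs_add_le a s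
    have : 0 ≤ a + s - a + P.tau ε := by linarith
    gcongr
  · rw [nd_comm]
    refine (un_time hu hv hV h0 hε hC0 hC (by linarith : a + s ≤ a)).trans ?_
    have : a - (a + s) ≤ |s| := by rw [abs_of_nonpos hs]; linarith
    have : 0 ≤ a - (a + s) + P.tau ε := by linarith
    have := abs_nonneg s
    have : |a| ≤ |a| + |s| := by linarith
    gcongr
def eps (n : ℕ) : ℝ := 1 / ((n:ℝ) + 1)
theorem eps_pos (n) : 0 < eps n := by unfold eps; positivity
theorem eps_le (n) : eps n ≤ 1 := by
  unfold eps; rw [div_le_one (by positivity)]; linarith [(Nat.cast_nonneg n : (0:ℝ) ≤ n)]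
theorem eps_tendsto : Tendsto eps atTop (𝓝 0) := tendsto_one_div_add_atTop_nhds_zero_nat
theorem tau_tendsto : Tendsto (fun n => P.tau (eps n)) atTop (𝓝 0) := by
  have := (eps_tendsto.pow 2).const_mul P.c
  simpa [tau] using this
theorem exp_abs_int : Integrable (fun t : ℝ => Real.exp (-|t|)) := by simpa using integrable_exp_abs one_pos
variable (P) in
def Wt (p : ℝ × EE N) : ℝ := Real.exp (-(P.K + 2) * |p.1|) * xi p.2
theorem Wt_int : Integrable (P.Wt) :=
  (integrable_exp_abs (by linarith [P.K_nonneg] : 0 < P.K + 2)).mul_prod xi_int0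
theorem Wt_cont : Continuous P.Wt := by
  have := xi_cont (N := N)
  unfold Wt; fun_prop
theorem Wt_pos (p) : 0 < P.Wt p := mul_pos (Real.exp_pos _) (xi_pos _)
theorem un_equi {u : EE N → ℝ} (hu : P.Adm u) {σ : ℝ} (hσ : 0 < σ) {η : ℝ} (hη : 0 < η) :
    ∃ δ > 0, ∃ n0 : ℕ, ∀ n ≥ n0, ∀ y : ℝ × EE N, ‖y‖ < δ →
      ∫ p : ℝ × EE N, |P.un (Vp N σ) (eps n) u (p + y).1 (p + y).2 - P.un (Vp N σ) (eps n) u p.1 p.2| * P.Wt p ≤ η := by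
  have hV := Vp_adm (N := N) hσ
  set V := Vp N σ with hVdef
  set B : ℝ := Real.exp P.K * ∫ t : ℝ, Real.exp (-|t|) with hB
  have hB0 : 0 ≤ B := mul_nonneg (Real.exp_pos _).le (integral_nonneg fun t => (Real.exp_pos _).le)
  obtain ⟨κ, hκ, hκη⟩ : ∃ κ > 0, B * κ ≤ η := by
    refine ⟨η / (B + 1), by positivity, ?_⟩
    rw [mul_div_assoc', div_le_iff₀ (by positivity)]; nlinarith
  obtain ⟨v, hv, ⟨C, hC⟩, huv⟩ := approx hu (by positivity : 0 < κ / 8)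
  set C' := |C| * (∫ x, xi (x : EE N)) + P.M ^ P.q * ∫ x, V x * xi x with hC'
  have hV1 : 0 ≤ ∫ x, V x * xi x := integral_nonneg fun x => mul_nonneg (hV.2.1 x) (xi_pos x).le
  have hx1 : 0 ≤ ∫ x : EE N, xi x := integral_nonneg fun x => (xi_pos x).le
  have hMq := Real.rpow_nonneg P.hM P.q
  have hC'0 : 0 ≤ C' := by positivity
  have l1 : Tendsto (fun y : EE N => nd (tr y u) u + P.M ^ P.q * ∫ x, |V (x + y) - V x| * xi x) (𝓝 0) (𝓝 0) := by
    simpa using (omega_u hu).add ((omega_V hσ).const_mul (P.M ^ P.q))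
  obtain ⟨δ1, hδ1, hd1⟩ := Metric.eventually_nhds_iff.1 (l1.eventually (gt_mem_nhds (by positivity : 0 < κ / 4)))
  have l2 : Tendsto (fun n => P.tau (eps n) * C') atTop (𝓝 0) := by simpa using (tau_tendsto (P := P)).mul_const C'
  obtain ⟨n0, hn0⟩ := eventually_atTop.1 (l2.eventually (gt_mem_nhds (by positivity : 0 < κ / 4)))
  obtain ⟨δ2, hδ2, hd2⟩ : ∃ δ2 > 0, δ2 * C' ≤ κ / 4 := by
    refine ⟨κ / 4 / (C' + 1), by positivity, ?_⟩
    rw [div_mul_eq_mul_div, div_le_iff₀ (by positivity)]; nlinarith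
  refine ⟨min 1 (min δ1 δ2), by positivity, n0, fun n hn y hy => ?_⟩
  obtain ⟨s, z⟩ := y
  have hs : |s| ≤ ‖((s, z) : ℝ × EE N)‖ := by rw [Prod.norm_def]; exact le_max_left _ _
  have hz : ‖z‖ ≤ ‖((s, z) : ℝ × EE N)‖ := by rw [Prod.norm_def]; exact le_max_right _ _
  have hs1 : |s| ≤ 1 := hs.trans (hy.le.trans (min_le_left _ _))
  have hs2 : |s| ≤ δ2 := hs.trans (hy.le.trans ((min_le_right _ _).trans (min_le_right _ _)))
  have hz1 : ‖z‖ < δ1 := hz.trans_lt (hy.trans_le ((min_le_right _ _).trans (min_le_left _ _)))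
  have hd1' := hd1 (y := z) (by simpa using hz1)
  set w := P.un V (eps n) u with hw
  have wm : Measurable (fun p : ℝ × EE N => w p.1 p.2) := un_meas hu hV _
  have wa : ∀ t, P.Adm (w t) := fun t => un_adm hu hV _ t
  have key : ∀ t, ∫ x, |w (t + s) (x + z) - w t x| * xi x ≤ Real.exp (P.K + (P.K + 1) * |t|) * κ := by
    intro t
    have e1 := un_space hu hV z (Vp_tr_adm hσ z) (eps_pos n) (eps_le n) (t + s)
    have e2 := un_time' hu hv hV (eps_pos n) (eps_le n) (abs_nonneg C) (fun x => (hC (eps n) (by rw [abs_of_pos (eps_pos n)]; exact eps_le n) x).trans (by gcongr; exact le_abs_self C)) t s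
    have e3 : nd (Par.tr z (w (t+s))) (w t) ≤ nd (Par.tr z (w (t+s))) (w (t+s)) + nd (w (t+s)) (w t) := nd_tri ((wa _).tr z) (wa _) (wa _)
    have e4 : ∫ x, |w (t + s) (x + z) - w t x| * xi x = nd (Par.tr z (w (t+s))) (w t) := rfl
    rw [e4]
    refine e3.trans ((add_le_add e1 e2).trans ?_)
    have a1 : |t + s| ≤ |t| + 1 := (abs_add_le t s).trans (by linarith)
    have hK := P.K_nonneg
    have a2 : Real.exp (P.K * |t + s|) ≤ Real.exp (P.K * (|t| + 1)) := by gcongr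
    have a3 : Real.exp (P.K * (|t| + |s|)) ≤ Real.exp (P.K * (|t| + 1)) := by gcongr
    have hn' := hn0 n hn
    have i1 : 0 ≤ ∫ x, |V (x + z) - V x| * xi x := integral_nonneg fun x => mul_nonneg (abs_nonneg _) (xi_pos x).le
    have i2 := nd_nonneg (Par.tr z u) u
    have i3 := nd_nonneg u v
    have at0 := abs_nonneg t
    have b1 : nd (Par.tr z u) u + |t + s| * (P.M ^ P.q * ∫ x, |V (x + z) - V x| * xi x) ≤ (|t| + 1) * (κ / 4) := by
      have : 0 ≤ P.M ^ P.q * ∫ x, |V (x + z) - V x| * xi x := by positivity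
      nlinarith
    have b2 : 2 * nd u v + (|s| + P.tau (eps n)) * C' ≤ (|t| + 1) * (3 * κ / 4) := by
      have : |s| * C' ≤ δ2 * C' := by gcongr
      nlinarith
    have b2' : 0 ≤ 2 * nd u v + (|s| + P.tau (eps n)) * C' := by
      have := tau_nonneg (P := P) (eps n); positivity
    calc _ ≤ Real.exp (P.K * (|t| + 1)) * ((|t| + 1) * (κ / 4)) + Real.exp (P.K * (|t| + 1)) * ((|t| + 1) * (3 * κ / 4)) := by
          gcongr
      _ = Real.exp (P.K * (|t| + 1)) * (|t| + 1) * κ := by ring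
      _ ≤ Real.exp (P.K * (|t| + 1)) * Real.exp |t| * κ := by gcongr; exact Real.add_one_le_exp _
      _ = _ := by rw [← Real.exp_add]; ring_nf
  have hint : Integrable (fun p : ℝ × EE N => |w (p + (s, z)).1 (p + (s, z)).2 - w p.1 p.2| * P.Wt p) := by
    refine Wt_int.bdd_mul (c := P.M) ?_ (Eventually.of_forall fun p => ?_)
    · exact (((wm.comp (measurable_add_const (s, z))).sub wm).abs).aestronglyMeasurable
    · rw [Real.norm_eq_abs, abs_abs, abs_le]
      have := (wa (p + (s,z)).1).2 (p + (s,z)).2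
      have := (wa p.1).2 p.2
      constructor <;> linarith
  rw [Measure.volume_eq_prod] at hint ⊢
  rw [integral_prod _ hint]
  calc _ ≤ ∫ t : ℝ, Real.exp P.K * κ * Real.exp (-|t|) := by
        refine integral_mono_of_nonneg (Eventually.of_forall fun t => integral_nonneg fun x => mul_nonneg (abs_nonneg _) (Wt_pos _).le) (exp_abs_int.const_mul _) (Eventually.of_forall fun t => ?_)
        have : ∀ x, |w ((t, x) + (s, z)).1 ((t, x) + (s, z)).2 - w t x| * P.Wt (t, x) = Real.exp (-(P.K + 2) * |t|) * (|w (t + s) (x + z) - w t x| * xi x) := fun x => by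
          simp only [Wt, Prod.mk_add_mk]; ring
        simp only [this]
        rw [integral_const_mul]
        calc _ ≤ Real.exp (-(P.K + 2) * |t|) * (Real.exp (P.K + (P.K + 1) * |t|) * κ) := by gcongr; exact key t
          _ = _ := by rw [← mul_assoc, ← Real.exp_add, mul_right_comm, ← Real.exp_add]; ring_nf
    _ = B * κ := by rw [integral_const_mul, hB]; ring
    _ ≤ η := hκη
instance haar1 : (volume : Measure (ℝ × EE N)).IsAddHaarMeasure := by rw [Measure.volume_eq_prod]; infer_instance
theorem un_limit {u : EE N → ℝ} (hu : P.Adm u) {σ : ℝ} (hσ : 0 < σ) :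
    ∃ ns : ℕ → ℕ, StrictMono ns ∧ ∃ b : ℝ × EE N → ℝ, Measurable b ∧ (∀ p, 0 ≤ b p ∧ b p ≤ P.M) ∧
      ∀ᵐ p : ℝ × EE N, Tendsto (fun j => P.un (Vp N σ) (eps (ns j)) u p.1 p.2) atTop (𝓝 (b p)) := by
  have hV := Vp_adm (N := N) hσ
  obtain ⟨ns, h1, v, h2, h3⟩ := compactness_ae (fun n (p : ℝ × EE N) => P.un (Vp N σ) (eps n) u p.1 p.2) P.M (fun n => un_meas hu hV _)
    (fun n p => by have := (un_adm hu hV (eps n) p.1).2 p.2; rw [abs_of_nonneg this.1]; exact this.2) P.Wt Wt_int Wt_pos Wt_cont.measurable (fun η hη => un_equi hu hσ hη)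
  refine ⟨ns, h1, fun p => max 0 (min (v p) P.M), by fun_prop, fun p => ⟨le_max_left _ _, max_le P.hM (min_le_right _ _)⟩, ?_⟩
  filter_upwards [h3] with p hp
  have e0 : 0 ≤ v p := ge_of_tendsto' hp fun j => ((un_adm hu hV _ p.1).2 p.2).1
  have e1 : v p ≤ P.M := le_of_tendsto' hp fun j => ((un_adm hu hV _ p.1).2 p.2).2
  rw [min_eq_left e1, max_eq_right e0]; exact hp
end Par
end

section
theorem isub {α : Type*} [MeasurableSpace α] {μ : Measure α} {f g : α → ℝ} (hf : Integrable f μ) (hg : Integrable g μ) :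
    Integrable (fun x => f x - g x) μ := hf.sub hg
namespace Par
variable {N : ℕ} {P : Par N}
def HH (N : ℕ) : Set (ℝ × EE N) := {p | 0 < p.1}
theorem HH_meas : MeasurableSet (HH N) := measurableSet_lt measurable_const measurable_fst
variable (P) in
def En (V : EE N → ℝ) (ε : ℝ) (u : EE N → ℝ) (t : ℝ) : ℝ := ∫ x, Sq ε (fun y => P.un V ε u t y ^ P.m) x * xi x
variable (P) in
def CE (V : EE N → ℝ) : ℝ := N * (P.M ^ P.m) ^ 2 * (∫ x : EE N, xi x) + 2 * P.L * P.c * (P.M ^ P.q) ^ 2 * ∫ x, V x ^ 2 * xi x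
theorem floor_meas (f : ℕ → ℝ) (τ : ℝ) : Measurable (fun t : ℝ => f ⌊t / τ⌋₊) :=
  (measurable_from_nat (f := f)).comp (Nat.measurable_floor.comp (measurable_id.div_const τ))
theorem En_nonneg (V : EE N → ℝ) (ε : ℝ) (u : EE N → ℝ) (t : ℝ) : 0 ≤ P.En V ε u t := integral_nonneg fun x => mul_nonneg (Sq_nonneg _ _ _) (xi_pos x).le
theorem En_int {u V : EE N → ℝ} (hu : P.Adm u) (hV : AdmV V) {ε : ℝ} (h0 : 0 < ε) (hε : ε ≤ 1) :
    IntegrableOn (fun t => Real.exp (-t) * P.En V ε u t) (Ioi 0) ∧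
    ∫ t in Ioi (0:ℝ), Real.exp (-t) * P.En V ε u t ≤ 4 * ε ^ 2 * (P.Phi P.M * (∫ x : EE N, xi x) + P.CE V) := by
  have hτ := tau_pos (P := P) h0
  have hc := P.hc
  set τ := P.tau ε with hτd
  set Z := P.Phi P.M * (∫ x : EE N, xi x) with hZ
  have he : IntegrableOn (fun t : ℝ => Real.exp (-t)) (Ioi 0) := integrableOn_exp_neg_Ioi 0
  have hem : Measurable (fun t : ℝ => Real.exp (-t)) := by fun_prop
  set y : ℝ → ℝ := fun t => P.Y (P.un V ε u t) with hy
  have ym : Measurable y := floor_meas (fun k => P.Y (P.it V ε u k)) τ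
  have Em : Measurable (P.En V ε u) := floor_meas (fun k => ∫ x, Sq ε (fun y => P.it V ε u k y ^ P.m) x * xi x) τ
  have y0 : ∀ t, 0 ≤ y t := fun t => Y_nonneg (un_adm hu hV ε t)
  have y1 : ∀ t, y t ≤ Z := fun t => Y_le (un_adm hu hV ε t)
  have hZ0 : 0 ≤ Z := (y0 0).trans (y1 0)
  have hstep : ∀ t, 0 ≤ t → P.c / 4 * P.En V ε u t ≤ y t - y (t + τ) + τ * P.CE V := fun t ht => by
    have := energy_step (un_adm hu hV ε t) hV (by rwa [abs_of_pos h0] : |ε| ≤ 1)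
    rw [← un_step u V h0 ht] at this
    exact this
  have iy : IntegrableOn (fun t => Real.exp (-t) * y t) (Ioi 0) := by
    refine he.mul_bdd (c := Z) ym.aestronglyMeasurable (Eventually.of_forall fun t => ?_)
    rw [Real.norm_eq_abs, abs_of_nonneg (y0 t)]; exact y1 t
  have iy2 : IntegrableOn (fun t => Real.exp (-t) * y (t + τ)) (Ioi 0) := by
    refine he.mul_bdd (c := Z) (ym.comp (measurable_add_const τ)).aestronglyMeasurable (Eventually.of_forall fun t => ?_)
    rw [Real.norm_eq_abs, abs_of_nonneg (y0 _)]; exact y1 _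
  have iR : IntegrableOn (fun t => Real.exp (-t) * y t - Real.exp (-t) * y (t + τ) + Real.exp (-t) * (τ * P.CE V)) (Ioi 0) :=
    (iy.sub iy2).add (he.mul_const _)
  have hle : ∀ t ∈ Ioi (0:ℝ), P.c / 4 * (Real.exp (-t) * P.En V ε u t) ≤ Real.exp (-t) * y t - Real.exp (-t) * y (t + τ) + Real.exp (-t) * (τ * P.CE V) := fun t ht => by
    have := mul_le_mul_of_nonneg_left (hstep t (le_of_lt ht)) (Real.exp_pos (-t)).le
    linarith
  have iE0 : IntegrableOn (fun t => P.c / 4 * (Real.exp (-t) * P.En V ε u t)) (Ioi 0) := by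
    refine Integrable.mono' iR ((hem.mul Em).const_mul _).aestronglyMeasurable ((ae_restrict_iff' measurableSet_Ioi).2 (Eventually.of_forall fun t ht => ?_))
    rw [Real.norm_eq_abs, abs_of_nonneg (mul_nonneg (by positivity) (mul_nonneg (Real.exp_pos _).le (En_nonneg _ _ _ _)))]
    exact hle t ht
  have iE : IntegrableOn (fun t => Real.exp (-t) * P.En V ε u t) (Ioi 0) := by
    have := iE0.const_mul (4 / P.c)
    refine this.congr (Eventually.of_forall fun t => ?_)
    simp only; field_simp
  refine ⟨iE, ?_⟩
  have h1 := setIntegral_mono_on iE0 iR measurableSet_Ioi hle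
  rw [integral_const_mul, integral_add (isub iy iy2) (he.mul_const _), integral_sub iy iy2, integral_mul_const, integral_exp_neg_Ioi_zero] at h1
  have h2 : ∫ t in Ioi (0:ℝ), Real.exp (-t) * y t ≤ τ * Z + ∫ t in Ioi τ, Real.exp (-t) * y t := by
    rw [← Ioc_union_Ioi_eq_Ioi hτ.le, setIntegral_union Ioc_disjoint_Ioi_same measurableSet_Ioi (iy.mono_set Ioc_subset_Ioi_self) (iy.mono_set (Ioi_subset_Ioi hτ.le))]
    gcongr
    calc _ ≤ ∫ t in Ioc 0 τ, Z := by
          refine setIntegral_mono_on (iy.mono_set Ioc_subset_Ioi_self) (integrableOn_const (by simp)) measurableSet_Ioc fun t ht => ?_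
          have : Real.exp (-t) ≤ 1 := Real.exp_le_one_iff.2 (by linarith [ht.1])
          nlinarith [y0 t, y1 t]
      _ = _ := by simp [hτ.le]
  have h3 : ∫ t in Ioi τ, Real.exp (-t) * y t ≤ ∫ t in Ioi (0:ℝ), Real.exp (-t) * y (t + τ) := by
    have e := (measurePreserving_add_right (volume : Measure ℝ) τ).setIntegral_preimage_emb (MeasurableEquiv.addRight τ).measurableEmbedding (fun t => Real.exp (-t) * y t) (Ioi τ)
    have e' : (fun t : ℝ => t + τ) ⁻¹' Ioi τ = Ioi 0 := by ext t; simp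
    rw [e'] at e
    rw [← e]
    refine setIntegral_mono_on ?_ iy2 measurableSet_Ioi fun t ht => ?_
    · have : IntegrableOn (fun t => Real.exp (-τ) * (Real.exp (-t) * y (t + τ))) (Ioi 0) := iy2.const_mul _
      refine this.congr (Eventually.of_forall fun t => ?_)
      simp only; rw [← mul_assoc, ← Real.exp_add]; ring_nf
    · have := y0 (t + τ); gcongr; linarith
  have h4 : P.c / 4 * ∫ t in Ioi (0:ℝ), Real.exp (-t) * P.En V ε u t ≤ τ * (Z + P.CE V) := by linarith
  have ht : τ = P.c * ε ^ 2 := rfl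
  rw [ht] at h4
  have : P.c * (∫ t in Ioi (0:ℝ), Real.exp (-t) * P.En V ε u t) ≤ P.c * (4 * ε ^ 2 * (Z + P.CE V)) := by linarith
  exact le_of_mul_le_mul_left this hc
/-- forward difference gradient -/
def Dw (ε : ℝ) (w : EE N → ℝ) (x : EE N) : EE N := WithLp.toLp 2 (fun i => (w (x + ε • ee i) - w x) / ε)
theorem Dw_sq (ε : ℝ) (w : EE N → ℝ) (x : EE N) : ‖Dw ε w x‖ ^ 2 ≤ Sq ε w x / ε ^ 2 := by
  rw [EuclideanSpace.norm_sq_eq]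
  unfold Dw Sq
  rw [Finset.sum_div]
  refine Finset.sum_le_sum fun i _ => ?_
  simp only [Real.norm_eq_abs, sq_abs, div_pow]
  gcongr
  have := sq_nonneg (w (x - ε • ee i) - w x)
  linarith
variable (P) in
def Dn (V : EE N → ℝ) (ε : ℝ) (u : EE N → ℝ) (p : ℝ × EE N) : EE N := Dw ε (fun y => P.un V ε u p.1 y ^ P.m) p.2
theorem Dn_meas {u V : EE N → ℝ} (hu : P.Adm u) (hV : AdmV V) (ε : ℝ) : Measurable (P.Dn V ε u) := by
  have h := un_meas hu hV ε
  unfold Dn Dw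
  refine (PiLp.continuous_toLp 2 _).measurable.comp (measurable_pi_iff.2 fun i => ?_)
  have h2 : Measurable (fun p : ℝ × EE N => P.un V ε u p.1 (p.2 + ε • ee i)) := h.comp (by fun_prop : Measurable (fun p : ℝ × EE N => (p.1, p.2 + ε • ee i)))
  exact ((h2.pow_const _).sub (h.pow_const _)).div_const _
theorem Dn_bdd {u V : EE N → ℝ} (hu : P.Adm u) (hV : AdmV V) (ε : ℝ) (p) : ‖P.Dn V ε u p‖ ^ 2 ≤ 2 * N * (P.M ^ P.m) ^ 2 / ε ^ 2 := by
  refine (Dw_sq _ _ _).trans ?_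
  have := un_adm hu hV ε p.1
  gcongr
  exact Sq_le this.pow_nonneg this.pow_le _ _
def wt (p : ℝ × EE N) : ℝ := Real.exp (-p.1) * xi p.2
theorem wt_pos (p : ℝ × EE N) : 0 < wt p := mul_pos (Real.exp_pos _) (xi_pos _)
theorem wt_cont : Continuous (wt (N := N)) := by
  have := xi_cont (N := N)
  unfold wt; fun_prop
theorem wt_int : IntegrableOn (wt (N := N)) (HH N) := by
  have h := Integrable.mul_prod (integrableOn_exp_neg_Ioi 0) (xi_int0 (N := N))
  have e : HH N = Ioi 0 ×ˢ univ := by ext p; simp [HH]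
  unfold IntegrableOn
  rw [e, Measure.volume_eq_prod, ← Measure.prod_restrict, Measure.restrict_univ]; exact h
variable (P) in
def Zn (V : EE N → ℝ) (ε : ℝ) (u : EE N → ℝ) : ℝ × EE N → EE N := (HH N).indicator fun p => Real.sqrt (wt p) • P.Dn V ε u p
theorem Zn_sq (V : EE N → ℝ) (ε : ℝ) (u : EE N → ℝ) : (fun p => ‖P.Zn V ε u p‖ ^ 2) = (HH N).indicator fun p => wt p * ‖P.Dn V ε u p‖ ^ 2 := by
  ext p
  unfold Zn
  by_cases h : p ∈ HH N
  · rw [indicator_of_mem h, indicator_of_mem h, norm_smul, mul_pow, Real.norm_eq_abs, sq_abs, Real.sq_sqrt (wt_pos p).le]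
  · rw [indicator_of_notMem h, indicator_of_notMem h]; simp
theorem Zn_meas {u V : EE N → ℝ} (hu : P.Adm u) (hV : AdmV V) (ε : ℝ) : Measurable (P.Zn V ε u) :=
  Measurable.indicator ((wt_cont.measurable.sqrt).smul (Dn_meas hu hV ε)) HH_meas
theorem Zn_int {u V : EE N → ℝ} (hu : P.Adm u) (hV : AdmV V) (ε : ℝ) : IntegrableOn (fun p => wt p * ‖P.Dn V ε u p‖ ^ 2) (HH N) := by
  refine wt_int.mul_bdd (c := 2 * N * (P.M ^ P.m) ^ 2 / ε ^ 2) (((Dn_meas hu hV ε).norm.pow_const 2).aestronglyMeasurable) (Eventually.of_forall fun p => ?_)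
  rw [Real.norm_eq_abs, abs_of_nonneg (sq_nonneg _)]; exact Dn_bdd hu hV ε p
theorem Zn_memLp {u V : EE N → ℝ} (hu : P.Adm u) (hV : AdmV V) (ε : ℝ) : MemLp (P.Zn V ε u) 2 := by
  rw [memLp_two_iff_integrable_sq_norm (Zn_meas hu hV ε).aestronglyMeasurable, Zn_sq, integrable_indicator_iff HH_meas]
  exact Zn_int hu hV ε
theorem Zn_le {u V : EE N → ℝ} (hu : P.Adm u) (hV : AdmV V) {ε : ℝ} (h0 : 0 < ε) (hε : ε ≤ 1) :
    ∫ p, ‖P.Zn V ε u p‖ ^ 2 ≤ 4 * (P.Phi P.M * (∫ x : EE N, xi x) + P.CE V) := by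
  rw [Zn_sq, integral_indicator HH_meas]
  have e : HH N = Ioi 0 ×ˢ univ := by ext p; simp [HH]
  have hi := Zn_int hu hV ε
  rw [e, Measure.volume_eq_prod] at hi ⊢
  rw [setIntegral_prod _ hi]
  have hE := En_int hu hV h0 hε
  calc _ ≤ ∫ t in Ioi (0:ℝ), (1 / ε ^ 2) * (Real.exp (-t) * P.En V ε u t) := by
        refine integral_mono_of_nonneg (Eventually.of_forall fun t => integral_nonneg fun x => mul_nonneg (wt_pos _).le (sq_nonneg _)) (hE.1.const_mul _) (Eventually.of_forall fun t => ?_)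
        simp only [Measure.restrict_univ]
        unfold En
        rw [← integral_const_mul, ← integral_const_mul]
        have ha := un_adm hu hV ε t
        refine integral_mono_of_nonneg (Eventually.of_forall fun x => mul_nonneg (wt_pos _).le (sq_nonneg _)) ?_ (Eventually.of_forall fun x => ?_)
        · refine Integrable.const_mul (Integrable.const_mul ?_ _) _
          exact bdd_int (Sq_meas ha.pow ε) fun x => by
            rw [abs_of_nonneg (Sq_nonneg _ _ _)]; exact Sq_le ha.pow_nonneg ha.pow_le ε x
        · simp only [wt]
          have := mul_le_mul_of_nonneg_left (Dw_sq ε (fun y => P.un V ε u t y ^ P.m) x) (wt_pos (t, x)).le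
          refine this.trans (le_of_eq ?_)
          simp only [wt]; ring
    _ = 1 / ε ^ 2 * ∫ t in Ioi (0:ℝ), (Real.exp (-t) * P.En V ε u t) := integral_const_mul _ _
    _ ≤ 1 / ε ^ 2 * (4 * ε ^ 2 * (P.Phi P.M * (∫ x : EE N, xi x) + P.CE V)) := by gcongr; exact hE.2
    _ = _ := by field_simp
end Par
end

section
section gen
variable {Q : Type*} [NormedAddCommGroup Q] [NormedSpace ℝ Q] [FiniteDimensional ℝ Q]
theorem diff_unif {ζ : Q → ℝ} (h1 : ContDiff ℝ 1 ζ) (h2 : HasCompactSupport ζ) (v : Q) {η : ℝ} (hη : 0 < η) :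
    ∃ δ > 0, ∀ ε : ℝ, 0 < |ε| → |ε| < δ → ∀ p, |(ζ (p + ε • v) - ζ p) / ε - fderiv ℝ ζ p v| ≤ η := by
  have hc : Continuous (fderiv ℝ ζ) := h1.continuous_fderiv one_ne_zero
  have hu : UniformContinuous (fderiv ℝ ζ) := (h2.fderiv ℝ).uniformContinuous_of_continuous hc
  set κ := η / (‖v‖ + 1) with hκ
  have hκ0 : 0 < κ := by positivity
  obtain ⟨δ, hδ, h⟩ := Metric.uniformContinuous_iff.1 hu κ hκ0
  refine ⟨δ / (‖v‖ + 1), by positivity, fun ε he0 he p => ?_⟩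
  have hev : |ε| * ‖v‖ < δ := by
    rw [lt_div_iff₀ (by positivity)] at he
    nlinarith [norm_nonneg v]
  have hs : Convex ℝ (Metric.ball p δ) := convex_ball _ _
  have := hs.norm_image_sub_le_of_norm_fderiv_le' (𝕜 := ℝ) (f := ζ) (φ := fderiv ℝ ζ p) (C := κ) (x := p) (y := p + ε • v)
    (fun x _ => (h1.differentiable one_ne_zero) x) (fun x hx => by
      have := h (a := x) (b := p) hx
      rw [dist_eq_norm] at this; exact this.le) (Metric.mem_ball_self hδ) (by
      rw [Metric.mem_ball, dist_eq_norm, add_sub_cancel_left, norm_smul, Real.norm_eq_abs]; exact hev)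
  rw [add_sub_cancel_left, norm_smul, map_smul, Real.norm_eq_abs, Real.norm_eq_abs, smul_eq_mul] at this
  have hε : ε ≠ 0 := abs_pos.1 he0
  have e : (ζ (p + ε • v) - ζ p) / ε - fderiv ℝ ζ p v = (ζ (p + ε • v) - ζ p - ε * fderiv ℝ ζ p v) / ε := by field_simp
  rw [e, abs_div, div_le_iff₀ he0]
  refine this.trans ?_
  have : κ * ‖v‖ ≤ η := by
    rw [hκ, div_mul_eq_mul_div, div_le_iff₀ (by positivity)]; nlinarith [norm_nonneg v]
  nlinarith
theorem diff_supp {ζ : Q → ℝ} (h2 : HasCompactSupport ζ) (v : Q) : ∃ K : Set Q, IsCompact K ∧ ∀ ε : ℝ, |ε| ≤ 1 → ∀ p ∉ K,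
    ζ p = 0 ∧ ζ (p + ε • v) = 0 ∧ fderiv ℝ ζ p v = 0 := by
  refine ⟨Metric.cthickening ‖v‖ (tsupport ζ), h2.isCompact.cthickening, fun ε hε p hp => ?_⟩
  have hsub := Metric.self_subset_cthickening (δ := ‖v‖) (tsupport ζ)
  have h0 : p ∉ tsupport ζ := fun h => hp (hsub h)
  refine ⟨image_eq_zero_of_notMem_tsupport h0, ?_, ?_⟩
  · by_contra hne
    apply hp
    have hm : p + ε • v ∈ tsupport ζ := subset_tsupport _ hne
    refine Metric.mem_cthickening_of_dist_le p (p + ε • v) _ _ hm ?_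
    rw [dist_eq_norm, sub_add_cancel_left, norm_neg, norm_smul, Real.norm_eq_abs]
    nlinarith [norm_nonneg v]
  · have : fderiv ℝ ζ p = 0 := by
      by_contra hne
      exact h0 (tsupport_fderiv_subset ℝ (subset_tsupport (f := fderiv ℝ ζ) hne))
    rw [this]; rfl
theorem diff_tendsto {ζ : Q → ℝ} (h1 : ContDiff ℝ 1 ζ) (v : Q) {e : ℕ → ℝ} (he : Tendsto e atTop (𝓝 0)) (h0 : ∀ n, e n ≠ 0) (p : Q) :
    Tendsto (fun n => (ζ (p + e n • v) - ζ p) / e n) atTop (𝓝 (fderiv ℝ ζ p v)) := by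
  have hd : HasFDerivAt ζ (fderiv ℝ ζ p) p := ((h1.differentiable one_ne_zero) p).hasFDerivAt
  have hl := hd.hasLineDerivAt v
  have := (hasLineDerivAt_iff_tendsto_slope_zero.1 hl)
  have t2 : Tendsto e atTop (𝓝[≠] 0) := tendsto_nhdsWithin_iff.2 ⟨he, Eventually.of_forall h0⟩
  refine (this.comp t2).congr fun n => ?_
  simp [div_eq_inv_mul]
theorem diff_bdd {ζ : Q → ℝ} (h1 : ContDiff ℝ 1 ζ) (h2 : HasCompactSupport ζ) (v : Q) : ∃ C : ℝ, 0 ≤ C ∧ ∀ ε : ℝ, ∀ p,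
    |(ζ (p + ε • v) - ζ p) / ε| ≤ C := by
  obtain ⟨L, hL⟩ := ContDiff.lipschitzWith_of_hasCompactSupport h2 h1 one_ne_zero
  refine ⟨L * ‖v‖, by positivity, fun ε p => ?_⟩
  rcases eq_or_ne ε 0 with rfl | hε
  · simp; positivity
  · rw [abs_div, div_le_iff₀ (abs_pos.2 hε)]
    have := hL.dist_le_mul (p + ε • v) p
    rw [Real.dist_eq, dist_eq_norm, add_sub_cancel_left, norm_smul, Real.norm_eq_abs] at this
    linarith
end gen
namespace Par
variable {N : ℕ} {P : Par N}
theorem grad_limit {u V : EE N → ℝ} (hu : P.Adm u) (hV : AdmV V) (ns : ℕ → ℕ) :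
    ∃ ms : ℕ → ℕ, StrictMono ms ∧ ∃ g : ℝ × EE N → EE N, Measurable g ∧ (∀ p ∉ HH N, g p = 0) ∧ Integrable (fun p => wt p * ‖g p‖ ^ 2) ∧
      ∀ (Ψ : ℕ → ℝ × EE N → EE N) (Ψ' : ℝ × EE N → EE N) (K : Set (ℝ × EE N)) (η : ℕ → ℝ), IsCompact K → (∀ n, Continuous (Ψ n)) → Continuous Ψ' →
        (∀ n, ∀ p ∉ K, Ψ n p = 0) → (∀ p ∉ K, Ψ' p = 0) → (∀ n p, ‖Ψ n p - Ψ' p‖ ≤ η n) → Tendsto η atTop (𝓝 0) →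
        Tendsto (fun j => ∫ p in HH N, inner ℝ (P.Dn V (eps (ns (ms j))) u p) (Ψ j p)) atTop (𝓝 (∫ p in HH N, inner ℝ (g p) (Ψ' p))) := by
  set C := 4 * (P.Phi P.M * (∫ x : EE N, xi x) + P.CE V) with hC
  obtain ⟨ms, hms, z, hzm, hz2, hz⟩ := weak_L2 (fun n => P.Zn V (eps (ns n)) u) (fun n => Zn_memLp hu hV _) C (fun n => Zn_le hu hV (eps_pos _) (eps_le _))
  have hwm : Measurable (fun p : ℝ × EE N => (Real.sqrt (wt p))⁻¹) := (wt_cont.measurable.sqrt).inv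
  have hsp : ∀ p : ℝ × EE N, 0 < Real.sqrt (wt p) := fun p => Real.sqrt_pos.2 (wt_pos p)
  refine ⟨ms, hms, (HH N).indicator fun p => (Real.sqrt (wt p))⁻¹ • z p, (hwm.smul hzm).indicator HH_meas, fun p hp => indicator_of_notMem hp _, ?_, ?_⟩
  · have i2 := (memLp_two_iff_integrable_sq_norm hzm.aestronglyMeasurable).1 hz2
    refine (i2.indicator HH_meas).congr (Eventually.of_forall fun p => ?_)
    by_cases h : p ∈ HH N
    · simp only [indicator_of_mem h, norm_smul, norm_inv, mul_pow, inv_pow, Real.norm_eq_abs, sq_abs, Real.sq_sqrt (wt_pos p).le]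
      have := wt_pos p; field_simp
    · simp [indicator_of_notMem h]
  · intro Ψ Ψ' K η hK hΨc hΨ'c hΨ hΨ' hη hη0
    have hcs : HasCompactSupport Ψ' := HasCompactSupport.intro hK hΨ'
    have hsc : Continuous (fun p : ℝ × EE N => (Real.sqrt (wt p))⁻¹) := (wt_cont.sqrt).inv₀ fun p => (hsp p).ne'
    have hmem : MemLp ((HH N).indicator fun p => (Real.sqrt (wt p))⁻¹ • Ψ' p) 2 := by
      refine MemLp.indicator HH_meas ?_
      exact (hsc.smul hΨ'c).memLp_of_hasCompactSupport (hcs.smul_left)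
    have t1 := hz _ hmem
    have e1 : ∀ Z : ℝ × EE N → EE N, ∫ p, inner ℝ ((HH N).indicator (fun p => Real.sqrt (wt p) • Z p) p) ((HH N).indicator (fun p => (Real.sqrt (wt p))⁻¹ • Ψ' p) p) = ∫ p in HH N, inner ℝ (Z p) (Ψ' p) := fun Z => by
      rw [← integral_indicator HH_meas]
      congr 1; ext p
      by_cases h : p ∈ HH N
      · simp only [indicator_of_mem h, real_inner_smul_left, real_inner_smul_right]
        rw [← mul_assoc, inv_mul_cancel₀ (hsp p).ne', one_mul]
      · simp [indicator_of_notMem h]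
    have e2 : ∫ p, inner ℝ (z p) ((HH N).indicator (fun p => (Real.sqrt (wt p))⁻¹ • Ψ' p) p) = ∫ p in HH N, inner ℝ ((HH N).indicator (fun p => (Real.sqrt (wt p))⁻¹ • z p) p) (Ψ' p) := by
      rw [← integral_indicator HH_meas]
      congr 1; ext p
      by_cases h : p ∈ HH N
      · simp only [indicator_of_mem h, real_inner_smul_left, real_inner_smul_right]
      · simp [indicator_of_notMem h]
    rw [e2] at t1
    have t1' := t1.congr fun j => e1 (P.Dn V (eps (ns (ms j))) u)
    obtain ⟨c, hc0, hc⟩ : ∃ c > 0, ∀ p ∈ K, c ≤ wt p := by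
      rcases K.eq_empty_or_nonempty with rfl | hne
      · exact ⟨1, one_pos, fun p hp => hp.elim⟩
      · obtain ⟨p0, -, h0⟩ := hK.exists_isMinOn hne (wt_cont (N := N)).continuousOn
        exact ⟨wt p0, wt_pos p0, fun p hp => h0 hp⟩
    have hη' : ∀ n, 0 ≤ η n := fun n => (norm_nonneg _).trans (hη n 0)
    have iD : ∀ n (Φ : ℝ × EE N → EE N), Continuous Φ → (∀ p ∉ K, Φ p = 0) → IntegrableOn (fun p => inner ℝ (P.Dn V (eps n) u p) (Φ p)) (HH N) := by
      intro n Φ hΦ hΦ0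
      have i1 : Integrable (fun p => ‖Φ p‖) := (hΦ.integrable_of_hasCompactSupport (HasCompactSupport.intro hK hΦ0)).norm
      refine (Integrable.mono' (i1.const_mul (Real.sqrt (2 * N * (P.M ^ P.m) ^ 2 / (eps n) ^ 2))) ((Dn_meas hu hV _).inner hΦ.measurable).aestronglyMeasurable (Eventually.of_forall fun p => ?_)).integrableOn
      refine (norm_inner_le_norm _ _).trans ?_
      gcongr
      exact Real.le_sqrt_of_sq_le (Dn_bdd hu hV _ p)
    have herr : ∀ j, |(∫ p in HH N, inner ℝ (P.Dn V (eps (ns (ms j))) u p) (Ψ j p)) - ∫ p in HH N, inner ℝ (P.Dn V (eps (ns (ms j))) u p) (Ψ' p)| ≤ η j * ((volume K).toReal + c⁻¹ * C) := by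
      intro j
      rw [← integral_sub (iD _ _ (hΨc j) (hΨ j)) (iD _ _ hΨ'c hΨ'), ← integral_indicator HH_meas]
      have iZ := (memLp_two_iff_integrable_sq_norm (Zn_meas hu hV (eps (ns (ms j)))).aestronglyMeasurable).1 (Zn_memLp hu hV (eps (ns (ms j))))
      have iK : Integrable (K.indicator fun _ => (1:ℝ)) := (integrable_indicator_iff hK.measurableSet).2 (integrableOn_const hK.measure_lt_top.ne)
      have iB : Integrable (fun p => η j * (K.indicator (fun _ => (1:ℝ)) p + c⁻¹ * ‖P.Zn V (eps (ns (ms j))) u p‖ ^ 2)) := (iK.fun_add (iZ.const_mul _)).const_mul _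
      rw [← Real.norm_eq_abs]
      refine (norm_integral_le_of_norm_le iB (Eventually.of_forall fun p => ?_)).trans ?_
      · have hR : 0 ≤ K.indicator (fun _ => (1:ℝ)) p + c⁻¹ * ‖P.Zn V (eps (ns (ms j))) u p‖ ^ 2 := by
          have : 0 ≤ K.indicator (fun _ => (1:ℝ)) p := indicator_nonneg (fun _ _ => zero_le_one) p
          positivity
        by_cases h : p ∈ HH N
        · rw [indicator_of_mem h, ← inner_sub_right]
          by_cases hk : p ∈ K
          · have e := congrFun (Zn_sq (P := P) V (eps (ns (ms j))) u) p
            rw [e, indicator_of_mem h, indicator_of_mem hk]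
            set d := P.Dn V (eps (ns (ms j))) u p
            have a1 : ‖d‖ ≤ 1 + ‖d‖ ^ 2 := by nlinarith [sq_nonneg (‖d‖ - 1), norm_nonneg d]
            have a2 : ‖d‖ ^ 2 ≤ c⁻¹ * (wt p * ‖d‖ ^ 2) := by
              rw [← mul_assoc]
              have : 1 ≤ c⁻¹ * wt p := by rw [inv_mul_eq_div, one_le_div hc0]; exact hc p hk
              nlinarith [sq_nonneg ‖d‖]
            refine (norm_inner_le_norm _ _).trans ?_
            rw [mul_comm]
            exact mul_le_mul (hη j p) (by linarith) (norm_nonneg _) (hη' j)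
          · rw [hΨ j p hk, hΨ' p hk]; simp only [sub_zero, inner_zero_right, norm_zero]
            exact mul_nonneg (hη' j) hR
        · rw [indicator_of_notMem h, norm_zero]; exact mul_nonneg (hη' j) hR
      · rw [integral_const_mul, integral_add iK (iZ.const_mul _), integral_const_mul, integral_indicator hK.measurableSet]
        have := Zn_le hu hV (eps_pos (ns (ms j))) (eps_le (ns (ms j)))
        have h1 := hη' j
        simp only [integral_const, smul_eq_mul, mul_one, measureReal_restrict_apply_univ]
        gcongr
        · exact le_rfl
    have t2 : Tendsto (fun j => (∫ p in HH N, inner ℝ (P.Dn V (eps (ns (ms j))) u p) (Ψ j p)) - ∫ p in HH N, inner ℝ (P.Dn V (eps (ns (ms j))) u p) (Ψ' p)) atTop (𝓝 0) := by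
      refine squeeze_zero_norm (fun j => ?_) (by simpa using hη0.mul_const ((volume K).toReal + c⁻¹ * C) : Tendsto (fun j => η j * ((volume K).toReal + c⁻¹ * C)) atTop (𝓝 0))
      rw [Real.norm_eq_abs]; exact herr j
    have := t2.add t1'
    simpa using this
end Par
end

section
theorem dct_prod {α : Type*} [MeasurableSpace α] {μ : Measure α} {A B : ℕ → α → ℝ} {A' B' : α → ℝ} {C1 C2 : ℝ} {K : Set α}
    (hK : MeasurableSet K) (hKf : μ K ≠ ⊤) (hA : ∀ n, Measurable (A n)) (hB : ∀ n, Measurable (B n)) (hC1 : ∀ n p, |A n p| ≤ C1) (h1 : 0 ≤ C1)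
    (hC2 : ∀ n p, |B n p| ≤ C2) (hBK : ∀ n, ∀ p ∉ K, B n p = 0) (tA : ∀ᵐ p ∂μ, Tendsto (fun n => A n p) atTop (𝓝 (A' p)))
    (tB : ∀ p, Tendsto (fun n => B n p) atTop (𝓝 (B' p))) :
    Tendsto (fun n => ∫ p, A n p * B n p ∂μ) atTop (𝓝 (∫ p, A' p * B' p ∂μ)) := by
  refine tendsto_integral_of_dominated_convergence (K.indicator fun _ => C1 * C2) (fun n => ((hA n).mul (hB n)).aestronglyMeasurable) ?_ (fun n => Eventually.of_forall fun p => ?_) ?_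
  · exact (integrable_indicator_iff hK).2 (integrableOn_const hKf)
  · by_cases h : p ∈ K
    · rw [indicator_of_mem h, norm_mul]; exact mul_le_mul (hC1 n p) (hC2 n p) (norm_nonneg _) h1
    · rw [indicator_of_notMem h, hBK n p h]; simp
  · filter_upwards [tA] with p hp
    exact hp.mul (tB p)
namespace Par
variable {N : ℕ} {P : Par N}
theorem p00 : (((0:ℝ), (0:EE N)) : ℝ × EE N) = 0 := rfl
theorem HH_shift (f : ℝ × EE N → ℝ) (z : EE N) : ∫ p in HH N, f (p + (0, z)) = ∫ p in HH N, f p := by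
  rw [← integral_indicator HH_meas, ← integral_indicator HH_meas, ← integral_add_right_eq_self ((HH N).indicator f) ((0, z) : ℝ × EE N)]
  congr 1; ext p
  simp only [indicator, HH, mem_setOf_eq, Prod.fst_add, add_zero]
theorem bc_int {Q : Type*} [TopologicalSpace Q] [MeasureSpace Q] [OpensMeasurableSpace Q] [IsFiniteMeasureOnCompacts (volume : Measure Q)] {w ζ : Q → ℝ} (hw : Measurable w) {C : ℝ} (hC : ∀ p, |w p| ≤ C) (h1 : Continuous ζ) (h2 : HasCompactSupport ζ) :
    Integrable (fun p => w p * ζ p) :=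
  (h1.integrable_of_hasCompactSupport h2).bdd_mul (c := C) hw.aestronglyMeasurable (Eventually.of_forall hC)
theorem cs_shift {ζ : ℝ × EE N → ℝ} (h2 : HasCompactSupport ζ) (y : ℝ × EE N) : HasCompactSupport (fun p => ζ (p + y)) :=
  h2.comp_homeomorph (Homeomorph.addRight y)
theorem ibp {w ζ : ℝ × EE N → ℝ} (hw : Measurable w) {C : ℝ} (hC : ∀ p, |w p| ≤ C) (h1 : Continuous ζ) (h2 : HasCompactSupport ζ) (z : EE N) :
    ∫ p in HH N, (w (p + (0, z)) - w p) * ζ p = ∫ p in HH N, w p * (ζ (p + (0, -z)) - ζ p) := by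
  have i1 : Integrable (fun p => w (p + (0, z)) * ζ p) := bc_int (w := fun p => w (p + (0, z))) (hw.comp (measurable_add_const _)) (fun p => hC _) h1 h2
  have i2 := bc_int hw hC h1 h2
  have i3 : Integrable (fun p => w p * ζ (p + (0, -z))) := bc_int hw hC (h1.comp (continuous_add_right _)) (cs_shift h2 _)
  simp only [sub_mul, mul_sub]
  rw [integral_sub i1.integrableOn i2.integrableOn, integral_sub i3.integrableOn i2.integrableOn]
  congr 1
  rw [← HH_shift (fun p => w p * ζ (p + (0, -z))) z]
  congr 1; ext p
  simp [add_assoc, p00]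
theorem lap {w ζ : ℝ × EE N → ℝ} (hw : Measurable w) {C : ℝ} (hC : ∀ p, |w p| ≤ C) (h1 : Continuous ζ) (h2 : HasCompactSupport ζ) (z : EE N) :
    ∫ p in HH N, (w (p + (0, z)) + w (p + (0, -z)) - 2 * w p) * ζ p = - ∫ p in HH N, (w (p + (0, z)) - w p) * (ζ (p + (0, z)) - ζ p) := by
  have a1 := ibp hw hC h1 h2 z
  have a2 := ibp hw hC h1 h2 (-z)
  have a3 := ibp hw hC ((h1.comp (continuous_add_right (0, z))).sub h1) ((cs_shift h2 (0,z)).sub h2) z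
  have im : ∀ y, Integrable (fun p => (w (p + y) - w p) * ζ p) := fun y => by
    refine bc_int (w := fun p => w (p + y) - w p) (C := C + C) ((hw.comp (measurable_add_const _)).sub hw) (fun p => (abs_sub _ _).trans (add_le_add (hC _) (hC _))) h1 h2
  have iz : ∀ y, Integrable (fun p => w p * (ζ (p + y) - ζ p)) := fun y => bc_int hw hC ((h1.comp (continuous_add_right y)).sub h1) ((cs_shift h2 y).sub h2)
  have e1 : ∀ p, (w (p + (0, z)) + w (p + (0, -z)) - 2 * w p) * ζ p = (w (p + (0, z)) - w p) * ζ p + (w (p + (0, -z)) - w p) * ζ p := fun p => by ring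
  simp only [e1]
  rw [integral_add (im _).integrableOn (im _).integrableOn, a1, a2]
  simp only [Pi.sub_apply, Function.comp, neg_neg] at a3 ⊢
  rw [a3, ← integral_add (iz _).integrableOn (iz _).integrableOn, ← integral_neg]
  congr 1; ext p
  have : p + (0, -z) + (0, z) = p := by simp [add_assoc, p00]
  rw [this]; ring
theorem inner_toLp (v : EE N) (f : Fin N → ℝ) : inner ℝ v (WithLp.toLp 2 f : EE N) = ∑ i, v i * f i := by
  rw [PiLp.inner_apply]; simp [mul_comm]
def Dz (ε : ℝ) (ζ : ℝ × EE N → ℝ) (p : ℝ × EE N) : EE N := WithLp.toLp 2 fun i => (ζ (p + ε • (0, ee i)) - ζ p) / ε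
def Gz (ζ : ℝ × EE N → ℝ) (p : ℝ × EE N) : EE N := WithLp.toLp 2 fun i => fderiv ℝ ζ p (0, ee i)
theorem lap_sum {u V : EE N → ℝ} (hu : P.Adm u) (hV : AdmV V) {ε : ℝ} (h0 : 0 < ε) {ζ : ℝ × EE N → ℝ} (h1 : Continuous ζ) (h2 : HasCompactSupport ζ) :
    IntegrableOn (fun p : ℝ × EE N => Dl ε (fun y => P.un V ε u p.1 y ^ P.m) p.2 * ζ p) (HH N) ∧
    ∫ p in HH N, Dl ε (fun y => P.un V ε u p.1 y ^ P.m) p.2 * ζ p = - (ε ^ 2 * ∫ p in HH N, inner ℝ (P.Dn V ε u p) (Dz ε ζ p)) := by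
  set w : ℝ × EE N → ℝ := fun p => P.un V ε u p.1 p.2 ^ P.m with hw
  have wm : Measurable w := (un_meas hu hV ε).pow_const _
  have wC : ∀ p, |w p| ≤ P.M ^ P.m := fun p => by
    rw [abs_of_nonneg ((un_adm hu hV ε p.1).pow_nonneg p.2)]; exact (un_adm hu hV ε p.1).pow_le p.2
  have e1 : ∀ p : ℝ × EE N, Dl ε (fun y => P.un V ε u p.1 y ^ P.m) p.2 * ζ p = ∑ i, (w (p + (0, ε • ee i)) + w (p + (0, -(ε • ee i))) - 2 * w p) * ζ p := fun p => by
    unfold Dl; rw [Finset.sum_mul]; simp [hw, sub_eq_add_neg]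
  have e2 : ∀ p : ℝ × EE N, ε ^ 2 * inner ℝ (P.Dn V ε u p) (Dz ε ζ p) = ∑ i, (w (p + (0, ε • ee i)) - w p) * (ζ (p + (0, ε • ee i)) - ζ p) := fun p => by
    unfold Dz; rw [inner_toLp, Finset.mul_sum]
    refine Finset.sum_congr rfl fun i _ => ?_
    simp only [Dn, Dw, hw, Prod.smul_mk, smul_zero, Prod.fst_add, Prod.snd_add, add_zero]
    field_simp
  have iL : ∀ i : Fin N, Integrable (fun p => (w (p + (0, ε • ee i)) + w (p + (0, -(ε • ee i))) - 2 * w p) * ζ p) := fun i => by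
    refine bc_int (w := fun p => (w (p + (0, ε • ee i)) + w (p + (0, -(ε • ee i))) - 2 * w p)) (C := P.M ^ P.m + P.M ^ P.m + 2 * P.M ^ P.m) ?_ (fun p => ?_) h1 h2
    · exact ((wm.comp (measurable_add_const _)).add (wm.comp (measurable_add_const _))).sub (wm.const_mul 2)
    · refine (abs_sub _ _).trans (add_le_add ((abs_add_le _ _).trans (add_le_add (wC _) (wC _))) ?_)
      rw [abs_mul, abs_two]; exact mul_le_mul_of_nonneg_left (wC p) two_pos.le
  have iR : ∀ i : Fin N, Integrable (fun p => (w (p + (0, ε • ee i)) - w p) * (ζ (p + (0, ε • ee i)) - ζ p)) := fun i => by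
    refine bc_int (w := fun p => (w (p + (0, ε • ee i)) - w p)) (ζ := fun p => ζ (p + (0, ε • ee i)) - ζ p) (C := P.M ^ P.m + P.M ^ P.m) ?_ (fun p => ?_) ((h1.comp (continuous_add_right (0, ε • ee i))).sub h1) ((cs_shift h2 (0,ε • ee i)).sub h2)
    · exact (wm.comp (measurable_add_const _)).sub wm
    · exact (abs_sub _ _).trans (add_le_add (wC _) (wC _))
  rw [← integral_const_mul]
  simp only [e1, e2]
  refine ⟨(integrable_finsetSum _ fun i _ => iL i).integrableOn, ?_⟩
  rw [integral_finsetSum _ fun i _ => (iL i).integrableOn, integral_finsetSum _ fun i _ => (iR i).integrableOn, ← Finset.sum_neg_distrib]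
  exact Finset.sum_congr rfl fun i _ => lap wm wC h1 h2 _
theorem ae_ne_zero : ∀ᵐ p : ℝ × EE N, p.1 ≠ 0 := by
  have : {p : ℝ × EE N | p.1 = 0} = {0} ×ˢ univ := by ext p; simp
  rw [ae_iff]; simp only [not_not]; rw [this, Measure.volume_eq_prod, Measure.prod_prod]; simp
theorem discrete {u V : EE N → ℝ} (hu : P.Adm u) (hV : AdmV V) (hVc : Continuous V) {ε : ℝ} (h0 : 0 < ε) {ζ : ℝ × EE N → ℝ} (h1 : Continuous ζ) (h2 : HasCompactSupport ζ) :
    ∫ p : ℝ × EE N, (P.un V ε u p.1 p.2 - u p.2) * ((ζ (p + (-(P.tau ε)) • (1, 0)) - ζ p) / (-(P.tau ε))) =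
      (∫ p in HH N, inner ℝ (P.Dn V ε u p) (Dz ε ζ p)) +
      ∫ p : ℝ × EE N, ({p : ℝ × EE N | P.tau ε < p.1}.indicator (fun p => P.un V ε u p.1 p.2 ^ P.q) p) * (V p.2 * ζ (p + (-(P.tau ε)) • (1, 0))) := by
  have hτ := tau_pos (P := P) h0
  set τ := P.tau ε with hτd
  set U : ℝ × EE N → ℝ := fun p => P.un V ε u p.1 p.2 - u p.2 with hU
  have um := un_meas hu hV ε
  have ua := fun p : ℝ × EE N => (un_adm hu hV ε p.1).2 p.2
  have Um : Measurable U := um.sub (hu.1.comp measurable_snd)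
  have UC : ∀ p, |U p| ≤ P.M := fun p => by
    rw [abs_le]; have := ua p; have := hu.2 p.2; simp only [hU]; constructor <;> linarith
  have hL := lap_sum hu hV h0 h1 h2
  have hVz : Continuous (fun p : ℝ × EE N => V p.2 * ζ p) := by fun_prop
  have hVzs : HasCompactSupport (fun p : ℝ × EE N => V p.2 * ζ p) := h2.mul_left
  have iS : Integrable (fun p : ℝ × EE N => (P.un V ε u (p.1 + τ) p.2 ^ P.q) * (V p.2 * ζ p)) := by
    refine bc_int (w := fun p : ℝ × EE N => P.un V ε u (p.1 + τ) p.2 ^ P.q) (C := P.M ^ P.q) ?_ (fun p => ?_) hVz hVzs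
    · exact ((um.comp (by fun_prop : Measurable (fun p : ℝ × EE N => (p.1 + τ, p.2)))).pow_const _)
    · have := ua (p.1 + τ, p.2)
      rw [abs_of_nonneg (Real.rpow_nonneg this.1 _)]; exact Real.rpow_le_rpow this.1 this.2 P.hq0.le
  have s1 : ∫ p, U p * ((ζ (p + (-τ) • (1, 0)) - ζ p) / (-τ)) = -(τ⁻¹ * ∫ p, (U (p + (τ, 0)) - U p) * ζ p) := by
    have i1 : Integrable (fun p => U (p + (τ, 0)) * ζ p) := bc_int (w := fun p => U (p + (τ, 0))) (Um.comp (measurable_add_const _)) (fun p => UC _) h1 h2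
    have i2 := bc_int Um UC h1 h2
    have i3 : Integrable (fun p => U p * ζ (p + (-τ) • (1, 0))) := bc_int Um UC (h1.comp (continuous_add_right _)) (cs_shift h2 _)
    have e : ∀ p, U p * ((ζ (p + (-τ) • (1, 0)) - ζ p) / (-τ)) = -(τ⁻¹ * (U p * ζ (p + (-τ) • (1, 0)) - U p * ζ p)) := fun p => by field_simp
    simp only [e, sub_mul]
    rw [integral_neg, integral_const_mul, integral_sub i3 i2, integral_sub i1 i2]
    congr 3
    rw [← integral_add_right_eq_self _ ((τ, 0) : ℝ × EE N)]
    congr 1; ext p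
    simp [add_assoc, p00]
  have s2 : ∫ p, (U (p + (τ, 0)) - U p) * ζ p = ∫ p in HH N, (P.c * (Dl ε (fun y => P.un V ε u p.1 y ^ P.m) p.2 * ζ p) - τ * ((P.un V ε u (p.1 + τ) p.2 ^ P.q) * (V p.2 * ζ p))) := by
    rw [← integral_indicator HH_meas]
    refine integral_congr_ae ?_
    filter_upwards [ae_ne_zero] with p hp
    by_cases h : p ∈ HH N
    · rw [indicator_of_mem h]
      have h3 := St_eq (un_adm hu hV ε p.1) hV.2.1 ε p.2
      rw [← un_step u V h0 (le_of_lt h)] at h3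
      simp only [hU, Prod.fst_add, Prod.snd_add, add_zero]
      linear_combination ζ p * h3
    · rw [indicator_of_notMem h]
      have hlt : p.1 < 0 := lt_of_le_of_ne (not_lt.1 h) hp
      simp only [hU, Prod.fst_add, Prod.snd_add, add_zero]
      rw [un_neg u V h0 (by linarith : p.1 + τ < P.tau ε), un_neg u V h0 (by linarith : p.1 < P.tau ε)]
      simp
  rw [s1, s2, integral_sub (hL.1.const_mul _) (iS.const_mul _).integrableOn, integral_const_mul, integral_const_mul, hL.2]
  have s3 : ∫ p in HH N, (P.un V ε u (p.1 + τ) p.2 ^ P.q) * (V p.2 * ζ p) = ∫ p : ℝ × EE N, ({p : ℝ × EE N | τ < p.1}.indicator (fun p => P.un V ε u p.1 p.2 ^ P.q) p) * (V p.2 * ζ (p + (-τ) • (1, 0))) := by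
    rw [← integral_indicator HH_meas, ← integral_add_right_eq_self (fun p : ℝ × EE N => ({p : ℝ × EE N | τ < p.1}.indicator (fun p => P.un V ε u p.1 p.2 ^ P.q) p) * (V p.2 * ζ (p + (-τ) • (1, 0)))) ((τ, 0) : ℝ × EE N)]
    congr 1; ext p
    by_cases h : 0 < p.1
    · simp [indicator, HH, h, add_assoc, p00]
    · simp [indicator, HH, h]
  rw [← s3]
  have : τ = P.c * ε ^ 2 := rfl
  have hc := P.hc
  rw [this]
  field_simp
  ring
end Par
end

section
namespace Par
variable {N : ℕ} {P : Par N}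
theorem Dz_cont {ζ : ℝ × EE N → ℝ} (h1 : Continuous ζ) (ε : ℝ) : Continuous (Dz ε ζ) := by
  unfold Dz
  exact (PiLp.continuous_toLp 2 _).comp (continuous_pi fun i => by fun_prop)
theorem Gz_cont {ζ : ℝ × EE N → ℝ} (h1 : ContDiff ℝ 1 ζ) : Continuous (Gz ζ) := by
  unfold Gz
  have := h1.continuous_fderiv one_ne_zero
  exact (PiLp.continuous_toLp 2 _).comp (continuous_pi fun i => by fun_prop)
theorem Dz_unif {ζ : ℝ × EE N → ℝ} (h1 : ContDiff ℝ 1 ζ) (h2 : HasCompactSupport ζ) {e : ℕ → ℝ} (he : Tendsto e atTop (𝓝 0)) (h0 : ∀ n, 0 < e n) (hle : ∀ n, e n ≤ 1) :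
    ∃ K : Set (ℝ × EE N), IsCompact K ∧ (∀ n, ∀ p ∉ K, Dz (e n) ζ p = 0) ∧ (∀ p ∉ K, Gz ζ p = 0) ∧
      ∃ η : ℕ → ℝ, (∀ n p, ‖Dz (e n) ζ p - Gz ζ p‖ ≤ η n) ∧ Tendsto η atTop (𝓝 0) := by
  choose K hK hK2 using fun i : Fin N => diff_supp h2 ((0 : ℝ), (ee i : EE N))
  refine ⟨⋃ i, K i, isCompact_iUnion hK, ?_, ?_, ?_⟩
  · intro n p hp
    simp only [mem_iUnion, not_exists] at hp
    ext i
    have := hK2 i (e n) (by rw [abs_of_pos (h0 n)]; exact hle n) p (hp i)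
    simp [Dz, this.1, this.2.1]
    have h := this.2.1
    simp at h; rw [h]; simp
  · intro p hp
    simp only [mem_iUnion, not_exists] at hp
    ext i
    have := hK2 i 0 (by simp) p (hp i)
    simp [Gz, this.2.2]
  · have hb : ∀ n p, ‖Dz (e n) ζ p - Gz ζ p‖ ≤ ∑ i : Fin N, |(ζ (p + e n • (0, ee i)) - ζ p) / e n - fderiv ℝ ζ p (0, ee i)| := fun n p => by
      refine (norm_le_sum _).trans (le_of_eq ?_)
      simp [Dz, Gz]
    have hbd : ∀ n, BddAbove (range fun p => ‖Dz (e n) ζ p - Gz ζ p‖) := by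
      intro n
      have hc : Continuous (fun p => ‖Dz (e n) ζ p - Gz ζ p‖) := ((Dz_cont h1.continuous _).sub (Gz_cont h1)).norm
      refine hc.bddAbove_range_of_hasCompactSupport ?_
      refine HasCompactSupport.intro (isCompact_iUnion hK) fun p hp => ?_
      simp only [mem_iUnion, not_exists] at hp
      have : Dz (e n) ζ p - Gz ζ p = 0 := by
        ext i
        have := hK2 i (e n) (by rw [abs_of_pos (h0 n)]; exact hle n) p (hp i)
        have h := this.2.1
        simp at h
        simp [Dz, Gz, this.1, this.2.2, h]
      rw [this, norm_zero]
    refine ⟨fun n => ⨆ p, ‖Dz (e n) ζ p - Gz ζ p‖, fun n p => le_ciSup (hbd n) p, ?_⟩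
    rw [Metric.tendsto_atTop]
    intro κ hκ
    have hκ' : 0 < κ / (2 * (N + 1)) := by positivity
    choose δ hδ hd using fun i : Fin N => diff_unif h1 h2 ((0 : ℝ), (ee i : EE N)) hκ'
    have ev : ∀ᶠ n in atTop, ∀ i : Fin N, e n < δ i := by
      rw [eventually_all]; exact fun i => he.eventually (gt_mem_nhds (hδ i))
    obtain ⟨n0, hn0⟩ := eventually_atTop.1 ev
    refine ⟨n0, fun n hn => ?_⟩
    rw [Real.dist_eq, sub_zero, abs_of_nonneg (Real.iSup_nonneg fun p => norm_nonneg _)]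
    refine lt_of_le_of_lt (ciSup_le fun p => (hb n p).trans (Finset.sum_le_sum fun i _ => hd i (e n) (by rw [abs_of_pos (h0 n)]; exact h0 n) (by rw [abs_of_pos (h0 n)]; exact hn0 n hn i) p)) ?_
    simp only [Finset.sum_const, Finset.card_univ, Fintype.card_fin, nsmul_eq_mul]
    rw [mul_div_assoc', div_lt_iff₀ (by positivity)]
    nlinarith [(Nat.cast_nonneg N : (0:ℝ) ≤ N)]
theorem vec_sum (v : EE N) : v = ∑ i, v i • ee i := by
  ext j; simp [ee, Finset.sum_apply, Pi.single_apply]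
theorem fd_inner (ζ : ℝ × EE N → ℝ) (p : ℝ × EE N) (v : EE N) : fderiv ℝ ζ p (0, v) = inner ℝ v (Gz ζ p) := by
  have : ((0:ℝ), v) = ∑ i, v i • ((0:ℝ), (ee i : EE N)) := by
    conv_lhs => rw [vec_sum v]
    ext
    · simp [Prod.fst_sum]
    · simp [Prod.snd_sum]
  unfold Gz
  rw [this, map_sum, inner_toLp]; exact Finset.sum_congr rfl fun i _ => by rw [map_smul, smul_eq_mul]
/-- weak solution data on the half space, abstract form -/
structure WS (N : ℕ) (m q : ℝ) (V u : EE N → ℝ) (b : ℝ × EE N → ℝ) (g : ℝ × EE N → EE N) : Prop where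
  bm : Measurable b
  gm : Measurable g
  b0 : ∀ p, 0 ≤ b p
  off : ∀ p ∉ HH N, b p = u p.2
  goff : ∀ p ∉ HH N, g p = 0
  g2 : ∀ K : Set (ℝ × EE N), IsCompact K → IntegrableOn (fun p => ‖g p‖ ^ 2) K
  grad : ∀ ζ : ℝ × EE N → ℝ, ContDiff ℝ 1 ζ → HasCompactSupport ζ → ∀ i, ∫ p in HH N, b p ^ m * fderiv ℝ ζ p (0, ee i) = - ∫ p in HH N, g p i * ζ p
  eq : ∀ ζ : ℝ × EE N → ℝ, ContDiff ℝ 1 ζ → HasCompactSupport ζ →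
    ∫ p in HH N, ((u p.2 - b p) * fderiv ℝ ζ p (1, 0) + fderiv ℝ ζ p (0, g p) + V p.2 * b p ^ q * ζ p) = 0
theorem wt_lower (K : Set (ℝ × EE N)) (hK : IsCompact K) : ∃ c > 0, ∀ p ∈ K, c ≤ wt p := by
  rcases K.eq_empty_or_nonempty with rfl | hne
  · exact ⟨1, one_pos, fun p hp => hp.elim⟩
  · obtain ⟨p0, -, h0⟩ := hK.exists_isMinOn hne (wt_cont (N := N)).continuousOn
    exact ⟨wt p0, wt_pos p0, fun p hp => h0 hp⟩
theorem construct {u : EE N → ℝ} (hu : P.Adm u) {σ : ℝ} (hσ : 0 < σ) :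
    ∃ b g, WS N P.m P.q (Vp N σ) u b g ∧ (∀ p, b p ≤ P.M) ∧
     ∀ η > 0, ∃ t0 > 0, ∀ᵐ t : ℝ, 0 < t → t < t0 → ∫ x, |b (t, x) - u x| * xi x ≤ η := by
  have hV := Vp_adm (N := N) hσ
  have hVc := Vp_cont (N := N) hσ
  obtain ⟨ns, hns, b, bm, bb, hb⟩ := un_limit hu hσ
  obtain ⟨ms, hms, g, gm, g0, g2, hg⟩ := grad_limit hu hV ns
  set V := Vp N σ with hVd
  set e : ℕ → ℝ := fun j => eps (ns (ms j)) with he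
  have e0 : ∀ j, 0 < e j := fun j => eps_pos _
  have e1 : ∀ j, e j ≤ 1 := fun j => eps_le _
  have et : Tendsto e atTop (𝓝 0) := eps_tendsto.comp ((hns.comp hms).tendsto_atTop)
  have τt : Tendsto (fun j => P.tau (e j)) atTop (𝓝 0) := tau_tendsto.comp ((hns.comp hms).tendsto_atTop)
  have hb' : ∀ᵐ p : ℝ × EE N, Tendsto (fun j => P.un V (e j) u p.1 p.2) atTop (𝓝 (b p)) := by
    filter_upwards [hb] with p hp
    exact hp.comp hms.tendsto_atTop
  have um := fun j => un_meas hu hV (e j)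
  have ua := fun j (p : ℝ × EE N) => (un_adm hu hV (e j) p.1).2 p.2
  have MP := P.hM
  have b_off : ∀ᵐ p : ℝ × EE N, p ∉ HH N → b p = u p.2 := by
    filter_upwards [hb'] with p hp h
    refine tendsto_nhds_unique hp ?_
    refine tendsto_const_nhds.congr fun j => ?_
    rw [un_neg u V (e0 j) (lt_of_le_of_lt (not_lt.1 h) (tau_pos (e0 j)))]
  classical
  set B : ℝ × EE N → ℝ := fun p => if p ∈ HH N then b p else u p.2 with hB
  have BH : ∀ p ∈ HH N, B p = b p := fun p hp => if_pos hp
  have Bm : Measurable B := Measurable.ite HH_meas bm (hu.1.comp measurable_snd)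
  refine ⟨B, g, ⟨Bm, gm, fun p => ?_, fun p hp => if_neg hp, g0, fun K hK => ?_, ?_, ?_⟩, fun p => ?_, ?_⟩
  · simp only [hB]; split_ifs; exacts [(bb p).1, (hu.2 _).1]
  · obtain ⟨c, hc0, hc⟩ := wt_lower K hK
    have : IntegrableOn (fun p => c⁻¹ * (wt p * ‖g p‖ ^ 2)) K := (g2.const_mul _).integrableOn
    refine Integrable.mono' this (gm.norm.pow_const 2).aestronglyMeasurable ((ae_restrict_iff' hK.measurableSet).2 (Eventually.of_forall fun p hp => ?_))
    rw [Real.norm_eq_abs, abs_of_nonneg (sq_nonneg _), ← mul_assoc]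
    have : 1 ≤ c⁻¹ * wt p := by rw [inv_mul_eq_div, one_le_div hc0]; exact hc p hp
    nlinarith [sq_nonneg ‖g p‖]
  · intro ζ h1 h2 i
    have t1 := hg (fun _ p => ζ p • ee i) (fun p => ζ p • ee i) (tsupport ζ) (fun _ => 0) h2 (fun _ => h1.continuous.smul continuous_const) (h1.continuous.smul continuous_const)
      (fun _ p hp => by rw [image_eq_zero_of_notMem_tsupport hp, zero_smul]) (fun p hp => by rw [image_eq_zero_of_notMem_tsupport hp, zero_smul]) (fun _ p => by simp) tendsto_const_nhds
    have wC : ∀ j (p : ℝ × EE N), |P.un V (e j) u p.1 p.2 ^ P.m| ≤ P.M ^ P.m := fun j p => by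
      rw [abs_of_nonneg ((un_adm hu hV (e j) p.1).pow_nonneg p.2)]; exact (un_adm hu hV (e j) p.1).pow_le p.2
    have e2 : ∀ j, ∫ p in HH N, inner ℝ (P.Dn V (e j) u p) (ζ p • ee i) = - ∫ p in HH N, P.un V (e j) u p.1 p.2 ^ P.m * ((ζ (p + (-(e j)) • (0, ee i)) - ζ p) / (-(e j))) := fun j => by
      have h := ibp ((um j).pow_const P.m) (wC j) h1.continuous h2 (e j • ee i)
      have hj := (e0 j).ne'
      have a1 : ∀ p : ℝ × EE N, inner ℝ (P.Dn V (e j) u p) (ζ p • ee i) = (e j)⁻¹ * ((P.un V (e j) u (p + (0, e j • ee i)).1 (p + (0, e j • ee i)).2 ^ P.m - P.un V (e j) u p.1 p.2 ^ P.m) * ζ p) := fun p => by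
        rw [real_inner_smul_right]
        have : inner ℝ (P.Dn V (e j) u p) (ee i) = P.Dn V (e j) u p i := by simp [ee, PiLp.inner_apply]
        rw [this]
        simp [Dn, Dw]; ring
      have a2 : ∀ p : ℝ × EE N, P.un V (e j) u p.1 p.2 ^ P.m * ((ζ (p + (-(e j)) • (0, ee i)) - ζ p) / (-(e j))) = (-(e j)⁻¹) * (P.un V (e j) u p.1 p.2 ^ P.m * (ζ (p + (0, -(e j • ee i))) - ζ p)) := fun p => by
        have : (-(e j)) • ((0:ℝ), (ee i : EE N)) = (0, -(e j • ee i)) := by simp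
        rw [this]; field_simp
      simp only [a1, a2]
      rw [integral_const_mul, integral_const_mul, h]; ring
    obtain ⟨K, hK, hK2⟩ := diff_supp h2 ((0:ℝ), (ee i : EE N))
    obtain ⟨C, hC0, hC⟩ := diff_bdd h1 h2 ((0:ℝ), (ee i : EE N))
    have hc := h1.continuous
    have t2 : Tendsto (fun j => ∫ p in HH N, P.un V (e j) u p.1 p.2 ^ P.m * ((ζ (p + (-(e j)) • (0, ee i)) - ζ p) / (-(e j)))) atTop (𝓝 (∫ p in HH N, b p ^ P.m * fderiv ℝ ζ p (0, ee i))) := by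
      refine dct_prod (K := K) (C1 := P.M ^ P.m) (C2 := C) hK.measurableSet ((Measure.restrict_apply_le _ _).trans_lt hK.measure_lt_top).ne (fun j => (um j).pow_const _) (fun j => by fun_prop) wC (Real.rpow_nonneg P.hM _) (fun j p => hC _ p)
        (fun j p hp => ?_) (ae_restrict_of_ae ?_) (fun p => ?_)
      · have := hK2 (-(e j)) (by rw [abs_neg, abs_of_pos (e0 j)]; exact e1 j) p hp
        rw [this.1, this.2.1]; simp
      · filter_upwards [hb'] with p hp
        exact hp.rpow_const (Or.inr (by linarith [P.hm]))
      · exact diff_tendsto h1 _ (by simpa using et.neg) (fun n => neg_ne_zero.2 (e0 n).ne') p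
    have t3 := t2.neg.congr fun j => (e2 j).symm
    have := tendsto_nhds_unique t1 t3
    have e3 : ∫ p in HH N, g p i * ζ p = ∫ p in HH N, inner ℝ (g p) (ζ p • ee i) := by
      congr 1; ext p; rw [real_inner_smul_right]; simp [ee, PiLp.inner_apply]; ring
    rw [e3, this, neg_neg]
    exact setIntegral_congr_fun HH_meas fun p hp => by simp only [BH p hp]
  · intro ζ h1 h2
    obtain ⟨K, hK, hKz, hKg, η, hη, hη0⟩ := Dz_unif h1 h2 et e0 e1
    have t1 := hg (fun j => Dz (e j) ζ) (Gz ζ) K η hK (fun j => Dz_cont h1.continuous _) (Gz_cont h1) hKz hKg hη hη0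
    have hc := h1.continuous
    have UC : ∀ j (p : ℝ × EE N), |P.un V (e j) u p.1 p.2 - u p.2| ≤ P.M := fun j p => by
      rw [abs_le]; have := ua j p; have := hu.2 p.2; constructor <;> linarith
    obtain ⟨K1, hK1, hK2⟩ := diff_supp h2 ((1:ℝ), (0 : EE N))
    obtain ⟨C, hC0, hC⟩ := diff_bdd h1 h2 ((1:ℝ), (0 : EE N))
    have τ0 : ∀ j, 0 < P.tau (e j) := fun j => tau_pos (e0 j)
    have tt := τt.eventually (gt_mem_nhds one_pos)
    obtain ⟨n0, hn0⟩ := eventually_atTop.1 tt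
    have s0 : Tendsto (fun j : ℕ => j + n0) atTop atTop := tendsto_add_atTop_nat n0
    have τa : ∀ j, |-(P.tau (e (j + n0)))| ≤ 1 := fun j => by rw [abs_neg, abs_of_pos (τ0 _)]; exact (hn0 _ (by omega)).le
    have τt' : Tendsto (fun j => P.tau (e (j + n0))) atTop (𝓝 0) := τt.comp s0
    have t2 : Tendsto (fun j => ∫ p : ℝ × EE N, (P.un V (e (j+n0)) u p.1 p.2 - u p.2) * ((ζ (p + (-(P.tau (e (j+n0)))) • (1, 0)) - ζ p) / (-(P.tau (e (j+n0)))))) atTop (𝓝 (∫ p, (b p - u p.2) * fderiv ℝ ζ p (1, 0))) := by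
      refine dct_prod (K := K1) (C1 := P.M) (C2 := C) hK1.measurableSet hK1.measure_lt_top.ne (fun j => (um _).sub (hu.1.comp measurable_snd)) (fun j => by fun_prop) (fun j => UC _) P.hM (fun j p => hC _ p)
        (fun j p hp => ?_) ?_ (fun p => ?_)
      · have := hK2 _ (τa j) p hp
        rw [this.1, this.2.1]; simp
      · filter_upwards [hb'] with p hp
        exact (hp.comp s0).sub_const _
      · exact diff_tendsto h1 _ (by simpa using τt'.neg) (fun n => neg_ne_zero.2 (τ0 _).ne') p
    obtain ⟨CV, hCV⟩ : ∃ CV, ∀ p ∈ K1, |V p.2| ≤ CV := by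
      obtain ⟨CV, h⟩ := hK1.exists_bound_of_continuousOn (f := fun p : ℝ × EE N => V p.2) (by fun_prop)
      exact ⟨CV, h⟩
    obtain ⟨Cz, hCz⟩ := h2.exists_bound_of_continuous hc
    have hCz0 : 0 ≤ Cz := (norm_nonneg _).trans (hCz 0)
    have t3 : Tendsto (fun j => ∫ p : ℝ × EE N, ({p : ℝ × EE N | P.tau (e (j+n0)) < p.1}.indicator (fun p => P.un V (e (j+n0)) u p.1 p.2 ^ P.q) p) * (V p.2 * ζ (p + (-(P.tau (e (j+n0)))) • (1, 0)))) atTop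
        (𝓝 (∫ p, ((HH N).indicator (fun p => b p ^ P.q) p) * (V p.2 * ζ p))) := by
      refine dct_prod (K := K1) (C1 := P.M ^ P.q) (C2 := |CV| * Cz) hK1.measurableSet hK1.measure_lt_top.ne (fun j => ((um _).pow_const _).indicator (measurableSet_lt measurable_const measurable_fst)) (fun j => by fun_prop) (fun j p => ?_) (Real.rpow_nonneg P.hM _) (fun j p => ?_)
        (fun j p hp => ?_) ?_ (fun p => ?_)
      · have := ua (j+n0) p
        rw [abs_of_nonneg (indicator_nonneg (fun p _ => Real.rpow_nonneg (ua (j+n0) p).1 _) p)]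
        exact indicator_apply_le' (fun _ => Real.rpow_le_rpow this.1 this.2 P.hq0.le) (fun _ => Real.rpow_nonneg P.hM _)
      · rw [abs_mul]
        by_cases hp : p ∈ K1
        · exact mul_le_mul ((hCV p hp).trans (le_abs_self _)) (hCz _) (abs_nonneg _) (abs_nonneg _)
        · rw [(hK2 _ (τa j) p hp).2.1]; simp; positivity
      · rw [(hK2 _ (τa j) p hp).2.1]; simp
      · filter_upwards [hb'] with p hp
        by_cases h : p ∈ HH N
        · rw [indicator_of_mem h]
          refine ((hp.comp s0).rpow_const (Or.inr P.hq0.le)).congr' ?_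
          filter_upwards [τt'.eventually (gt_mem_nhds (show 0 < p.1 from h))] with j hj
          rw [indicator_of_mem (by exact hj)]; rfl
        · rw [indicator_of_notMem h]
          refine tendsto_const_nhds.congr fun j => ?_
          rw [indicator_of_notMem]
          simp only [mem_setOf_eq, not_lt]
          exact (not_lt.1 h).trans (τ0 _).le
      · have : Tendsto (fun j => p + (-(P.tau (e (j+n0)))) • ((1:ℝ), (0 : EE N))) atTop (𝓝 (p + (-0 : ℝ) • ((1:ℝ), (0 : EE N)))) := tendsto_const_nhds.add (τt'.neg.smul_const _)
        simp only [neg_zero, zero_smul, add_zero] at this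
        exact ((hc.tendsto p).comp this).const_mul _
    have t4 := ((t1.comp s0).add t3).congr fun j => (discrete hu hV hVc (e0 (j + n0)) hc h2).symm
    have E := tendsto_nhds_unique t2 t4
    have iA : Integrable (fun p => (b p - u p.2) * fderiv ℝ ζ p (1, 0)) := by
      refine bc_int (w := fun p => b p - u p.2) (ζ := fun p => fderiv ℝ ζ p (1, 0)) (C := P.M) (bm.sub (hu.1.comp measurable_snd)) (fun p => ?_) ((h1.continuous_fderiv one_ne_zero).clm_apply continuous_const) ?_
      · rw [abs_le]; have := bb p; have := hu.2 p.2; constructor <;> linarith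
      · exact (h2.fderiv (𝕜 := ℝ)).comp_left (g := fun L : (ℝ × EE N) →L[ℝ] ℝ => L (1, 0)) rfl
    have iC : Integrable (fun p => ((HH N).indicator (fun p => b p ^ P.q) p) * (V p.2 * ζ p)) := by
      refine bc_int (w := (HH N).indicator (fun p => b p ^ P.q)) (C := P.M ^ P.q) ((bm.pow_const _).indicator HH_meas) (fun p => ?_) (by fun_prop) (h2.mul_left)
      rw [abs_of_nonneg (indicator_nonneg (fun p _ => Real.rpow_nonneg (bb p).1 _) p)]
      exact indicator_apply_le' (fun _ => Real.rpow_le_rpow (bb p).1 (bb p).2 P.hq0.le) (fun _ => Real.rpow_nonneg P.hM _)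
    have iB : IntegrableOn (fun p => inner ℝ (g p) (Gz ζ p)) (HH N) := by
      obtain ⟨c, hc0, hc⟩ := wt_lower K hK
      obtain ⟨CG, hCG⟩ := (HasCompactSupport.intro hK hKg).exists_bound_of_continuous (Gz_cont h1)
      have hCG0 := (norm_nonneg _).trans (hCG 0)
      have iK : Integrable (K.indicator fun _ => (1:ℝ)) := (integrable_indicator_iff hK.measurableSet).2 (integrableOn_const hK.measure_lt_top.ne)
      refine (Integrable.mono' (((iK.fun_add (g2.const_mul c⁻¹)).const_mul CG)) (gm.inner (Gz_cont h1).measurable).aestronglyMeasurable (Eventually.of_forall fun p => ?_)).integrableOn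
      by_cases hp : p ∈ K
      · rw [indicator_of_mem hp]
        have a1 : ‖g p‖ ≤ 1 + ‖g p‖ ^ 2 := by nlinarith [sq_nonneg (‖g p‖ - 1), norm_nonneg (g p)]
        have a2 : ‖g p‖ ^ 2 ≤ c⁻¹ * (wt p * ‖g p‖ ^ 2) := by
          rw [← mul_assoc]
          have : 1 ≤ c⁻¹ * wt p := by rw [inv_mul_eq_div, one_le_div hc0]; exact hc p hp
          nlinarith [sq_nonneg ‖g p‖]
        refine (norm_inner_le_norm _ _).trans ?_
        rw [mul_comm]
        exact mul_le_mul (hCG p) (by linarith) (norm_nonneg _) hCG0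
      · rw [hKg p hp, indicator_of_notMem hp]; simp only [inner_zero_right, norm_zero]
        have := wt_pos p; positivity
    have eA : ∫ p, (b p - u p.2) * fderiv ℝ ζ p (1, 0) = ∫ p in HH N, (b p - u p.2) * fderiv ℝ ζ p (1, 0) := by
      rw [← integral_indicator HH_meas]
      refine integral_congr_ae ?_
      filter_upwards [b_off] with p hp
      by_cases h : p ∈ HH N
      · rw [indicator_of_mem h]
      · rw [indicator_of_notMem h, hp h]; simp
    have eC : ∫ p, ((HH N).indicator (fun p => b p ^ P.q) p) * (V p.2 * ζ p) = ∫ p in HH N, b p ^ P.q * (V p.2 * ζ p) := by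
      rw [← integral_indicator HH_meas]
      congr 1; ext p
      by_cases h : p ∈ HH N <;> simp [h]
    have iC' : IntegrableOn (fun p => b p ^ P.q * (V p.2 * ζ p)) (HH N) := by
      rw [← integrable_indicator_iff HH_meas]
      refine iC.congr (Eventually.of_forall fun p => ?_)
      by_cases h : p ∈ HH N <;> simp [h]
    rw [eA, eC] at E
    have e5 : ∫ p in HH N, ((u p.2 - B p) * fderiv ℝ ζ p (1, 0) + fderiv ℝ ζ p (0, g p) + V p.2 * B p ^ P.q * ζ p) = ∫ p in HH N, (-((b p - u p.2) * fderiv ℝ ζ p (1, 0)) + inner ℝ (g p) (Gz ζ p) + b p ^ P.q * (V p.2 * ζ p)) := by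
      refine setIntegral_congr_fun HH_meas fun p hp => ?_
      simp only [BH p hp, fd_inner]; ring
    rw [e5, integral_add ((iA.integrableOn.fun_neg).fun_add iB) iC', integral_add iA.integrableOn.fun_neg iB, integral_neg, E]
    ring
  · simp only [hB]; split_ifs; exacts [(bb p).2, (hu.2 _).2]
  · intro η hη
    obtain ⟨v, hv, ⟨C, hC⟩, huv⟩ := approx hu (by positivity : 0 < η / (8 * Real.exp P.K))
    set C' := |C| * (∫ x, xi (x : EE N)) + P.M ^ P.q * ∫ x, V x * xi x with hC'
    have hV1 : 0 ≤ ∫ x, V x * xi x := integral_nonneg fun x => mul_nonneg (hV.2.1 x) (xi_pos x).le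
    have hx1 : 0 ≤ ∫ x : EE N, xi x := integral_nonneg fun x => (xi_pos x).le
    have hMq := Real.rpow_nonneg P.hM P.q
    have hC'0 : 0 ≤ C' := by positivity
    refine ⟨min 1 (η / (2 * Real.exp P.K * (C' + 1))), by positivity, ?_⟩
    have hae : ∀ᵐ t : ℝ, ∀ᵐ x : EE N, Tendsto (fun j => P.un V (e j) u t x) atTop (𝓝 (b (t, x))) := by
      rw [Measure.volume_eq_prod] at hb'
      exact Measure.ae_ae_of_ae_prod hb'
    filter_upwards [hae] with t ht h0 ht0
    have tt : Tendsto (fun j => ∫ x, |P.un V (e j) u t x - u x| * xi x) atTop (𝓝 (∫ x, |b (t, x) - u x| * xi x)) := by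
      refine tendsto_integral_of_dominated_convergence (fun x => P.M * xi x) (fun j => ((((un_adm hu hV (e j) t).1.sub hu.1).abs).mul xi_meas).aestronglyMeasurable) (xi_int0.const_mul _) (fun j => Eventually.of_forall fun x => ?_) ?_
      · rw [norm_mul, Real.norm_eq_abs, Real.norm_eq_abs, abs_abs, abs_of_pos (xi_pos x)]
        refine mul_le_mul_of_nonneg_right ?_ (xi_pos x).le
        rw [abs_le]; have := ua j (t, x); have := hu.2 x; constructor <;> linarith
      · filter_upwards [ht] with x hx
        exact ((hx.sub_const _).abs).mul_const _
    have eB : ∫ x, |B (t, x) - u x| * xi x = ∫ x, |b (t, x) - u x| * xi x := by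
      congr 1; ext x; rw [BH (t, x) h0]
    rw [eB]
    have hle : ∀ j, ∫ x, |P.un V (e j) u t x - u x| * xi x ≤ Real.exp P.K * (2 * (η / (8 * Real.exp P.K)) + (t + P.tau (e j)) * C') := fun j => by
      have h := un_time hu hv hV (e0 j) (e1 j) (abs_nonneg C) (fun x => (hC (e j) (by rw [abs_of_pos (e0 j)]; exact e1 j) x).trans (by gcongr; exact le_abs_self C)) h0.le
      rw [un_neg u V (e0 j) (tau_pos (e0 j))] at h
      refine h.trans ?_
      have h1 : |t| ≤ 1 := by rw [abs_of_pos h0]; exact ht0.le.trans (min_le_left _ _)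
      have hK := P.K_nonneg
      have : P.K * |t| ≤ P.K := by nlinarith
      have h3 := tau_nonneg (P := P) (e j)
      have h4 := nd_nonneg u v
      rw [sub_zero]
      gcongr
    have lim : Tendsto (fun j => Real.exp P.K * (2 * (η / (8 * Real.exp P.K)) + (t + P.tau (e j)) * C')) atTop (𝓝 (Real.exp P.K * (2 * (η / (8 * Real.exp P.K)) + (t + 0) * C'))) :=
      (tendsto_const_nhds.add ((tendsto_const_nhds.add τt).mul_const _)).const_mul _
    refine (le_of_tendsto_of_tendsto' tt lim hle).trans ?_
    have h5 : t * C' ≤ η / (2 * Real.exp P.K) := by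
      have h6 : t ≤ η / (2 * Real.exp P.K * (C' + 1)) := ht0.le.trans (min_le_right _ _)
      have : t * (C' + 1) ≤ η / (2 * Real.exp P.K) := by
        rw [le_div_iff₀ (by positivity)] at h6 ⊢; linarith
      nlinarith
    rw [add_zero]
    calc _ ≤ Real.exp P.K * (2 * (η / (8 * Real.exp P.K)) + η / (2 * Real.exp P.K)) := by gcongr
      _ = 3 / 4 * η := by field_simp; ring
      _ ≤ η := by linarith
end Par
end

section
section gen2
open scoped Pointwise
variable {Q : Type*} [NormedAddCommGroup Q] [NormedSpace ℝ Q] [FiniteDimensional ℝ Q]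
  [MeasureSpace Q] [BorelSpace Q] [(volume : Measure Q).IsAddHaarMeasure]
def Bm (f : Q → ℝ) : Prop := Measurable f ∧ ∃ C, ∀ p, |f p| ≤ C
def L2l (f : Q → ℝ) : Prop := Measurable f ∧ ∀ K : Set Q, IsCompact K → IntegrableOn (fun p => f p ^ 2) K
def WD (v : Q) (F G : Q → ℝ) : Prop := ∀ ζ : Q → ℝ, ContDiff ℝ 1 ζ → HasCompactSupport ζ →
  (∫ p, F p * fderiv ℝ ζ p v) = - ∫ p, G p * ζ p
theorem Bm.mul {f g : Q → ℝ} (hf : Bm f) (hg : Bm g) : Bm (fun p => f p * g p) := by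
  obtain ⟨f1, C, hC⟩ := hf; obtain ⟨g1, D, hD⟩ := hg
  refine ⟨f1.mul g1, C * D, fun p => ?_⟩
  rw [abs_mul]; exact mul_le_mul (hC p) (hD p) (abs_nonneg _) ((abs_nonneg _).trans (hC p))
theorem Bm.sub {f g : Q → ℝ} (hf : Bm f) (hg : Bm g) : Bm (fun p => f p - g p) := by
  obtain ⟨f1, C, hC⟩ := hf; obtain ⟨g1, D, hD⟩ := hg
  exact ⟨f1.sub g1, C + D, fun p => (abs_sub _ _).trans (add_le_add (hC p) (hD p))⟩
theorem Bm.comp {f : Q → ℝ} (hf : Bm f) {Ψ : ℝ → ℝ} (hΨ : Continuous Ψ) : Bm (fun p => Ψ (f p)) := by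
  obtain ⟨f1, C, hC⟩ := hf
  obtain ⟨D, hD⟩ := (isCompact_Icc (a := -C) (b := C)).exists_bound_of_continuousOn hΨ.continuousOn
  exact ⟨hΨ.measurable.comp f1, D, fun p => hD _ (abs_le.1 (hC p))⟩
theorem Bm.ind {f : Q → ℝ} (hf : Bm f) {s : Set Q} (hs : MeasurableSet s) : Bm (s.indicator f) := by
  obtain ⟨f1, C, hC⟩ := hf
  refine ⟨f1.indicator hs, C, fun p => ?_⟩
  by_cases h : p ∈ s
  · rw [indicator_of_mem h]; exact hC p
  · rw [indicator_of_notMem h, abs_zero]; exact (abs_nonneg _).trans (hC p)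
theorem Bm.cc {f : Q → ℝ} (h1 : Continuous f) (h2 : HasCompactSupport f) : Bm f := by
  obtain ⟨C, hC⟩ := h2.exists_bound_of_continuous h1
  exact ⟨h1.measurable, C, hC⟩
theorem Bm.l2l {f : Q → ℝ} (hf : Bm f) : L2l f := by
  obtain ⟨f1, C, hC⟩ := hf
  refine ⟨f1, fun K hK => Measure.integrableOn_of_bounded (M := C ^ 2) hK.measure_lt_top.ne (f1.pow_const 2).aestronglyMeasurable (Eventually.of_forall fun p => ?_)⟩
  rw [Real.norm_eq_abs, abs_pow]; exact pow_le_pow_left₀ (abs_nonneg _) (hC p) 2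
theorem L2l.mul_bm {f g : Q → ℝ} (hf : L2l f) (hg : Bm g) : L2l (fun p => f p * g p) := by
  obtain ⟨g1, D, hD⟩ := hg
  refine ⟨hf.1.mul g1, fun K hK => Integrable.mono' ((hf.2 K hK).const_mul (D ^ 2)) ((hf.1.mul g1).pow_const 2).aestronglyMeasurable (Eventually.of_forall fun p => ?_)⟩
  rw [Real.norm_eq_abs, abs_of_nonneg (sq_nonneg _), mul_pow, mul_comm]
  exact mul_le_mul_of_nonneg_right (sq_le_sq' (by linarith [abs_le.1 (hD p)]) (abs_le.1 (hD p)).2) (sq_nonneg _)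
theorem L2l.sub {f g : Q → ℝ} (hf : L2l f) (hg : L2l g) : L2l (fun p => f p - g p) := by
  refine ⟨hf.1.sub hg.1, fun K hK => Integrable.mono' (((hf.2 K hK).const_mul 2).fun_add ((hg.2 K hK).const_mul 2)) ((hf.1.sub hg.1).pow_const 2).aestronglyMeasurable (Eventually.of_forall fun p => ?_)⟩
  rw [Real.norm_eq_abs, abs_of_nonneg (sq_nonneg _)]; nlinarith [sq_nonneg (f p + g p)]
theorem L2l.add {f g : Q → ℝ} (hf : L2l f) (hg : L2l g) : L2l (fun p => f p + g p) := by
  have h0 : L2l (fun p => (0:ℝ) - g p) := L2l.sub (Bm.l2l ⟨measurable_const, 0, by simp⟩) hg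
  simpa using hf.sub h0
theorem L2l.ind {f : Q → ℝ} (hf : L2l f) {s : Set Q} (hs : MeasurableSet s) : L2l (s.indicator f) := by
  have := hf.mul_bm (Bm.ind (f := fun _ => (1:ℝ)) ⟨measurable_const, 1, by simp⟩ hs)
  have e : s.indicator f = fun p => f p * s.indicator (fun _ => (1:ℝ)) p := by
    ext p; by_cases h : p ∈ s <;> simp [h]
  rw [e]; exact this
theorem L2l.sum {ι : Type*} (s : Finset ι) {f : ι → Q → ℝ} (hf : ∀ i, L2l (f i)) : L2l (fun p => ∑ i ∈ s, f i p) := by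
  classical
  induction s using Finset.induction_on with
  | empty => simpa using Bm.l2l (Q := Q) (f := fun _ => (0:ℝ)) ⟨measurable_const, 0, by simp⟩
  | insert a s ha ih => simp only [Finset.sum_insert ha]; exact (hf a).add ih
theorem int2 {f g : Q → ℝ} (hf : L2l f) (hg : L2l g) (hc : HasCompactSupport g) : Integrable (fun p => f p * g p) := by
  rw [← integrableOn_iff_integrable_of_support_subset (s := tsupport g)]
  · refine Integrable.mono' ((hf.2 _ hc).fun_add (hg.2 _ hc)) (hf.1.mul hg.1).aestronglyMeasurable (Eventually.of_forall fun p => ?_)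
    rw [Real.norm_eq_abs, abs_le]; constructor <;> nlinarith [sq_nonneg (f p + g p), sq_nonneg (f p - g p)]
  · intro p hp; exact subset_tsupport g fun h => hp (by simp [h])
theorem bm1 : Bm (fun _ : Q => (1:ℝ)) := ⟨measurable_const, 1, by simp⟩
theorem int1 {g : Q → ℝ} (hg : L2l g) (hc : HasCompactSupport g) : Integrable g := by
  simpa using int2 bm1.l2l hg hc
theorem L2l.mem {g : Q → ℝ} (hg : L2l g) (hc : HasCompactSupport g) : MemLp g 2 := by
  rw [memLp_two_iff_integrable_sq hg.1.aestronglyMeasurable]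
  simpa [sq] using int2 hg hg hc
theorem cs_ind {f : Q → ℝ} {K : Set Q} (hK : IsCompact K) : HasCompactSupport (K.indicator f) :=
  HasCompactSupport.intro hK fun p hp => indicator_of_notMem hp _
theorem L2l.loc {g : Q → ℝ} (hg : L2l g) : LocallyIntegrable g := by
  rw [locallyIntegrable_iff]
  intro K hK
  rw [← integrable_indicator_iff hK.measurableSet]
  exact int1 (hg.ind hK.measurableSet) (cs_ind hK)
/-- bumps -/
def bmp (Q : Type*) [NormedAddCommGroup Q] (j : ℕ) : ContDiffBump (0 : Q) := ⟨1 / (2 * ((j:ℝ) + 1)), 1 / ((j:ℝ) + 1), by positivity, by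
  apply one_div_lt_one_div_of_lt <;> linarith [(Nat.cast_nonneg j : (0:ℝ) ≤ j)]⟩
def kr (j : ℕ) : Q → ℝ := (bmp Q j).normed volume
def ml (j : ℕ) (f : Q → ℝ) : Q → ℝ := convolution f (kr j) (ContinuousLinearMap.lsmul ℝ ℝ) volume
theorem kr_cd (j : ℕ) : ContDiff ℝ 1 (kr j : Q → ℝ) := (bmp Q j).contDiff_normed
theorem kr_cs (j : ℕ) : HasCompactSupport (kr j : Q → ℝ) := (bmp Q j).hasCompactSupport_normed
theorem kr_nn (j : ℕ) (z : Q) : 0 ≤ kr j z := (bmp Q j).nonneg_normed z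
theorem kr_int (j : ℕ) : ∫ z : Q, kr j z = 1 := (bmp Q j).integral_normed
theorem kr_i (j : ℕ) : Integrable (kr j : Q → ℝ) := (bmp Q j).integrable_normed
theorem kr_supp {j : ℕ} {z : Q} (h : ¬ ‖z‖ ≤ 1 / ((j:ℝ)+1)) : kr j z = 0 := by
  have : z ∉ tsupport (kr j : Q → ℝ) := by
    unfold kr; rw [ContDiffBump.tsupport_normed_eq]; simpa [bmp] using h
  exact image_eq_zero_of_notMem_tsupport this
theorem ml_eq (j : ℕ) (f : Q → ℝ) (p : Q) : ml j f p = ∫ z, f z * kr j (p - z) := rfl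
theorem ml_eq2 (j : ℕ) (f : Q → ℝ) (p : Q) : ml j f p = ∫ z, f (p - z) * kr j z := by
  rw [ml_eq, ← integral_sub_left_eq_self (fun z => f z * kr j (p - z)) volume p]; simp
theorem ml_cd {f : Q → ℝ} (hf : L2l f) (j : ℕ) : ContDiff ℝ 1 (ml j f) :=
  HasCompactSupport.contDiff_convolution_right (n := 1) _ (kr_cs j) hf.loc (kr_cd j)
theorem ml_fd {v : Q} {F G : Q → ℝ} (hF : L2l F) (h : WD v F G) (j : ℕ) (p : Q) : fderiv ℝ (ml j F) p v = ml j G p := by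
  have h1 := HasCompactSupport.hasFDerivAt_convolution_right (ContinuousLinearMap.lsmul ℝ ℝ) (kr_cs j) hF.loc (kr_cd (Q := Q) j) p
  unfold ml
  rw [h1.fderiv, convolution_precompR_apply _ hF.loc ((kr_cs j).fderiv (𝕜 := ℝ)) ((kr_cd j).continuous_fderiv one_ne_zero)]
  have h2 := h (fun z => kr j (p - z)) ((kr_cd j).comp (contDiff_const.sub contDiff_id)) ((kr_cs j).comp_homeomorph (Homeomorph.subLeft p))
  have h3 : ∀ z, fderiv ℝ (fun z => kr j (p - z)) z v = - fderiv ℝ (kr j) (p - z) v := fun z => by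
    have e := (((kr_cd (Q := Q) j).differentiable one_ne_zero).differentiableAt (x := p - z)).hasFDerivAt.comp z ((hasFDerivAt_id z).const_sub p)
    have : fderiv ℝ (fun z => kr j (p - z)) z = _ := e.fderiv
    rw [this]; simp
  simp only [h3, mul_neg, integral_neg, neg_inj] at h2
  exact h2
theorem ml_bd {f : Q → ℝ} {C : ℝ} (hf : Measurable f) (hC : ∀ p, |f p| ≤ C) (j : ℕ) (p : Q) : |ml j f p| ≤ C := by
  rw [ml_eq2]
  have hi := (kr_i (Q := Q) j).const_mul C
  have : |∫ z, f (p - z) * kr j z| ≤ ∫ z : Q, C * kr j z := by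
    rw [← Real.norm_eq_abs]
    refine norm_integral_le_of_norm_le hi (Eventually.of_forall fun z => ?_)
    rw [norm_mul, Real.norm_eq_abs, Real.norm_eq_abs, abs_of_nonneg (kr_nn j z)]
    exact mul_le_mul_of_nonneg_right (hC _) (kr_nn j z)
  rwa [integral_const_mul, kr_int, mul_one] at this
theorem ml_ae {f : Q → ℝ} (hf : L2l f) : ∀ᵐ p, Tendsto (fun j => ml j f p) atTop (𝓝 (f p)) := by
  have h := ContDiffBump.ae_convolution_tendsto_right_of_locallyIntegrable (φ := bmp Q) (l := atTop) (K := 2) (μ := volume) (g := f) (by simpa [bmp] using tendsto_one_div_add_atTop_nhds_zero_nat (𝕜 := ℝ)) (Eventually.of_forall fun j => le_of_eq ?_) hf.loc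
  · filter_upwards [h] with p hp
    refine hp.congr fun j => ?_
    rw [ml_eq2, convolution_def]
    congr 1; ext z; simp [kr]; ring
  · simp only [bmp]; field_simp
theorem ml_loc {f : Q → ℝ} {K : Set Q} (hK : IsCompact K) : ∃ K', IsCompact K' ∧ K ⊆ K' ∧ ∀ (j : ℕ), ∀ p ∈ K, ml j f p = ml j (K'.indicator f) p := by
  refine ⟨K + Metric.closedBall 0 1, hK.add (isCompact_closedBall _ _), fun p hp => ⟨p, hp, 0, by simp, by simp⟩, fun j p hp => ?_⟩
  rw [ml_eq2, ml_eq2]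
  congr 1; ext z
  by_cases h : ‖z‖ ≤ 1 / ((j:ℝ)+1)
  · rw [indicator_of_mem]
    refine ⟨p, hp, -z, ?_, by simp [sub_eq_add_neg]⟩
    rw [mem_closedBall_zero_iff, norm_neg]
    refine h.trans ?_
    rw [div_le_one (by positivity)]; linarith [(Nat.cast_nonneg j : (0:ℝ) ≤ j)]
  · rw [kr_supp h]; simp
theorem ml_cs {f : Q → ℝ} {K : Set Q} (hK : IsCompact K) (hf : ∀ p ∉ K, f p = 0) (j : ℕ) {p : Q} (hp : p ∉ K + Metric.closedBall (0:Q) 1) : ml j f p = 0 := by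
  rw [ml_eq2]
  refine integral_eq_zero_of_ae (Eventually.of_forall fun z => ?_)
  by_cases h : ‖z‖ ≤ 1 / ((j:ℝ)+1)
  · simp only [Pi.zero_apply]; rw [hf _ fun h' => hp ⟨p - z, h', z, ?_, by simp⟩, zero_mul]
    rw [mem_closedBall_zero_iff]
    refine h.trans ?_
    rw [div_le_one (by positivity)]; linarith [(Nat.cast_nonneg j : (0:ℝ) ≤ j)]
  · simp [kr_supp h]
theorem ml_pair {w G : Q → ℝ} (hw : MemLp w 2) (hG : MemLp G 2) (hwm : Measurable w) (hGm : Measurable G) (j : ℕ) (y : Q) {T0 η : ℝ}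
    (h : ∀ z, ‖z‖ ≤ 1 / ((j:ℝ)+1) → |(∫ p, w p * G (p + y - z)) - T0| ≤ η) : |(∫ p, w p * ml j G (p + y)) - T0| ≤ η := by
  have hk := kr_i (Q := Q) j
  have hkc := (kr_cd (Q := Q) j).continuous
  have i1 : Integrable (Function.uncurry fun (p z : Q) => w p * (G (p + y - z) * kr j z)) (volume.prod volume) := by
    have a1 : Integrable (fun r : Q × Q => w r.1 ^ 2 * kr j r.2) (volume.prod volume) := hw.integrable_sq.mul_prod hk
    have a2 : Integrable (fun r : Q × Q => G (r.1 + y - r.2) ^ 2 * kr j r.2) (volume.prod volume) := by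
      have m2 : AEStronglyMeasurable (fun r : Q × Q => G (r.1 + y - r.2) ^ 2 * kr j r.2) (volume.prod volume) := by
        apply Measurable.aestronglyMeasurable
        exact ((hGm.comp ((measurable_fst.add_const y).sub measurable_snd)).pow_const 2).mul (hkc.measurable.comp measurable_snd)
      rw [integrable_prod_iff' m2]
      have e : ∀ (z : Q), (fun p => G (p + y - z) ^ 2 * kr j z) = fun p => (fun p => G p ^ 2 * kr j z) (p + (y - z)) := fun z => by ext p; simp [add_sub_assoc]
      refine ⟨Eventually.of_forall fun z => ?_, ?_⟩
      · simp only
        rw [e]; exact (hG.integrable_sq.mul_const _).comp_add_right (y - z)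
      · refine (hk.const_mul (∫ p, G p ^ 2)).congr (Eventually.of_forall fun z => ?_)
        simp only
        have : ∀ p, ‖G (p + y - z) ^ 2 * kr j z‖ = (fun p => G p ^ 2 * kr j z) (p + (y - z)) := fun p => by
          rw [Real.norm_eq_abs, abs_of_nonneg (mul_nonneg (sq_nonneg _) (kr_nn j z)), add_sub_assoc]
        simp only [this]
        rw [integral_add_right_eq_self (fun p => G p ^ 2 * kr j z) (y - z), integral_mul_const]
    refine Integrable.mono' (a1.add a2) ?_ (Eventually.of_forall fun r => ?_)
    · apply Measurable.aestronglyMeasurable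
      exact (hwm.comp measurable_fst).mul ((hGm.comp ((measurable_fst.add_const y).sub measurable_snd)).mul (hkc.measurable.comp measurable_snd))
    · simp only [Function.uncurry, Pi.add_apply]
      rw [← mul_assoc, norm_mul, Real.norm_eq_abs, Real.norm_eq_abs, abs_of_nonneg (kr_nn j r.2), ← add_mul]
      refine mul_le_mul_of_nonneg_right ?_ (kr_nn j _)
      rw [abs_le]; constructor <;> nlinarith [sq_nonneg (w r.1 + G (r.1 + y - r.2)), sq_nonneg (w r.1 - G (r.1 + y - r.2))]
  have e1 : ∫ p, w p * ml j G (p + y) = ∫ z, (∫ p, w p * G (p + y - z)) * kr j z := by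
    have := integral_integral_swap i1
    simp only [ml_eq2, ← integral_const_mul, ← integral_mul_const]
    rw [this]; congr 1; ext z; congr 1; ext p; ring
  have i3 : Integrable (fun z => (∫ p, w p * G (p + y - z)) * kr j z) := by
    have := i1.integral_prod_right
    refine this.congr (Eventually.of_forall fun z => ?_)
    simp only [Function.uncurry, ← integral_mul_const]
    congr 1; ext p; ring
  have e2 : T0 = ∫ z : Q, T0 * kr j z := by rw [integral_const_mul, kr_int, mul_one]
  rw [e1, e2, ← integral_sub i3 (hk.const_mul _), ← Real.norm_eq_abs]
  have : η = ∫ z : Q, η * kr j z := by rw [integral_const_mul, kr_int, mul_one]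
  rw [this]
  refine norm_integral_le_of_norm_le (hk.const_mul _) (Eventually.of_forall fun z => ?_)
  rw [← sub_mul, norm_mul, Real.norm_eq_abs, Real.norm_eq_abs, abs_of_nonneg (kr_nn j z)]
  by_cases hz : ‖z‖ ≤ 1 / ((j:ℝ)+1)
  · exact mul_le_mul_of_nonneg_right (h z hz) (kr_nn j z)
  · rw [kr_supp hz]; simp
end gen2
end

section
section gen3
open scoped Pointwise
variable {Q : Type*} [NormedAddCommGroup Q] [NormedSpace ℝ Q] [FiniteDimensional ℝ Q]
  [MeasureSpace Q] [BorelSpace Q] [(volume : Measure Q).IsAddHaarMeasure]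
theorem fd_c {ζ : Q → ℝ} (h1 : ContDiff ℝ 1 ζ) (v : Q) : Continuous (fun p => fderiv ℝ ζ p v) :=
  (h1.continuous_fderiv one_ne_zero).clm_apply continuous_const
theorem fd_cs {ζ : Q → ℝ} (h2 : HasCompactSupport ζ) (v : Q) : HasCompactSupport (fun p => fderiv ℝ ζ p v) :=
  (h2.fderiv (𝕜 := ℝ)).comp_left (g := fun L : Q →L[ℝ] ℝ => L v) rfl
theorem fd_bm {ζ : Q → ℝ} (h1 : ContDiff ℝ 1 ζ) (h2 : HasCompactSupport ζ) (v : Q) : Bm (fun p => fderiv ℝ ζ p v) :=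
  Bm.cc (fd_c h1 v) (fd_cs h2 v)
/-- product rule with a C¹ function -/
theorem WD.mul {v : Q} {F G ψ : Q → ℝ} (h : WD v F G) (hF : L2l F) (hG : L2l G) (hψ : ContDiff ℝ 1 ψ) :
    WD v (fun p => F p * ψ p) (fun p => G p * ψ p + F p * fderiv ℝ ψ p v) := by
  intro ζ h1 h2
  have h3 := h (fun p => ψ p * ζ p) (hψ.mul h1) h2.mul_left
  have d1 := hψ.differentiable one_ne_zero
  have d2 := h1.differentiable one_ne_zero
  have e : ∀ p, fderiv ℝ (fun p => ψ p * ζ p) p v = ψ p * fderiv ℝ ζ p v + fderiv ℝ ψ p v * ζ p := fun p => by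
    rw [fderiv_fun_mul (d1 p) (d2 p)]; simp; ring
  simp only [e, mul_add] at h3
  have c1 := fd_c h1 v
  have c2 := fd_c hψ v
  have hc := h1.continuous
  have hp := hψ.continuous
  have s1 : HasCompactSupport (fun p => ψ p * fderiv ℝ ζ p v) := (fd_cs h2 v).mul_left
  have s2 : HasCompactSupport (fun p => fderiv ℝ ψ p v * ζ p) := h2.mul_left
  have s3 : HasCompactSupport (fun p => ψ p * ζ p) := h2.mul_left
  have i1 := int2 hF (Bm.cc (hp.fun_mul c1) s1).l2l s1
  have i2 := int2 hF (Bm.cc (c2.fun_mul hc) s2).l2l s2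
  have i3 := int2 hG (Bm.cc (hp.fun_mul hc) s3).l2l s3
  rw [integral_add i1 i2] at h3
  have e2 : ∫ p, (G p * ψ p + F p * fderiv ℝ ψ p v) * ζ p = (∫ p, G p * (ψ p * ζ p)) + ∫ p, F p * (fderiv ℝ ψ p v * ζ p) := by
    rw [← integral_add i3 i2]; congr 1; ext p; ring
  have e3 : ∫ p, F p * ψ p * fderiv ℝ ζ p v = ∫ p, F p * (ψ p * fderiv ℝ ζ p v) := by congr 1; ext p; ring
  rw [e2, e3]; linarith
/-- chain rule -/
theorem WD.chain {v : Q} {F G : Q → ℝ} (h : WD v F G) (hF : Bm F) (hG : L2l G) {Ψ : ℝ → ℝ} (hΨ : ContDiff ℝ 1 Ψ) :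
    WD v (fun p => Ψ (F p)) (fun p => deriv Ψ (F p) * G p) := by
  intro ζ h1 h2
  obtain ⟨hFm, C, hC⟩ := hF
  have hFl : L2l F := Bm.l2l ⟨hFm, C, hC⟩
  have dc : Continuous (deriv Ψ) := hΨ.continuous_deriv le_rfl
  obtain ⟨D0, hD0⟩ := (isCompact_Icc (a := -C) (b := C)).exists_bound_of_continuousOn hΨ.continuous.continuousOn
  obtain ⟨D1, hD1⟩ := (isCompact_Icc (a := -C) (b := C)).exists_bound_of_continuousOn dc.continuousOn
  obtain ⟨Z, hZ⟩ := h2.exists_bound_of_continuous h1.continuous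
  have mem := fun j p => abs_le.1 (ml_bd hFm hC j p)
  obtain ⟨K, hK, hKs, hKm⟩ := ml_loc (f := G) h2.isCompact
  set G' := K.indicator G with hG'
  have lG' : L2l G' := hG.ind hK.measurableSet
  have cG' : HasCompactSupport G' := cs_ind hK
  have cF := fun j => ml_cd hFl j
  set w : ℕ → Q → ℝ := fun j p => deriv Ψ (ml j F p) * ζ p with hw
  have wc : ∀ j, Continuous (w j) := fun j => (dc.comp (cF j).continuous).mul h1.continuous
  have wcs : ∀ j, HasCompactSupport (w j) := fun j => h2.mul_left
  have wb : ∀ j p, |w j p| ≤ D1 * Z := fun j p => by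
    rw [hw, abs_mul]; exact mul_le_mul (hD1 _ (mem j p)) (hZ p) (abs_nonneg _) ((norm_nonneg _).trans (hD1 _ (mem j p)))
  have e1 : ∀ j, ∫ p, Ψ (ml j F p) * fderiv ℝ ζ p v = - ∫ p, w j p * ml j G' p := fun j => by
    have cm : ContDiff ℝ 1 (fun p => Ψ (ml j F p)) := hΨ.comp (cF j)
    have fd : ∀ p, fderiv ℝ (fun p => Ψ (ml j F p)) p v = deriv Ψ (ml j F p) * ml j G p := fun p => by
      have e := ((hΨ.differentiable one_ne_zero) (ml j F p)).hasDerivAt.comp_hasFDerivAt p (((cF j).differentiable one_ne_zero) p).hasFDerivAt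
      have e' : fderiv ℝ (fun p => Ψ (ml j F p)) p = _ := e.fderiv
      rw [e', ← ml_fd hFl h j p]; simp
    have s1 : HasCompactSupport (fun p => fderiv ℝ (fun p => Ψ (ml j F p)) p v * ζ p) := h2.mul_left
    have s2 : HasCompactSupport (fun p => Ψ (ml j F p) * fderiv ℝ ζ p v) := (fd_cs h2 v).mul_left
    have s3 : HasCompactSupport (fun p => Ψ (ml j F p) * ζ p) := h2.mul_left
    rw [integral_mul_fderiv_eq_neg_fderiv_mul_of_integrable (int1 (Bm.cc ((fd_c cm v).mul h1.continuous) s1).l2l s1) (int1 (Bm.cc (cm.continuous.mul (fd_c h1 v)) s2).l2l s2)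
      (int1 (Bm.cc (cm.continuous.mul h1.continuous) s3).l2l s3) (fun p _ => cm.differentiable one_ne_zero p) (fun p _ => h1.differentiable one_ne_zero p)]
    congr 2; ext p
    rw [fd]
    by_cases hp : p ∈ tsupport ζ
    · rw [hKm j p hp, hw]; ring
    · simp [hw, image_eq_zero_of_notMem_tsupport hp]
  have aeF := ml_ae hFl
  have bZ := fd_bm h1 h2 v
  have t1 : Tendsto (fun j => ∫ p, Ψ (ml j F p) * fderiv ℝ ζ p v) atTop (𝓝 (∫ p, Ψ (F p) * fderiv ℝ ζ p v)) := by
    refine tendsto_integral_of_dominated_convergence (fun p => D0 * |fderiv ℝ ζ p v|) (fun j => ((hΨ.continuous.comp (cF j).continuous).mul (fd_c h1 v)).aestronglyMeasurable) ((int1 bZ.l2l (fd_cs h2 v)).abs.const_mul _) (fun j => Eventually.of_forall fun p => ?_) ?_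
    · rw [norm_mul]; exact mul_le_mul_of_nonneg_right (hD0 _ (mem j p)) (norm_nonneg _)
    · filter_upwards [aeF] with p hp
      exact ((hΨ.continuous.tendsto _).comp hp).mul_const _
  have iG := int1 lG' cG'
  have t2 : Tendsto (fun j => ∫ p, w j p * G' p) atTop (𝓝 (∫ p, deriv Ψ (F p) * ζ p * G' p)) := by
    refine tendsto_integral_of_dominated_convergence (fun p => D1 * Z * |G' p|) (fun j => ((wc j).measurable.mul lG'.1).aestronglyMeasurable) (iG.abs.const_mul _) (fun j => Eventually.of_forall fun p => ?_) ?_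
    · rw [norm_mul]; exact mul_le_mul_of_nonneg_right (wb j p) (norm_nonneg _)
    · filter_upwards [aeF] with p hp
      exact (((dc.tendsto _).comp hp).mul_const _).mul_const _
  have t3 : Tendsto (fun j => (∫ p, w j p * ml j G' p) - ∫ p, w j p * G' p) atTop (𝓝 0) := by
    rw [Metric.tendsto_atTop]
    intro η hη
    have hB : 0 ≤ D1 * Z := (abs_nonneg _).trans (wb 0 0)
    obtain ⟨r, hr, hr2⟩ := Metric.tendsto_nhds_nhds.1 (trans_L1 iG) (η / (D1 * Z + 1)) (by positivity)
    obtain ⟨n, hn⟩ := exists_nat_one_div_lt hr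
    refine ⟨n, fun j hj => ?_⟩
    rw [Real.dist_eq, sub_zero]
    have wl := fun j => (Bm.cc (wc j) (wcs j)).l2l
    refine lt_of_le_of_lt (b := D1 * Z * (η / (D1 * Z + 1))) ?_ ?_
    · have := ml_pair ((wl j).mem (wcs j)) (lG'.mem cG') (wl j).1 lG'.1 j 0 (T0 := ∫ p, w j p * G' p) (η := D1 * Z * (η / (D1 * Z + 1))) fun z hz => ?_
      · simpa using this
      have hz2 : dist (-z) 0 < r := by
        rw [dist_zero_right, norm_neg]; refine hz.trans_lt (lt_of_le_of_lt ?_ hn)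
        exact one_div_le_one_div_of_le (by positivity) (by exact_mod_cast Nat.succ_le_succ hj)
      have h4 := hr2 hz2
      rw [Real.dist_eq, sub_zero, abs_of_nonneg (integral_nonneg fun _ => abs_nonneg _)] at h4
      have ish : Integrable (fun p => G' (p + -z)) := iG.comp_add_right (-z)
      have bw : ∀ f : Q → ℝ, Integrable f → Integrable (fun p => w j p * f p) := fun f hf =>
        hf.bdd_mul (c := D1 * Z) (wc j).aestronglyMeasurable (Eventually.of_forall fun p => wb j p)
      simp only [add_zero, sub_eq_add_neg]
      rw [← sub_eq_add_neg, ← integral_sub (bw _ ish) (bw _ iG), ← Real.norm_eq_abs]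
      calc _ ≤ ∫ p, D1 * Z * |G' (p + -z) - G' p| := norm_integral_le_of_norm_le ((ish.sub iG).abs.const_mul _) (Eventually.of_forall fun p => by
              rw [← mul_sub, norm_mul]; exact mul_le_mul_of_nonneg_right (wb j p) (norm_nonneg _))
        _ ≤ _ := by rw [integral_const_mul]; exact mul_le_mul_of_nonneg_left h4.le hB
    · rw [mul_div_assoc', div_lt_iff₀ (by positivity)]; nlinarith
  have t4 := (t3.add t2).neg
  simp only [sub_add_cancel, zero_add] at t4
  rw [tendsto_nhds_unique t1 (t4.congr fun j => (e1 j).symm)]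
  congr 2; ext p
  by_cases hp : p ∈ tsupport ζ
  · rw [hG', indicator_of_mem (hKs hp)]; ring
  · simp [image_eq_zero_of_notMem_tsupport hp]
/-- multiplication by limits of functions constant in the direction v -/
theorem WD.lim {v : Q} {F G c : Q → ℝ} (h : WD v F G) (hF : L2l F) (hG : L2l G) {cn : ℕ → Q → ℝ} (h1 : ∀ n, ContDiff ℝ 1 (cn n))
    (h2 : ∀ n p, |cn n p| ≤ 1) (h3 : ∀ n p, fderiv ℝ (cn n) p v = 0) (h4 : ∀ p, Tendsto (fun n => cn n p) atTop (𝓝 (c p))) :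
    WD v (fun p => c p * F p) (fun p => c p * G p) := by
  intro ζ k1 k2
  have key : ∀ f g : Q → ℝ, L2l f → Bm g → HasCompactSupport g → Tendsto (fun n => ∫ p, cn n p * f p * g p) atTop (𝓝 (∫ p, c p * f p * g p)) := by
    intro f g hf hg hs
    refine tendsto_integral_of_dominated_convergence (fun p => |f p * g p|) (fun n => (((h1 n).continuous.measurable.mul hf.1).mul hg.1).aestronglyMeasurable) (int2 hf hg.l2l hs).abs (fun n => Eventually.of_forall fun p => ?_) (Eventually.of_forall fun p => ((h4 p).mul_const _).mul_const _)
    rw [mul_assoc, norm_mul]; exact mul_le_of_le_one_left (norm_nonneg _) (h2 n p)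
  have a1 := key F _ hF (fd_bm k1 k2 v) (fd_cs k2 v)
  have a2 := (key G ζ hG (Bm.cc k1.continuous k2) k2).neg
  refine tendsto_nhds_unique a1 (a2.congr fun n => ?_)
  have := h.mul hF hG (h1 n) ζ k1 k2
  simp only [h3, mul_zero, add_zero] at this
  simp only [mul_comm (cn n _)]
  exact this.symm
end gen3
end

section
section gen4
open scoped Pointwise
variable {Q : Type*} [NormedAddCommGroup Q] [NormedSpace ℝ Q] [FiniteDimensional ℝ Q]
  [MeasureSpace Q] [BorelSpace Q] [(volume : Measure Q).IsAddHaarMeasure]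
theorem pair_fd {D ζ : Q → ℝ} (hD : L2l D) (h1 : ContDiff ℝ 1 ζ) (h2 : HasCompactSupport ζ) (e : Q) (h : ℝ) :
    HasDerivAt (fun h : ℝ => ∫ p, D p * ζ (p + h • e)) (∫ p, D p * fderiv ℝ ζ (p + h • e) e) h := by
  have hD' : L2l (fun p => D (-p)) := ⟨hD.1.comp measurable_neg, fun K hK => by
    have := (integrableOn_iff_integrable_of_support_subset (s := -K) (f := (-K).indicator fun p => D p ^ 2) (μ := volume) support_indicator_subset).1 ?_
    · rw [← integrable_indicator_iff hK.measurableSet]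
      refine (this.comp_neg).congr (Eventually.of_forall fun p => ?_)
      by_cases hp : p ∈ K <;> simp [hp]
    · rw [integrableOn_indicator_iff hK.neg.measurableSet, inter_self]; exact hD.2 _ hK.neg⟩
  have e1 : ∀ ζ : Q → ℝ, ∀ y, ∫ p, D p * ζ (p + y) = convolution (fun p => D (-p)) ζ (ContinuousLinearMap.lsmul ℝ ℝ) volume y := fun ζ y => by
    rw [convolution_def, ← integral_neg_eq_self]
    congr 1; ext p; simp [add_comm, sub_eq_add_neg]
  have a := HasCompactSupport.hasFDerivAt_convolution_right (ContinuousLinearMap.lsmul ℝ ℝ) h2 hD'.loc h1 (h • e)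
  have b := a.comp_hasDerivAt h ((hasDerivAt_id h).smul_const e)
  simp only [one_smul] at b
  rw [convolution_precompR_apply _ hD'.loc (h2.fderiv (𝕜 := ℝ)) (h1.continuous_fderiv one_ne_zero), ← e1 (fun p => fderiv ℝ ζ p e)] at b
  refine b.congr_of_eventuallyEq (Eventually.of_forall fun r => ?_)
  simp [e1]
theorem near_pair {w G : Q → ℝ} (hw : L2l w) (hwc : HasCompactSupport w) (hG : L2l G) (hGc : HasCompactSupport G) (y : Q) {ε : ℝ} (hε : 0 < ε) :
    ∃ r > 0, ∀ (j : ℕ) (y' : Q), ‖y' - y‖ + 1 / ((j:ℝ)+1) < r → |(∫ p, w p * ml j G (p + y')) - ∫ p, w p * G (p + y)| ≤ ε := by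
  have hc := trans_L2_pair (hG.mem hGc) (hw.mem hwc)
  obtain ⟨r, hr, h⟩ := Metric.continuous_iff.1 hc y ε hε
  refine ⟨r, hr, fun j y' hy => ml_pair (hw.mem hwc) (hG.mem hGc) hw.1 hG.1 j y' fun z hz => ?_⟩
  have := h (y' - z) (by
    rw [dist_eq_norm]
    calc ‖y' - z - y‖ = ‖(y' - y) - z‖ := by congr 1; abel
      _ ≤ ‖y' - y‖ + ‖z‖ := norm_sub_le _ _
      _ < r := by linarith)
  rw [Real.dist_eq] at this
  simp only [mul_comm (w _), add_sub_assoc] at this ⊢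
  exact this.le
theorem time_lem {N : ℕ} {D f : Q → ℝ} {g : Fin N → Q → ℝ} {v : Fin N → Q} {e : Q} (hD : L2l D) (hf : L2l f) (hg : ∀ i, L2l (g i))
    (weak : ∀ ζ : Q → ℝ, ContDiff ℝ 1 ζ → HasCompactSupport ζ → ∫ p, D p * fderiv ℝ ζ p e = (∑ i, ∫ p, g i p * fderiv ℝ ζ p (v i)) + ∫ p, f p * ζ p)
    {η : Q → ℝ} {γ : Fin N → Q → ℝ} (hη : L2l η) (cη : HasCompactSupport η) (hγ : ∀ i, L2l (γ i)) (cγ : ∀ i, HasCompactSupport (γ i))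
    (wd : ∀ i, WD (v i) η (γ i)) :
    Tendsto (fun h : ℝ => ((∫ p, D p * η (p + h • e)) - ∫ p, D p * η p) / h) (𝓝[>] 0) (𝓝 ((∑ i, ∫ p, g i p * γ i p) + ∫ p, f p * η p)) := by
  set K0 : Set Q := tsupport η ∪ ⋃ i, tsupport (γ i) with hK0
  have kK0 : IsCompact K0 := IsCompact.union cη (isCompact_iUnion fun i => cγ i)
  have o1 : ∀ p ∉ K0, η p = 0 := fun p hp => image_eq_zero_of_notMem_tsupport fun h => hp (Or.inl h)
  have o2 : ∀ i, ∀ p ∉ K0, γ i p = 0 := fun i p hp => image_eq_zero_of_notMem_tsupport fun h => hp (Or.inr (mem_iUnion.2 ⟨i, h⟩))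
  set K : Set Q := (K0 + Metric.closedBall (0:Q) 1) + Metric.closedBall (0:Q) ‖e‖ with hK
  have kK : IsCompact K := (kK0.add (isCompact_closedBall _ _)).add (isCompact_closedBall _ _)
  have mK := kK.measurableSet
  have sub : ∀ (h : ℝ), 0 ≤ h → h ≤ 1 → ∀ p ∉ K, p + h • e ∉ K0 + Metric.closedBall (0:Q) 1 := fun h h0 h1 p hp hq => hp
    ⟨p + h • e, hq, -(h • e), by rw [mem_closedBall_zero_iff, norm_neg, norm_smul, Real.norm_eq_abs, abs_of_nonneg h0]; exact mul_le_of_le_one_left (norm_nonneg _) h1, by simp⟩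
  have sub0 : ∀ (h : ℝ), 0 ≤ h → h ≤ 1 → ∀ p ∉ K, p + h • e ∉ K0 := fun h h0 h1 p hp hq => sub h h0 h1 p hp ⟨_, hq, 0, by simp, by simp⟩
  have ind : ∀ (w u : Q → ℝ), (∀ p ∉ K, u p = 0) → ∫ p, w p * u p = ∫ p, K.indicator w p * u p := fun w u hu => by
    congr 1; ext p; by_cases hp : p ∈ K
    · rw [indicator_of_mem hp]
    · rw [hu p hp, mul_zero, mul_zero]
  have lD := hD.ind mK
  have lf := hf.ind mK
  have lg := fun i => (hg i).ind mK
  set S0 := (∑ i, ∫ p, g i p * γ i p) + ∫ p, f p * η p with hS0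
  have key : ∀ ε > 0, ∃ r > 0, ∀ h : ℝ, 0 < h → h < r → |(∫ p, D p * η (p + h • e)) - (∫ p, D p * η p) - h * S0| ≤ ε * h := by
    intro ε hε
    have hε' : 0 < ε / (N + 1) := by positivity
    choose r hr hr1 using fun i => near_pair (lg i) (cs_ind kK) (hγ i) (cγ i) 0 hε'
    obtain ⟨r0, hr0, hr01⟩ := near_pair lf (cs_ind kK) hη cη 0 hε'
    obtain ⟨ρ, hρ, hρr⟩ : ∃ ρ > 0, (∀ i, ρ ≤ r i) ∧ ρ ≤ r0 := by
      rcases isEmpty_or_nonempty (Fin N) with h | h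
      · exact ⟨r0, hr0, fun i => h.elim i, le_rfl⟩
      · refine ⟨min (Finset.univ.inf' Finset.univ_nonempty r) r0, lt_min ((Finset.lt_inf'_iff _).2 fun i _ => hr i) hr0, fun i => (min_le_left _ _).trans (Finset.inf'_le _ (Finset.mem_univ i)), min_le_right _ _⟩
    refine ⟨min 1 (ρ / (2 * (‖e‖ + 1))), by positivity, fun h h0 hh => ?_⟩
    have hh1 : h ≤ 1 := hh.le.trans (min_le_left _ _)
    have hhe : h * ‖e‖ < ρ / 2 := by
      have := (hh.trans_le (min_le_right _ _))
      rw [lt_div_iff₀ (by positivity)] at this; nlinarith [norm_nonneg e]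
    obtain ⟨n, hn⟩ := exists_nat_one_div_lt (half_pos hρ)
    have cj : ∀ j, ContDiff ℝ 1 (ml j η) := fun j => ml_cd hη j
    have sj : ∀ j, HasCompactSupport (ml j η) := fun j => HasCompactSupport.intro (kK0.add (isCompact_closedBall (0:Q) 1)) fun p hp => ml_cs kK0 o1 j hp
    have mb : ∀ j ≥ n, |(∫ p, D p * ml j η (p + h • e)) - (∫ p, D p * ml j η (p + (0:ℝ) • e)) - h * S0| ≤ ε * h := by
      intro j hj
      have jn : 1 / ((j:ℝ)+1) < ρ / 2 := lt_of_le_of_lt (one_div_le_one_div_of_le (by positivity) (by exact_mod_cast Nat.succ_le_succ hj)) hn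
      have hd : ∀ s : ℝ, HasDerivAt (fun s : ℝ => (∫ p, D p * ml j η (p + s • e)) - s * S0) ((∫ p, D p * fderiv ℝ (ml j η) (p + s • e) e) - 1 * S0) s := fun s => (pair_fd hD (cj j) (sj j) e s).sub ((hasDerivAt_id s).mul_const S0)
      have := norm_image_sub_le_of_norm_deriv_le_segment' (f := fun s : ℝ => (∫ p, D p * ml j η (p + s • e)) - s * S0) (a := 0) (b := h) (C := ε) (fun s _ => (hd s).hasDerivWithinAt) ?_ h ⟨h0.le, le_rfl⟩
      · simp only [Real.norm_eq_abs, sub_zero, zero_mul] at this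
        convert this using 2; ring
      intro s hs
      have w := weak (fun p => ml j η (p + s • e)) ((cj j).comp (contDiff_id.add contDiff_const)) ((sj j).comp_homeomorph (Homeomorph.addRight (s • e)))
      have fdt : ∀ p u, fderiv ℝ (fun p => ml j η (p + s • e)) p u = fderiv ℝ (ml j η) (p + s • e) u := fun p u => by rw [fderiv_comp_add_right]
      simp only [fdt, ml_fd hη (wd _) j] at w
      have hy : ‖s • e - 0‖ + 1 / ((j:ℝ)+1) < ρ := by
        rw [sub_zero, norm_smul, Real.norm_eq_abs, abs_of_nonneg hs.1]
        nlinarith [mul_le_mul_of_nonneg_right hs.2.le (norm_nonneg e)]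
      rw [w, one_mul, hS0, Real.norm_eq_abs]
      have b1 : ∀ i, |(∫ p, g i p * ml j (γ i) (p + s • e)) - ∫ p, g i p * γ i p| ≤ ε / (N + 1) := fun i => by
        have := hr1 i j (s • e) (hy.trans_le (hρr.1 i))
        rw [ind _ _ (fun p hp => ml_cs kK0 (o2 i) j (sub s hs.1 (hs.2.le.trans hh1) p hp)), ind _ (γ i) (fun p hp => o2 i p (by simpa using sub0 0 le_rfl zero_le_one p hp))]
        simpa using this
      have b2 : |(∫ p, f p * ml j η (p + s • e)) - ∫ p, f p * η p| ≤ ε / (N + 1) := by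
        have := hr01 j (s • e) (hy.trans_le hρr.2)
        rw [ind _ _ (fun p hp => ml_cs kK0 o1 j (sub s hs.1 (hs.2.le.trans hh1) p hp)), ind _ η (fun p hp => o1 p (by simpa using sub0 0 le_rfl zero_le_one p hp))]
        simpa using this
      have b3 : |∑ i, ((∫ p, g i p * ml j (γ i) (p + s • e)) - ∫ p, g i p * γ i p)| ≤ ∑ i : Fin N, ε / (N + 1) := (Finset.abs_sum_le_sum_abs _ _).trans (Finset.sum_le_sum fun i _ => b1 i)
      rw [Finset.sum_sub_distrib] at b3
      simp only [Finset.sum_const, Finset.card_univ, Fintype.card_fin, nsmul_eq_mul] at b3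
      have b4 : N * (ε / (N + 1)) + ε / (N + 1) = ε := by field_simp
      rw [abs_le] at b2 b3 ⊢
      constructor <;> linarith [b2.1, b2.2, b3.1, b3.2]
    have lim : ∀ s : ℝ, 0 ≤ s → s ≤ 1 → Tendsto (fun j => ∫ p, D p * ml j η (p + s • e)) atTop (𝓝 (∫ p, D p * η (p + s • e))) := by
      intro s s0 s1
      rw [Metric.tendsto_atTop]
      intro κ hκ
      obtain ⟨r', hr', hr''⟩ := near_pair lD (cs_ind kK) hη cη (s • e) (half_pos hκ)
      obtain ⟨n', hn'⟩ := exists_nat_one_div_lt hr'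
      refine ⟨n', fun j hj => ?_⟩
      have := hr'' j (s • e) (by rw [sub_self, norm_zero, zero_add]; exact lt_of_le_of_lt (one_div_le_one_div_of_le (by positivity) (by exact_mod_cast Nat.succ_le_succ hj)) hn')
      rw [Real.dist_eq, ind _ _ (fun p hp => ml_cs kK0 o1 j (sub s s0 s1 p hp)), ind D (fun p => η (p + s • e)) (fun p hp => o1 _ (sub0 s s0 s1 p hp))]
      linarith
    have t0 := lim 0 le_rfl zero_le_one
    simp only [zero_smul, add_zero] at t0 mb
    refine le_of_tendsto (((lim h h0.le hh1).sub t0).sub_const (h * S0)).abs ?_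
    filter_upwards [eventually_ge_atTop n] with j hj using mb j hj
  rw [Metric.tendsto_nhdsWithin_nhds]
  intro ε hε
  obtain ⟨r, hr, h⟩ := key (ε / 2) (by positivity)
  refine ⟨r, hr, fun {x} hx hxr => ?_⟩
  have hx0 : 0 < x := hx
  rw [dist_zero_right, Real.norm_eq_abs, abs_of_pos hx0] at hxr
  have := h x hx0 hxr
  rw [Real.dist_eq, div_sub' hx0.ne', abs_div, abs_of_pos hx0, div_lt_iff₀ hx0]
  nlinarith
end gen4
end

section
section scal
def Jd (δ r : ℝ) : ℝ := √(r ^ 2 + δ ^ 2)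
def Hd (δ r : ℝ) : ℝ := r / √(r ^ 2 + δ ^ 2)
def Bd (δ m a b : ℝ) : ℝ := ∫ r in b..a, Hd δ (r ^ m - b ^ m)
variable {δ m : ℝ}
theorem sq_pos' (hδ : 0 < δ) (r : ℝ) : 0 < r ^ 2 + δ ^ 2 := by positivity
theorem Jd_cd (hδ : 0 < δ) : ContDiff ℝ 1 (Jd δ) := by
  unfold Jd
  exact ContDiff.sqrt (by fun_prop) fun r => (sq_pos' hδ r).ne'
theorem Hd_cd (hδ : 0 < δ) : ContDiff ℝ 1 (Hd δ) := by
  unfold Hd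
  exact contDiff_id.div (ContDiff.sqrt (by fun_prop) fun r => (sq_pos' hδ r).ne') fun r => (Real.sqrt_pos.2 (sq_pos' hδ r)).ne'
theorem Jd_deriv (hδ : 0 < δ) (r : ℝ) : deriv (Jd δ) r = Hd δ r := by
  have h1 : HasDerivAt (fun r : ℝ => r ^ 2 + δ ^ 2) (2 * r) r := by
    simpa using (hasDerivAt_pow 2 r).add_const (δ ^ 2)
  have := (h1.sqrt (sq_pos' hδ r).ne').deriv
  unfold Jd Hd
  rw [this]; field_simp
theorem Hd_neg (r : ℝ) : Hd δ (-r) = - Hd δ r := by unfold Hd; rw [neg_sq, neg_div]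
theorem Hd_abs (hδ : 0 < δ) (r : ℝ) : |Hd δ r| ≤ 1 := by
  unfold Hd
  have h := Real.sqrt_pos.2 (sq_pos' hδ r)
  rw [abs_div, abs_of_pos h, div_le_one h]
  exact Real.abs_le_sqrt (by nlinarith)
theorem Hd_mono (hδ : 0 < δ) : Monotone (Hd δ) := by
  have cv : ConvexOn ℝ univ (Jd δ) := by
    refine ⟨convex_univ, fun x _ y _ a b ha hb hab => ?_⟩
    unfold Jd
    rw [Real.sqrt_le_left (by positivity)]
    have hx := Real.sq_sqrt (sq_pos' hδ x).le
    have hy := Real.sq_sqrt (sq_pos' hδ y).le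
    have hxy : x * y + δ ^ 2 ≤ √(x ^ 2 + δ ^ 2) * √(y ^ 2 + δ ^ 2) := by
      rw [← Real.sqrt_mul (sq_pos' hδ x).le]
      apply Real.le_sqrt_of_sq_le
      nlinarith [sq_nonneg (δ * (x - y))]
    simp only [smul_eq_mul]
    have hb' : b = 1 - a := by linarith
    have : (a * √(x ^ 2 + δ ^ 2) + b * √(y ^ 2 + δ ^ 2)) ^ 2 = a ^ 2 * (x ^ 2 + δ ^ 2) + b ^ 2 * (y ^ 2 + δ ^ 2) + 2 * (a * b) * (√(x ^ 2 + δ ^ 2) * √(y ^ 2 + δ ^ 2)) := by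
      rw [← hx, ← hy]; simp only [Real.sqrt_sq (Real.sqrt_nonneg _)]; ring
    rw [this]
    have h2 := mul_le_mul_of_nonneg_left hxy (mul_nonneg ha hb)
    have e : δ ^ 2 = (a + b) ^ 2 * δ ^ 2 := by rw [hab]; ring
    nlinarith
  have := cv.monotoneOn_deriv (fun x _ => (Jd_cd hδ).differentiable one_ne_zero x)
  intro x y hxy
  simpa [Jd_deriv hδ] using this (mem_univ x) (mem_univ y) hxy
theorem Hd_dnn (hδ : 0 < δ) (r : ℝ) : 0 ≤ deriv (Hd δ) r := (Hd_mono hδ).deriv_nonneg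
theorem Hd_deven (r : ℝ) : deriv (Hd δ) (-r) = deriv (Hd δ) r := by
  have : Hd δ = fun x => - Hd δ (-x) := by ext x; rw [Hd_neg, neg_neg]
  conv_rhs => rw [this]
  rw [deriv.fun_neg, deriv_comp_neg]; simp
theorem Hd_sgn {x y : ℝ} (h : 0 ≤ x * y) : 0 ≤ x * Hd δ y := by
  unfold Hd; rw [mul_div_assoc']; exact div_nonneg h (Real.sqrt_nonneg _)
theorem Bd_c (hδ : 0 < δ) (hm : 0 < m) : Continuous (Function.uncurry fun (b r : ℝ) => Hd δ (r ^ m - b ^ m)) :=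
  (Hd_cd hδ).continuous.comp (((Real.continuous_rpow_const hm.le).comp continuous_snd).sub ((Real.continuous_rpow_const hm.le).comp continuous_fst))
theorem Bd_ii (hδ : 0 < δ) (hm : 0 < m) (b c d : ℝ) : IntervalIntegrable (fun r => Hd δ (r ^ m - b ^ m)) volume c d :=
  ((Bd_c hδ hm).comp (continuous_const.prodMk continuous_id) : Continuous fun r => Hd δ (r ^ m - b ^ m)).intervalIntegrable _ _
theorem Bd_cont (hδ : 0 < δ) (hm : 0 < m) : Continuous (fun r : ℝ × ℝ => Bd δ m r.1 r.2) := by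
  have e : (fun r : ℝ × ℝ => Bd δ m r.1 r.2) = fun r => (∫ x in (0:ℝ)..r.1, Hd δ (x ^ m - r.2 ^ m)) - ∫ x in (0:ℝ)..r.2, Hd δ (x ^ m - r.2 ^ m) := by
    ext r
    rw [intervalIntegral.integral_interval_sub_left (Bd_ii hδ hm _ _ _) (Bd_ii hδ hm _ _ _)]; rfl
  rw [e]
  have c1 : Continuous (Function.uncurry fun (r : ℝ × ℝ) (x : ℝ) => Hd δ (x ^ m - r.2 ^ m)) :=
    (Bd_c hδ hm).comp ((continuous_snd.comp continuous_fst).prodMk continuous_snd)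
  exact (intervalIntegral.continuous_parametric_intervalIntegral_of_continuous c1 continuous_fst).sub (intervalIntegral.continuous_parametric_intervalIntegral_of_continuous c1 continuous_snd)
theorem Bd_abs (hδ : 0 < δ) (a b : ℝ) : |Bd δ m a b| ≤ |a - b| := by
  have := intervalIntegral.norm_integral_le_of_norm_le_const (a := b) (b := a) (f := fun r => Hd δ (r ^ m - b ^ m)) (C := 1) fun r _ => Hd_abs hδ _
  simpa [Bd] using this
theorem Bd_le (hδ : 0 < δ) (hm : 0 < m) {A A' b : ℝ} (hA : 0 ≤ A) (hA' : 0 ≤ A') : Bd δ m A b - Bd δ m A' b ≤ (A - A') * Hd δ (A ^ m - b ^ m) := by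
  unfold Bd
  rw [intervalIntegral.integral_interval_sub_left (Bd_ii hδ hm _ _ _) (Bd_ii hδ hm _ _ _)]
  have hc : ∀ c d : ℝ, (d - c) * Hd δ (A ^ m - b ^ m) = ∫ r in c..d, Hd δ (A ^ m - b ^ m) := fun c d => by simp
  rcases le_total A' A with h | h
  · rw [hc]
    refine intervalIntegral.integral_mono_on h (Bd_ii hδ hm _ _ _) (by simp) fun r hr => Hd_mono hδ ?_
    have := Real.rpow_le_rpow (hA'.trans hr.1) hr.2 hm.le; linarith
  · rw [intervalIntegral.integral_symm, ← neg_sub A' A, neg_mul, neg_le_neg_iff, hc]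
    refine intervalIntegral.integral_mono_on h (by simp) (Bd_ii hδ hm _ _ _) fun r hr => Hd_mono hδ ?_
    have := Real.rpow_le_rpow hA hr.1 hm.le; linarith
theorem Jd_lim {d : ℕ → ℝ} (hd : Tendsto d atTop (𝓝 0)) (r : ℝ) : Tendsto (fun n => Jd (d n) r) atTop (𝓝 |r|) := by
  have : Continuous fun δ => Jd δ r := by unfold Jd; fun_prop
  have e : Jd 0 r = |r| := by simp [Jd, Real.sqrt_sq_eq_abs]
  rw [← e]; exact (this.tendsto 0).comp hd
theorem Hd_lim {d : ℕ → ℝ} (hd : Tendsto d atTop (𝓝 0)) {r : ℝ} (hr : r ≠ 0) : Tendsto (fun n => Hd (d n) r) atTop (𝓝 (r / |r|)) :=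
  tendsto_const_nhds.div (Jd_lim hd r) (abs_ne_zero.2 hr)
theorem Bd_lim (hm : 0 < m) {d : ℕ → ℝ} (hd : Tendsto d atTop (𝓝 0)) (d0 : ∀ n, 0 < d n) {a b : ℝ} (ha : 0 ≤ a) (hb : 0 ≤ b) : Tendsto (fun n => Bd (d n) m a b) atTop (𝓝 |a - b|) := by
  have e : |a - b| = ∫ r in b..a, if a < b then (-1:ℝ) else 1 := by
    rw [intervalIntegral.integral_const, smul_eq_mul]
    split_ifs with h
    · rw [abs_of_neg (by linarith)]; ring
    · rw [abs_of_nonneg (by linarith [not_lt.1 h])]; ring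
  rw [e]
  refine intervalIntegral.tendsto_integral_filter_of_dominated_convergence (fun _ => 1) (Eventually.of_forall fun n => (Bd_ii (d0 n) hm b 0 1 |> fun _ => ((Bd_c (d0 n) hm).comp (continuous_const.prodMk continuous_id) : Continuous fun r => Hd (d n) (r ^ m - b ^ m)).aestronglyMeasurable)) (Eventually.of_forall fun n => Eventually.of_forall fun r _ => Hd_abs (d0 n) _) (by simp) ?_
  have hne : ∀ᵐ r : ℝ, r ≠ b := by simp [ae_iff]
  filter_upwards [hne] with r hr hrm
  have s : r ^ m ≠ b ^ m → Tendsto (fun n => Hd (d n) (r ^ m - b ^ m)) atTop (𝓝 ((r ^ m - b ^ m) / |r ^ m - b ^ m|)) := fun h => Hd_lim hd (sub_ne_zero.2 h)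
  rcases lt_or_ge a b with h | h
  · rw [if_pos h]
    rw [uIoc_of_ge h.le] at hrm
    have l := Real.rpow_lt_rpow (ha.trans hrm.1.le) (lt_of_le_of_ne hrm.2 hr) hm
    have := s l.ne
    rwa [abs_of_neg (by linarith), div_neg, div_self (by linarith)] at this
  · rw [if_neg (not_lt.2 h)]
    rw [uIoc_of_le h] at hrm
    have l := Real.rpow_lt_rpow hb hrm.1 hm
    have := s l.ne'
    rwa [abs_of_pos (by linarith), div_self (by linarith)] at this
end scal
end

section
section lift
variable {Q : Type*} [NormedAddCommGroup Q] [NormedSpace ℝ Q] [FiniteDimensional ℝ Q]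
  [MeasureSpace Q] [BorelSpace Q] [(volume : Measure Q).IsAddHaarMeasure]
instance haar2 : (volume : Measure (ℝ × Q)).IsAddHaarMeasure := by rw [Measure.volume_eq_prod]; infer_instance
theorem L2l.lift {f : Q → ℝ} (hf : L2l f) : L2l (fun ω : ℝ × Q => f ω.2) := by
  refine ⟨hf.1.comp measurable_snd, fun K hK => ?_⟩
  have h1 := hK.image continuous_fst
  have h2 := hK.image continuous_snd
  refine IntegrableOn.mono_set (t := (Prod.fst '' K) ×ˢ (Prod.snd '' K)) ?_ fun ω hω => ⟨⟨ω, hω, rfl⟩, ⟨ω, hω, rfl⟩⟩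
  unfold IntegrableOn
  rw [Measure.volume_eq_prod, ← Measure.prod_restrict]
  haveI : IsFiniteMeasure (volume.restrict (Prod.fst '' K)) := ⟨by rw [Measure.restrict_apply_univ]; exact h1.measure_lt_top⟩
  simpa using (integrable_const (1:ℝ) (μ := volume.restrict (Prod.fst '' K))).mul_prod (hf.2 _ h2)
theorem sl_cd {ζ : ℝ × Q → ℝ} (h : ContDiff ℝ 1 ζ) (s : ℝ) : ContDiff ℝ 1 (fun p => ζ (s, p)) := h.comp (contDiff_const.prodMk contDiff_id)
theorem sl_cs {ζ : ℝ × Q → ℝ} (h : HasCompactSupport ζ) (s : ℝ) : HasCompactSupport (fun p => ζ (s, p)) :=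
  HasCompactSupport.intro (h.image continuous_snd) fun p hp => by
    by_contra h0; exact hp ⟨(s, p), subset_tsupport _ h0, rfl⟩
theorem sl_fd {ζ : ℝ × Q → ℝ} (h : ContDiff ℝ 1 ζ) (s : ℝ) (p v : Q) : fderiv ℝ (fun p => ζ (s, p)) p v = fderiv ℝ ζ (s, p) (0, v) := by
  have e := ((h.differentiable one_ne_zero).differentiableAt (x := (s, p))).hasFDerivAt.comp p ((hasFDerivAt_const s p).prodMk (hasFDerivAt_id p))
  have : fderiv ℝ (fun p => ζ (s, p)) p = _ := e.fderiv
  rw [this]; simp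
theorem lift_int {f : Q → ℝ} (hf : L2l f) {k : ℝ × Q → ℝ} (hk : Bm k) (hc : HasCompactSupport k) :
    Integrable (fun s => ∫ p, f p * k (s, p)) ∧ (∫ ω : ℝ × Q, f ω.2 * k ω) = ∫ s, ∫ p, f p * k (s, p) := by
  have h := int2 hf.lift hk.l2l hc
  rw [Measure.volume_eq_prod] at h ⊢
  exact ⟨h.integral_prod_left, integral_prod _ h⟩
theorem WD.lift {v : Q} {F G : Q → ℝ} (h : WD v F G) (hF : L2l F) (hG : L2l G) : WD ((0:ℝ), v) (fun ω => F ω.2) (fun ω => G ω.2) := by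
  intro ζ h1 h2
  rw [(lift_int hF (fd_bm h1 h2 _) (fd_cs h2 _)).2, (lift_int hG (Bm.cc h1.continuous h2) h2).2, ← integral_neg]
  congr 1; ext s
  rw [← h _ (sl_cd h1 s) (sl_cs h2 s)]; simp only [sl_fd h1]
theorem weak_lift {N : ℕ} {D f : Q → ℝ} {g : Fin N → Q → ℝ} {v : Fin N → Q} {e : Q} (hD : L2l D) (hf : L2l f) (hg : ∀ i, L2l (g i))
    (weak : ∀ ζ : Q → ℝ, ContDiff ℝ 1 ζ → HasCompactSupport ζ → ∫ p, D p * fderiv ℝ ζ p e = (∑ i, ∫ p, g i p * fderiv ℝ ζ p (v i)) + ∫ p, f p * ζ p)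
    (ζ : ℝ × Q → ℝ) (h1 : ContDiff ℝ 1 ζ) (h2 : HasCompactSupport ζ) :
    ∫ ω : ℝ × Q, D ω.2 * fderiv ℝ ζ ω (0, e) = (∑ i, ∫ ω : ℝ × Q, g i ω.2 * fderiv ℝ ζ ω (0, v i)) + ∫ ω : ℝ × Q, f ω.2 * ζ ω := by
  have k := fun i => lift_int (hg i) (fd_bm h1 h2 ((0:ℝ), v i)) (fd_cs h2 _)
  have k2 := lift_int hf (Bm.cc h1.continuous h2) h2
  rw [(lift_int hD (fd_bm h1 h2 _) (fd_cs h2 _)).2, k2.2]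
  simp only [fun i => (k i).2]
  rw [← integral_finsetSum _ fun i _ => (k i).1, ← integral_add (integrable_finsetSum _ fun i _ => (k i).1) k2.1]
  congr 1; ext s
  have := weak _ (sl_cd h1 s) (sl_cs h2 s)
  simpa only [sl_fd h1] using this
end lift
section swp
variable {N : ℕ}
def TT (ω : ℝ × ℝ × EE N) : ℝ × ℝ × EE N := (ω.2.1, ω.1, ω.2.2)
theorem TT_c : Continuous (TT (N := N)) := by unfold TT; fun_prop
theorem TT_TT (ω : ℝ × ℝ × EE N) : TT (TT ω) = ω := rfl
def TTe : (ℝ × ℝ × EE N) ≃ᵐ (ℝ × ℝ × EE N) := ⟨⟨TT, TT, TT_TT, TT_TT⟩, TT_c.measurable, TT_c.measurable⟩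
theorem TT_mp : MeasurePreserving (TT (N := N)) := by
  have h1 : MeasurePreserving (MeasurableEquiv.prodAssoc (α := ℝ) (β := ℝ) (γ := EE N)) := volume_preserving_prodAssoc
  have h2 : MeasurePreserving (Prod.swap : ℝ × ℝ → ℝ × ℝ) := Measure.measurePreserving_swap
  exact (h1.comp (h2.prod (MeasurePreserving.id (volume : Measure (EE N))))).comp h1.symm
theorem TT_int (f : ℝ × ℝ × EE N → ℝ) : ∫ ω, f (TT ω) = ∫ ω, f ω := TT_mp.integral_comp (TTe (N := N)).measurableEmbedding f
theorem TT_cd : ContDiff ℝ 1 (TT (N := N)) := by unfold TT; fun_prop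
theorem TT_fd {ζ : ℝ × ℝ × EE N → ℝ} (h : ContDiff ℝ 1 ζ) (ω v : ℝ × ℝ × EE N) : fderiv ℝ (fun ω => ζ (TT ω)) ω v = fderiv ℝ ζ (TT ω) (TT v) := by
  let T : (ℝ × ℝ × EE N) →L[ℝ] (ℝ × ℝ × EE N) := ⟨⟨⟨TT, fun _ _ => rfl⟩, fun _ _ => rfl⟩, TT_c⟩
  have e := ((h.differentiable one_ne_zero).differentiableAt (x := T ω)).hasFDerivAt.comp ω T.hasFDerivAt
  have : fderiv ℝ (fun ω => ζ (TT ω)) ω = _ := e.fderiv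
  rw [this]; rfl
theorem TT_cs {ζ : ℝ × ℝ × EE N → ℝ} (h : HasCompactSupport ζ) : HasCompactSupport (fun ω => ζ (TT ω)) :=
  HasCompactSupport.intro (h.image TT_c) fun p hp => by
    by_contra h0; exact hp ⟨TT p, subset_tsupport _ h0, rfl⟩
theorem L2l.tt {f : ℝ × ℝ × EE N → ℝ} (hf : L2l f) : L2l (fun ω => f (TT ω)) := by
  refine ⟨hf.1.comp TT_c.measurable, fun K hK => ?_⟩
  have e : K = TT ⁻¹' (TT '' K) := by
    ext ω; exact ⟨fun h => ⟨ω, h, rfl⟩, fun ⟨w, h, h'⟩ => by rw [← TT_TT ω, ← h']; exact h⟩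
  rw [e]
  exact (TT_mp.integrableOn_comp_preimage (TTe (N := N)).measurableEmbedding).2 (hf.2 _ (hK.image TT_c))
theorem WD.tt {i : Fin N} {F G : ℝ × ℝ × EE N → ℝ} (h : WD (0, 0, ee i) F G) : WD (0, 0, ee i) (fun ω => F (TT ω)) (fun ω => G (TT ω)) := by
  intro ζ h1 h2
  have := h _ (h1.comp TT_cd) (TT_cs h2)
  rw [← TT_int, ← TT_int (fun ω => G ω * _)] at this
  simp only [Function.comp_def, TT_fd h1, TT_TT] at this
  exact this
end swp
end

section
namespace Par
structure Dt (N : ℕ) (m q C : ℝ) (V u : EE N → ℝ) (a : ℝ × EE N → ℝ) (g : ℝ × EE N → EE N) : Prop where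
  ws : WS N m q V u a g
  hm : 1 < m
  hq : 0 < q
  hV : Continuous V
  hV0 : ∀ x, 0 ≤ V x
  um : Measurable u
  u0 : ∀ x, 0 ≤ u x
  uC : ∀ x, u x ≤ C
  aC : ∀ p, a p ≤ C
def Aa {N : ℕ} (m : ℝ) (a : ℝ × EE N → ℝ) : ℝ × EE N → ℝ := (HH N).indicator fun p => a p ^ m
variable {N : ℕ} {m q C : ℝ} {V u : EE N → ℝ} {a : ℝ × EE N → ℝ} {g : ℝ × EE N → EE N}
theorem Dt.am (h : Dt N m q C V u a g) : Bm a := ⟨h.ws.bm, C, fun p => by rw [abs_of_nonneg (h.ws.b0 p)]; exact h.aC p⟩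
theorem Dt.ub (h : Dt N m q C V u a g) : Bm (fun p : ℝ × EE N => u p.2) := ⟨h.um.comp measurable_snd, C, fun p => by rw [abs_of_nonneg (h.u0 _)]; exact h.uC _⟩
theorem Dt.Ab (h : Dt N m q C V u a g) : Bm (Aa m a) :=
  (h.am.comp (Ψ := fun r => r ^ m) (Real.continuous_rpow_const (by linarith [h.hm]))).ind HH_meas
theorem Dt.gl (h : Dt N m q C V u a g) (i : Fin N) : L2l (fun p => g p i) := by
  have k : Measurable (fun p => g p i) := (by fun_prop : Measurable fun x : EE N => x i).comp h.ws.gm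
  refine ⟨k, fun K hK => (h.ws.g2 K hK).mono' (k.pow_const 2).aestronglyMeasurable (Eventually.of_forall fun p => ?_)⟩
  rw [norm_pow]; exact pow_le_pow_left₀ (norm_nonneg _) (PiLp.norm_apply_le _ i) 2
theorem c_l2l {Q : Type*} [NormedAddCommGroup Q] [NormedSpace ℝ Q] [FiniteDimensional ℝ Q] [MeasureSpace Q] [BorelSpace Q] [(volume : Measure Q).IsAddHaarMeasure]
    {f : Q → ℝ} (hf : Continuous f) : L2l f := ⟨hf.measurable, fun K hK => (hf.pow 2).continuousOn.integrableOn_compact hK⟩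
theorem Dt.fl (h : Dt N m q C V u a g) : L2l ((HH N).indicator fun p => V p.2 * a p ^ q) :=
  ((c_l2l (h.hV.comp continuous_snd)).mul_bm (h.am.comp (Ψ := fun r => r ^ q) (Real.continuous_rpow_const h.hq.le))).ind HH_meas
theorem Dt.wd (h : Dt N m q C V u a g) (i : Fin N) : WD ((0:ℝ), ee i) (Aa m a) (fun p => g p i) := by
  intro ζ h1 h2
  have := h.ws.grad ζ h1 h2 i
  rw [← integral_indicator HH_meas, ← integral_indicator HH_meas] at this
  refine Eq.trans ?_ (this.trans ?_)
  · congr 1; ext p; unfold Aa; by_cases hp : p ∈ HH N <;> simp [hp]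
  · congr 2; ext p; by_cases hp : p ∈ HH N <;> simp [hp, h.ws.goff p]
theorem Dt.weak (h : Dt N m q C V u a g) (ζ : ℝ × EE N → ℝ) (h1 : ContDiff ℝ 1 ζ) (h2 : HasCompactSupport ζ) :
    ∫ p, (a p - u p.2) * fderiv ℝ ζ p (1, 0) = (∑ i, ∫ p, g p i * fderiv ℝ ζ p (0, ee i)) + ∫ p, (HH N).indicator (fun p => V p.2 * a p ^ q) p * ζ p := by
  have i1 := int2 (h.am.sub h.ub).l2l (fd_bm h1 h2 (1, 0)).l2l (fd_cs h2 _)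
  have i2 := fun i => int2 (h.gl i) (fd_bm h1 h2 (0, ee i)).l2l (fd_cs h2 _)
  have i3 := int2 h.fl (Bm.cc h1.continuous h2).l2l h2
  rw [← integral_finsetSum _ fun i _ => i2 i, ← integral_add (integrable_finsetSum _ fun i _ => i2 i) i3, ← sub_eq_zero, ← integral_sub i1 ((integrable_finsetSum _ fun i _ => i2 i).fun_add i3), ← neg_eq_zero, ← integral_neg]
  have e := h.ws.eq ζ h1 h2
  rw [← integral_indicator HH_meas] at e
  refine Eq.trans ?_ e
  congr 1; ext p
  by_cases hp : p ∈ HH N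
  · simp only [indicator_of_mem hp]
    have : fderiv ℝ ζ p (0, g p) = ∑ i, g p i * fderiv ℝ ζ p (0, ee i) := by
      rw [fd_inner]; simp [Gz, PiLp.inner_apply, mul_comm]
    rw [this]; ring
  · simp [indicator_of_notMem hp, h.ws.goff p hp, h.ws.off p hp]
/-- the doubled functions -/
def FF (m : ℝ) (a b : ℝ × EE N → ℝ) (ω : ℝ × ℝ × EE N) : ℝ := Aa m a ω.2 - Aa m b (TT ω).2
def cc (ω : ℝ × ℝ × EE N) : ℝ := if 0 < ω.1 ∧ 0 < ω.2.1 then 1 else 0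
def cn (n : ℕ) (ω : ℝ × ℝ × EE N) : ℝ := Real.smoothTransition (n * ω.1) * Real.smoothTransition (n * ω.2.1)
theorem st_lim (r : ℝ) : Tendsto (fun n : ℕ => Real.smoothTransition (n * r)) atTop (𝓝 (if 0 < r then 1 else 0)) := by
  split_ifs with h
  · refine tendsto_const_nhds.congr' ?_
    obtain ⟨n0, hn⟩ := exists_nat_ge (1 / r)
    filter_upwards [eventually_ge_atTop n0] with n hn2
    have : (1:ℝ) ≤ n * r := by rw [div_le_iff₀ h] at hn; exact hn.trans (mul_le_mul_of_nonneg_right (by exact_mod_cast hn2) h.le)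
    rw [Real.smoothTransition.one_of_one_le this]
  · refine tendsto_const_nhds.congr fun n => ?_
    rw [Real.smoothTransition.zero_of_nonpos (mul_nonpos_of_nonneg_of_nonpos n.cast_nonneg (not_lt.1 h))]
theorem st_cd (n : ℕ) : ContDiff ℝ 1 (fun r : ℝ => Real.smoothTransition (n * r)) := (Real.smoothTransition.contDiff (n := 1)).comp (by fun_prop)
theorem st_abs (r : ℝ) : |Real.smoothTransition r| ≤ 1 := abs_le.2 ⟨by linarith [Real.smoothTransition.nonneg r], Real.smoothTransition.le_one r⟩
theorem cn_cd (n : ℕ) : ContDiff ℝ 1 (cn (N := N) n) := ((st_cd n).comp (by fun_prop : ContDiff ℝ 1 fun ω : ℝ × ℝ × EE N => ω.1)).mul ((st_cd n).comp (by fun_prop : ContDiff ℝ 1 fun ω : ℝ × ℝ × EE N => ω.2.1))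
theorem cn_abs (n : ℕ) (ω : ℝ × ℝ × EE N) : |cn n ω| ≤ 1 := by
  unfold cn; rw [abs_mul]; exact mul_le_one₀ (st_abs _) (abs_nonneg _) (st_abs _)
theorem fd_dir {Q : Type*} [NormedAddCommGroup Q] [NormedSpace ℝ Q] {f : Q → ℝ} {p v : Q} {l : ℝ} (h : DifferentiableAt ℝ f p) (hl : HasDerivAt (fun r : ℝ => f (p + r • v)) l 0) : fderiv ℝ f p v = l := by
  have h' : HasFDerivAt f (fderiv ℝ f p) (p + (0:ℝ) • v) := by simpa using h.hasFDerivAt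
  have := h'.comp_hasDerivAt (0:ℝ) (((hasDerivAt_id (0:ℝ)).smul_const v).const_add p)
  have := this.unique hl
  simpa using this
theorem cn_fd (n : ℕ) (ω : ℝ × ℝ × EE N) (x : EE N) : fderiv ℝ (cn n) ω (0, 0, x) = 0 :=
  fd_dir ((cn_cd n).differentiable one_ne_zero).differentiableAt (by simpa [cn] using hasDerivAt_const _ _)
theorem cn_lim (ω : ℝ × ℝ × EE N) : Tendsto (fun n => cn n ω) atTop (𝓝 (cc ω)) := by
  have := (st_lim ω.1).mul (st_lim ω.2.1)
  unfold cc cn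
  convert this using 2
  by_cases h1 : 0 < ω.1 <;> by_cases h2 : 0 < ω.2.1 <;> simp [h1, h2]
theorem cc_bm : Bm (cc (N := N)) := ⟨Measurable.ite ((measurableSet_lt measurable_const measurable_fst).inter (measurableSet_lt measurable_const (measurable_fst.comp measurable_snd))) measurable_const measurable_const, 1, fun ω => by unfold cc; split_ifs <;> simp⟩
theorem cc_wd {i : Fin N} {F G : ℝ × ℝ × EE N → ℝ} (h : WD (0, 0, ee i) F G) (hF : L2l F) (hG : L2l G) : WD (0, 0, ee i) (fun p => cc p * F p) (fun p => cc p * G p) :=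
  h.lim hF hG cn_cd cn_abs (fun n p => cn_fd n p _) cn_lim
theorem cc_tt (ω : ℝ × ℝ × EE N) : cc (TT ω) = cc ω := by unfold cc TT; simp [and_comm]
theorem Bm.lift {f : ℝ × EE N → ℝ} (h : Bm f) : Bm (fun ω : ℝ × ℝ × EE N => f ω.2) := ⟨h.1.comp measurable_snd, h.2.imp fun C hC ω => hC _⟩
theorem Bm.tt {f : ℝ × ℝ × EE N → ℝ} (h : Bm f) : Bm (fun ω => f (TT ω)) := ⟨h.1.comp TT_c.measurable, h.2.imp fun C hC ω => hC _⟩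
variable {b : ℝ × EE N → ℝ} {k : ℝ × EE N → EE N}
def GG (g k : ℝ × EE N → EE N) (i : Fin N) (ω : ℝ × ℝ × EE N) : ℝ := g ω.2 i - k (TT ω).2 i
theorem FF_bm (ha : Dt N m q C V u a g) (hb : Dt N m q C V u b k) : Bm (FF m a b) := (Bm.lift ha.Ab).sub (Bm.tt (Bm.lift hb.Ab))
theorem GG_l (ha : Dt N m q C V u a g) (hb : Dt N m q C V u b k) (i : Fin N) : L2l (GG g k i) := (ha.gl i).lift.sub (hb.gl i).lift.tt
theorem WD.sub {Q : Type*} [NormedAddCommGroup Q] [NormedSpace ℝ Q] [FiniteDimensional ℝ Q] [MeasureSpace Q] [BorelSpace Q] [(volume : Measure Q).IsAddHaarMeasure]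
    {v : Q} {F G F' G' : Q → ℝ} (h : WD v F G) (h' : WD v F' G') (hF : L2l F) (hG : L2l G) (hF' : L2l F') (hG' : L2l G') : WD v (fun p => F p - F' p) (fun p => G p - G' p) := by
  intro ζ h1 h2
  have e := (Bm.cc h1.continuous h2).l2l
  have e' := (fd_bm h1 h2 v).l2l
  simp only [sub_mul]
  rw [integral_sub (int2 hF e' (fd_cs h2 v)) (int2 hF' e' (fd_cs h2 v)), integral_sub (int2 hG e h2) (int2 hG' e h2), h ζ h1 h2, h' ζ h1 h2]; ring
theorem FG_wd (ha : Dt N m q C V u a g) (hb : Dt N m q C V u b k) (i : Fin N) : WD (0, 0, ee i) (FF m a b) (GG g k i) :=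
  WD.sub ((ha.wd i).lift ha.Ab.l2l (ha.gl i)) ((hb.wd i).lift hb.Ab.l2l (hb.gl i)).tt (Bm.lift ha.Ab).l2l (ha.gl i).lift (Bm.tt (Bm.lift hb.Ab)).l2l (hb.gl i).lift.tt
end Par
end

section
namespace Par
variable {N : ℕ} {m q C δ : ℝ} {V u : EE N → ℝ} {a b : ℝ × EE N → ℝ} {g k : ℝ × EE N → EE N} {ψ : ℝ × ℝ × EE N → ℝ}
def Ee (δ m : ℝ) (u : EE N → ℝ) (a b : ℝ × EE N → ℝ) (ω : ℝ × ℝ × EE N) : ℝ :=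
  if 0 < ω.1 then Bd δ m (a ω.2) (b (TT ω).2) - Bd δ m (u ω.2.2) (b (TT ω).2) else 0
theorem Ee_abs (ha : Dt N m q C V u a g) (hb : Dt N m q C V u b k) (hδ : 0 < δ) (ω : ℝ × ℝ × EE N) : |Ee δ m u a b ω| ≤ C + C + (C + C) := by
  have n := ha.ws.b0; have n2 := hb.ws.b0
  have hC := (n ω.2).trans (ha.aC ω.2)
  have f : ∀ r s : ℝ, 0 ≤ r → r ≤ C → 0 ≤ s → s ≤ C → |Bd δ m r s| ≤ C + C := fun r s h1 h2 h3 h4 => (Bd_abs hδ r s).trans (abs_le.2 ⟨by linarith, by linarith⟩)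
  unfold Ee; split_ifs
  · exact (abs_sub _ _).trans (add_le_add (f _ _ (n _) (ha.aC _) (n2 _) (hb.aC _)) (f _ _ (ha.u0 _) (ha.uC _) (n2 _) (hb.aC _)))
  · simp; linarith
theorem Ee_bm (ha : Dt N m q C V u a g) (hb : Dt N m q C V u b k) (hδ : 0 < δ) : Bm (Ee δ m u a b) := by
  have c := Bd_cont hδ (m := m) (by linarith [ha.hm])
  have hB : Measurable fun ω : ℝ × ℝ × EE N => b (TT ω).2 := (Bm.tt (Bm.lift hb.am)).1
  exact ⟨Measurable.ite (measurableSet_lt measurable_const measurable_fst) ((c.measurable.comp ((Bm.lift ha.am).1.prodMk hB)).sub (c.measurable.comp ((Bm.lift ha.ub).1.prodMk hB))) measurable_const, _, Ee_abs ha hb hδ⟩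
theorem Ent (ha : Dt N m q C V u a g) (hb : Dt N m q C V u b k) (hδ : 0 < δ) (h1 : ContDiff ℝ 1 ψ) (h2 : HasCompactSupport ψ) (h0 : ∀ ω, 0 ≤ ψ ω) :
    (∑ i, ∫ ω, g ω.2 i * (cc ω * (deriv (Hd δ) (FF m a b ω) * GG g k i ω * ψ ω + Hd δ (FF m a b ω) * fderiv ℝ ψ ω (0, 0, ee i))))
      + ∫ ω, (HH N).indicator (fun p => V p.2 * a p ^ q) ω.2 * (cc ω * (Hd δ (FF m a b ω) * ψ ω)) ≤ ∫ ω, Ee δ m u a b ω * fderiv ℝ ψ ω (0, 1, 0) := by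
  have bF := FF_bm ha hb
  have bH : Bm (fun ω => Hd δ (FF m a b ω)) := bF.comp (Hd_cd hδ).continuous
  have bψ : Bm ψ := Bm.cc h1.continuous h2
  have bη : Bm (fun ω => Hd δ (FF m a b ω) * ψ ω) := bH.mul bψ
  have bη2 : Bm (fun ω => cc ω * (Hd δ (FF m a b ω) * ψ ω)) := cc_bm.mul bη
  have lG : ∀ i, L2l (fun ω => deriv (Hd δ) (FF m a b ω) * GG g k i ω) := fun i => by
    simpa [mul_comm] using (GG_l ha hb i).mul_bm (bF.comp ((Hd_cd hδ).continuous_deriv le_rfl))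
  have lγ : ∀ i, L2l (fun ω => deriv (Hd δ) (FF m a b ω) * GG g k i ω * ψ ω + Hd δ (FF m a b ω) * fderiv ℝ ψ ω (0, 0, ee i)) := fun i => ((lG i).mul_bm bψ).add (bH.mul (fd_bm h1 h2 _)).l2l
  have wd := fun i => cc_wd (((FG_wd ha hb i).chain bF (GG_l ha hb i) (Hd_cd hδ)).mul bH.l2l (lG i) h1) bη.l2l (lγ i)
  have z : ∀ ω ∉ tsupport ψ, ψ ω = 0 := fun ω => image_eq_zero_of_notMem_tsupport
  have lγ2 : ∀ i, L2l (fun ω => cc ω * (deriv (Hd δ) (FF m a b ω) * GG g k i ω * ψ ω + Hd δ (FF m a b ω) * fderiv ℝ ψ ω (0, 0, ee i))) := fun i => by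
    simpa [mul_comm] using (lγ i).mul_bm cc_bm
  have cη : HasCompactSupport (fun ω => cc ω * (Hd δ (FF m a b ω) * ψ ω)) := HasCompactSupport.intro h2 fun ω hω => by simp [z ω hω]
  have bD : Bm (fun ω : ℝ × ℝ × EE N => a ω.2 - u ω.2.2) := Bm.lift (ha.am.sub ha.ub)
  have T := time_lem (e := (0, 1, 0)) (v := fun i => (0, 0, ee i)) bD.l2l ha.fl.lift (fun i => (ha.gl i).lift)
    (weak_lift (ha.am.sub ha.ub).l2l ha.fl ha.gl ha.weak) bη2.l2l cη lγ2 (fun i => HasCompactSupport.intro h2 fun ω hω => by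
      have : fderiv ℝ ψ ω (0, 0, ee i) = 0 := by rw [image_eq_zero_of_notMem_tsupport (fun h => hω (tsupport_fderiv_subset ℝ h))]; rfl
      simp [z ω hω, this]) wd
  have bE := Ee_bm ha hb hδ
  have P := (pair_fd bE.l2l h1 h2 (0, 1, 0) 0).tendsto_slope_zero_right
  simp only [zero_add, zero_smul, add_zero, smul_eq_mul] at P
  refine le_of_tendsto_of_tendsto T P ?_
  filter_upwards [self_mem_nhdsWithin] with h (hh : 0 < h)
  rw [← div_eq_inv_mul, div_le_div_iff_of_pos_right hh]
  have sh : ∀ w η : ℝ × ℝ × EE N → ℝ, ∫ ω, w ω * η (ω + h • (0, 1, 0)) = ∫ ω, w (ω - h • (0, 1, 0)) * η ω := fun w η => by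
    rw [← integral_sub_right_eq_self _ (h • ((0:ℝ), (1:ℝ), (0 : EE N)))]; simp
  have ms : Measurable fun ω : ℝ × ℝ × EE N => ω - h • (0, 1, 0) := measurable_id.sub_const _
  have sb : ∀ {f : ℝ × ℝ × EE N → ℝ}, Bm f → Bm (fun ω => f (ω - h • (0, 1, 0))) := fun hf => ⟨hf.1.comp ms, hf.2.imp fun C hC p => hC _⟩
  rw [sh (Ee δ m u a b), sh (fun p => a p.2 - u p.2.2) (fun p => cc p * (Hd δ (FF m a b p) * ψ p)), ← integral_sub (int2 (sb bD).l2l bη2.l2l cη) (int2 bD.l2l bη2.l2l cη), ← integral_sub (int2 (sb bE).l2l bψ.l2l h2) (int2 bE.l2l bψ.l2l h2)]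
  refine integral_mono (isub (int2 (sb bD).l2l bη2.l2l cη) (int2 bD.l2l bη2.l2l cη)) (isub (int2 (sb bE).l2l bψ.l2l h2) (int2 bE.l2l bψ.l2l h2)) fun ω => ?_
  obtain ⟨s, t, x⟩ := ω
  have hn := h0 (s, t, x)
  rw [← sub_mul, ← sub_mul]
  have off : ∀ t x, t ≤ 0 → a (t, x) = u x := fun t x ht => ha.ws.off (t, x) (by simpa [HH] using ht)
  by_cases hs : 0 < s
  · by_cases ht : 0 < t
    · have e : cc (s, t, x) = 1 := by simp [cc, hs, ht]
      have e2 : FF m a b (s, t, x) = a (t, x) ^ m - b (s, x) ^ m := by simp [FF, Aa, TT, HH, hs, ht]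
      have := Bd_le (b := b (s, x)) hδ (by linarith [ha.hm] : 0 < m) (ha.ws.b0 (t, x)) (ha.ws.b0 (t - h, x))
      rw [e, e2, one_mul, ← mul_assoc]
      refine mul_le_mul_of_nonneg_right ?_ hn
      simp [Ee, hs, TT]; linarith
    · have e : cc (s, t, x) = 0 := by simp [cc, ht]
      simp [e, Ee, hs, TT, off t x (not_lt.1 ht), off (t - h) x (by linarith)]
  · have e : cc (s, t, x) = 0 := by simp [cc, hs]
    simp [e, Ee, hs]
end Par
end

section
namespace Par
variable {N : ℕ} {m q C δ : ℝ} {V u : EE N → ℝ} {a b : ℝ × EE N → ℝ} {g k : ℝ × EE N → EE N} {ψ : ℝ × ℝ × EE N → ℝ}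
def d1 (ψ : ℝ × ℝ × EE N → ℝ) (i : Fin N) (ω : ℝ × ℝ × EE N) : ℝ := fderiv ℝ ψ ω (0, 0, ee i)
def d2 (ψ : ℝ × ℝ × EE N → ℝ) (i : Fin N) (ω : ℝ × ℝ × EE N) : ℝ := fderiv ℝ (d1 ψ i) ω (0, 0, ee i)
theorem d1_cd (h : ContDiff ℝ 2 ψ) (i : Fin N) : ContDiff ℝ 1 (d1 ψ i) :=
  (h.fderiv_right (m := 1) (by norm_num)).clm_apply contDiff_const
def If (V : EE N → ℝ) (q : ℝ) (a : ℝ × EE N → ℝ) : ℝ × EE N → ℝ := (HH N).indicator fun p => V p.2 * a p ^ q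
theorem Kr1 (ha : Dt N m q C V u a g) (hb : Dt N m q C V u b k) (hδ : 0 < δ) (h1 : ContDiff ℝ 2 ψ) (h2 : HasCompactSupport ψ) (h0 : ∀ ω, 0 ≤ ψ ω) :
    - (∑ i, ∫ ω, cc ω * Jd δ (FF m a b ω) * d2 ψ i ω) ≤ (∫ ω, Ee δ m u a b ω * fderiv ℝ ψ ω (0, 1, 0)) + ∫ ω, Ee δ m u b a (TT ω) * fderiv ℝ ψ ω (1, 0, 0) := by
  have h1' : ContDiff ℝ 1 ψ := h1.of_le (by norm_num)
  have E1 := Ent ha hb hδ h1' h2 h0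
  have E2 := Ent hb ha hδ (h1'.comp TT_cd) (TT_cs h2) fun ω => h0 _
  have eF : ∀ ω, FF m b a (TT ω) = - FF m a b ω := fun ω => by unfold FF; rw [TT_TT]; ring
  have eG : ∀ i ω, GG k g i (TT ω) = - GG g k i ω := fun i ω => by unfold GG; rw [TT_TT]; ring
  rw [← TT_int (fun ω => Ee δ m u b a ω * _), ← TT_int (fun ω => (HH N).indicator _ _ * _)] at E2
  simp only [fun i => (TT_int (fun ω => k ω.2 i * (cc ω * (deriv (Hd δ) (FF m b a ω) * GG k g i ω * (ψ ∘ TT) ω + Hd δ (FF m b a ω) * fderiv ℝ (ψ ∘ TT) ω (0, 0, ee i))))).symm] at E2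
  have eT : ∀ ω v, fderiv ℝ (fun x => ψ (TT x)) (TT ω) v = fderiv ℝ ψ ω (TT v) := fun ω v => TT_fd h1' _ _
  simp only [eF, eG, eT, cc_tt, Function.comp_def, TT_TT, Hd_neg, Hd_deven] at E2
  change _ + (∫ ω, If V q b (TT ω).2 * _) ≤ ∫ ω, _ * fderiv ℝ ψ ω (1, 0, 0) at E2
  change _ + (∫ ω : ℝ × ℝ × EE N, If V q a ω.2 * _) ≤ _ at E1
  have eT2 : ∀ i, TT (0, 0, ee i) = (0, 0, (ee i : EE N)) := fun i => rfl
  simp only [eT2] at E2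
  have bF := FF_bm ha hb
  have bH : Bm (fun ω => Hd δ (FF m a b ω)) := bF.comp (Hd_cd hδ).continuous
  have bψ : Bm ψ := Bm.cc h1.continuous h2
  have bK : ∀ i, Bm (fun ω => cc ω * Hd δ (FF m a b ω) * d1 ψ i ω) := fun i => (cc_bm.mul bH).mul (fd_bm h1' h2 _)
  have bd : Bm (fun ω => deriv (Hd δ) (FF m a b ω)) := bF.comp ((Hd_cd hδ).continuous_deriv le_rfl)
  have z : ∀ ω ∉ tsupport ψ, ψ ω = 0 := fun ω => image_eq_zero_of_notMem_tsupport
  have lg : ∀ i, L2l (fun ω : ℝ × ℝ × EE N => g ω.2 i) := fun i => (ha.gl i).lift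
  have lk : ∀ i, L2l (fun ω : ℝ × ℝ × EE N => k (TT ω).2 i) := fun i => (hb.gl i).lift.tt
  have lG := fun i => GG_l ha hb i
  have c1 : ∀ i, HasCompactSupport (fun ω => cc ω * Hd δ (FF m a b ω) * d1 ψ i ω) := fun i => (fd_cs h2 _).mul_left
  have lX : ∀ i, L2l (fun ω => GG g k i ω * (cc ω * deriv (Hd δ) (FF m a b ω) * ψ ω)) := fun i => (lG i).mul_bm ((cc_bm.mul bd).mul bψ)
  have cX : ∀ i, HasCompactSupport (fun ω => GG g k i ω * (cc ω * deriv (Hd δ) (FF m a b ω) * ψ ω)) := fun i => h2.mul_left.mul_left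
  have bY : Bm (fun ω => cc ω * (Hd δ (FF m a b ω) * ψ ω)) := cc_bm.mul (bH.mul bψ)
  have cY : HasCompactSupport (fun ω => cc ω * (Hd δ (FF m a b ω) * ψ ω)) := h2.mul_left.mul_left
  have i1 : ∀ {f : ℝ × ℝ × EE N → ℝ} i, L2l f → Integrable (fun ω => f ω * (GG g k i ω * (cc ω * deriv (Hd δ) (FF m a b ω) * ψ ω)) + f ω * (cc ω * Hd δ (FF m a b ω) * d1 ψ i ω)) := fun i hf =>
    (int2 hf (lX i) (cX i)).fun_add (int2 hf (bK i).l2l (c1 i))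
  have J : ∀ i, (∫ ω, cc ω * Jd δ (FF m a b ω) * d2 ψ i ω) = - ∫ ω, GG g k i ω * (cc ω * Hd δ (FF m a b ω) * d1 ψ i ω) := fun i => by
    have bJ := bF.comp (Jd_cd hδ).continuous
    have := cc_wd ((FG_wd ha hb i).chain bF (lG i) (Jd_cd hδ)) bJ.l2l (by
      simp only [Jd_deriv hδ]; simpa [mul_comm] using (lG i).mul_bm bH) (d1 ψ i) (d1_cd h1 i) (fd_cs h2 _)
    refine this.trans ?_
    simp only [Jd_deriv hδ]; congr 2; ext ω; ring
  have K1 : ∀ i, (∫ ω, GG g k i ω * (cc ω * Hd δ (FF m a b ω) * d1 ψ i ω)) ≤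
      (∫ ω, g ω.2 i * (cc ω * (deriv (Hd δ) (FF m a b ω) * GG g k i ω * ψ ω + Hd δ (FF m a b ω) * fderiv ℝ ψ ω (0, 0, ee i)))) +
      ∫ ω, k (TT ω).2 i * (cc ω * (deriv (Hd δ) (FF m a b ω) * - GG g k i ω * ψ ω + - Hd δ (FF m a b ω) * fderiv ℝ ψ ω (0, 0, ee i))) := fun i => by
    have e1 : (∫ ω, g ω.2 i * (cc ω * (deriv (Hd δ) (FF m a b ω) * GG g k i ω * ψ ω + Hd δ (FF m a b ω) * fderiv ℝ ψ ω (0, 0, ee i)))) = ∫ ω, (g ω.2 i * (GG g k i ω * (cc ω * deriv (Hd δ) (FF m a b ω) * ψ ω)) + g ω.2 i * (cc ω * Hd δ (FF m a b ω) * d1 ψ i ω)) := by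
      congr 1; ext ω; unfold d1; ring
    have e2 : (∫ ω, k (TT ω).2 i * (cc ω * (deriv (Hd δ) (FF m a b ω) * - GG g k i ω * ψ ω + - Hd δ (FF m a b ω) * fderiv ℝ ψ ω (0, 0, ee i)))) = - ∫ ω, (k (TT ω).2 i * (GG g k i ω * (cc ω * deriv (Hd δ) (FF m a b ω) * ψ ω)) + k (TT ω).2 i * (cc ω * Hd δ (FF m a b ω) * d1 ψ i ω)) := by
      rw [← integral_neg]; congr 1; ext ω; unfold d1; ring
    rw [e1, e2, ← sub_eq_add_neg, ← integral_sub (i1 i (lg i)) (i1 i (lk i))]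
    refine integral_mono (int2 (lG i) (bK i).l2l (c1 i)) (isub (i1 i (lg i)) (i1 i (lk i))) fun ω => ?_
    have hn : 0 ≤ GG g k i ω ^ 2 * (cc ω * deriv (Hd δ) (FF m a b ω) * ψ ω) := mul_nonneg (sq_nonneg _) (mul_nonneg (mul_nonneg (by unfold cc; split_ifs <;> simp) (Hd_dnn hδ _)) (h0 ω))
    have : GG g k i ω = g ω.2 i - k (TT ω).2 i := rfl
    simp only []
    generalize cc ω * deriv (Hd δ) (FF m a b ω) * ψ ω = A at *
    generalize cc ω * Hd δ (FF m a b ω) * d1 ψ i ω = B at *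
    rw [this] at hn ⊢; nlinarith
  have fa : L2l (fun ω : ℝ × ℝ × EE N => If V q a ω.2) := ha.fl.lift
  have fb : L2l (fun ω : ℝ × ℝ × EE N => If V q b (TT ω).2) := hb.fl.lift.tt
  have K2 : 0 ≤ (∫ ω, If V q a ω.2 * (cc ω * (Hd δ (FF m a b ω) * ψ ω))) + ∫ ω, If V q b (TT ω).2 * (cc ω * (- Hd δ (FF m a b ω) * ψ ω)) := by
    have e2 : (∫ ω, If V q b (TT ω).2 * (cc ω * (- Hd δ (FF m a b ω) * ψ ω))) = - ∫ ω, If V q b (TT ω).2 * (cc ω * (Hd δ (FF m a b ω) * ψ ω)) := by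
      rw [← integral_neg]; congr 1; ext ω; ring
    rw [e2, ← sub_eq_add_neg, ← integral_sub (int2 fa bY.l2l cY) (int2 fb bY.l2l cY)]
    refine integral_nonneg fun ω => ?_
    obtain ⟨s, t, x⟩ := ω
    by_cases h : 0 < s ∧ 0 < t
    · have e : cc (s, t, x) = 1 := by simp [cc, h]
      have e2 : FF m a b (s, t, x) = a (t, x) ^ m - b (s, x) ^ m := by simp [FF, Aa, TT, HH, h]
      simp only [e, e2, If, HH, TT, indicator, mem_setOf_eq, h, if_true, one_mul, Pi.zero_apply]
      rw [← sub_mul, ← mul_sub, ← mul_assoc]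
      refine mul_nonneg ?_ (h0 _)
      rw [mul_assoc]
      refine mul_nonneg (ha.hV0 _) (Hd_sgn ?_)
      have hm : 0 ≤ m := by linarith [ha.hm]
      rcases le_total (a (t, x)) (b (s, x)) with hl | hl
      · exact mul_nonneg_of_nonpos_of_nonpos (sub_nonpos.2 (Real.rpow_le_rpow (ha.ws.b0 _) hl ha.hq.le)) (sub_nonpos.2 (Real.rpow_le_rpow (ha.ws.b0 _) hl hm))
      · exact mul_nonneg (sub_nonneg.2 (Real.rpow_le_rpow (hb.ws.b0 _) hl ha.hq.le)) (sub_nonneg.2 (Real.rpow_le_rpow (hb.ws.b0 _) hl hm))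
    · simp [cc, h]
  have K3 := Finset.sum_le_sum fun (i : Fin N) (_ : i ∈ Finset.univ) => K1 i
  rw [Finset.sum_add_distrib] at K3
  simp only [J, Finset.sum_neg_distrib, neg_neg]
  linarith
def E0 (u : EE N → ℝ) (a b : ℝ × EE N → ℝ) (ω : ℝ × ℝ × EE N) : ℝ := if 0 < ω.1 then |a ω.2 - b (TT ω).2| - |u ω.2.2 - b (TT ω).2| else 0
theorem E0_lim (ha : Dt N m q C V u a g) (hb : Dt N m q C V u b k) {f : ℝ × ℝ × EE N → ℝ} (hf : Bm f) (hc : HasCompactSupport f) :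
    Tendsto (fun n => ∫ ω, Ee (eps n) m u a b ω * f ω) atTop (𝓝 (∫ ω, E0 u a b ω * f ω)) := by
  refine tendsto_integral_of_dominated_convergence (fun ω => (C + C + (C + C)) * |f ω|) (fun n => ((Ee_bm ha hb (eps_pos n)).1.mul hf.1).aestronglyMeasurable) ((int1 hf.l2l hc).abs.const_mul _) (fun n => Eventually.of_forall fun ω => ?_) (Eventually.of_forall fun ω => ?_)
  · rw [norm_mul]; exact mul_le_mul_of_nonneg_right (Ee_abs ha hb (eps_pos n) ω) (abs_nonneg _)
  · refine Tendsto.mul_const _ ?_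
    have hm : 0 < m := by linarith [ha.hm]
    unfold Ee E0; split_ifs
    · exact (Bd_lim hm eps_tendsto eps_pos (ha.ws.b0 _) (hb.ws.b0 _)).sub (Bd_lim hm eps_tendsto eps_pos (ha.u0 _) (hb.ws.b0 _))
    · exact tendsto_const_nhds
theorem Kr2 (ha : Dt N m q C V u a g) (hb : Dt N m q C V u b k) (h1 : ContDiff ℝ 2 ψ) (h2 : HasCompactSupport ψ) (h0 : ∀ ω, 0 ≤ ψ ω) :
    - (∑ i, ∫ ω, cc ω * |FF m a b ω| * d2 ψ i ω) ≤ (∫ ω, E0 u a b ω * fderiv ℝ ψ ω (0, 1, 0)) + ∫ ω, E0 u b a (TT ω) * fderiv ℝ ψ ω (1, 0, 0) := by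
  have h1' : ContDiff ℝ 1 ψ := h1.of_le (by norm_num)
  refine le_of_tendsto_of_tendsto' (Tendsto.neg (tendsto_finset_sum _ fun i _ => ?_)) ((E0_lim ha hb (fd_bm h1' h2 _) (fd_cs h2 _)).add ?_) fun n => Kr1 ha hb (eps_pos n) h1 h2 h0
  · have bf := fd_bm (d1_cd h1 i) (fd_cs h2 _) (0, 0, ee i)
    obtain ⟨f1, D, hD⟩ := FF_bm ha hb
    refine tendsto_integral_of_dominated_convergence (fun ω => (D + 1) * |d2 ψ i ω|) (fun n => ((cc_bm.1.mul ((Jd_cd (eps_pos n)).continuous.measurable.comp f1)).mul bf.1).aestronglyMeasurable) ((int1 bf.l2l (fd_cs (fd_cs h2 _) _)).abs.const_mul _) (fun n => Eventually.of_forall fun ω => ?_) (Eventually.of_forall fun ω => ((Jd_lim eps_tendsto _).const_mul _).mul_const _)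
    rw [norm_mul]; refine mul_le_mul_of_nonneg_right ?_ (abs_nonneg _)
    have : Jd (eps n) (FF m a b ω) ≤ D + 1 := by
      unfold Jd; rw [Real.sqrt_le_left (by linarith [(abs_nonneg _).trans (hD ω)])]
      have := hD ω; have e1 := eps_le n; have e0 := eps_pos n; rw [← sq_abs (FF m a b ω)]
      nlinarith [abs_nonneg (FF m a b ω)]
    rw [norm_mul, Real.norm_of_nonneg (show 0 ≤ Jd (eps n) (FF m a b ω) from Real.sqrt_nonneg _)]
    refine (mul_le_of_le_one_left (show 0 ≤ Jd (eps n) (FF m a b ω) from Real.sqrt_nonneg _) ?_).trans this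
    unfold cc; split_ifs <;> simp
  · have := E0_lim hb ha (Bm.tt (fd_bm h1' h2 (1, 0, 0))) (TT_cs (fd_cs h2 _))
    rw [← TT_int] at this
    refine this.congr fun n => ?_
    rw [← TT_int]; rfl
end Par
end

section
open scoped Pointwise
namespace Par
variable {N : ℕ} {m q C δ : ℝ} {V u : EE N → ℝ} {a b : ℝ × EE N → ℝ} {g k : ℝ × EE N → EE N} {ψ : ℝ × ℝ × EE N → ℝ}
def SS (ω : ℝ × ℝ × EE N) : ℝ × ℝ × EE N := (ω.1 + ω.2.1, ω.2)
def SSe : (ℝ × ℝ × EE N) ≃ᵐ (ℝ × ℝ × EE N) := ⟨⟨SS, fun ω => (ω.1 - ω.2.1, ω.2), fun ω => by simp [SS], fun ω => by simp [SS]⟩, by unfold SS; dsimp; fun_prop, by dsimp; fun_prop⟩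
theorem SS_mp : MeasurePreserving (SS (N := N)) := by
  have h := MeasurePreserving.skew_product (MeasurePreserving.id (volume : Measure (ℝ × EE N))) (μc := (volume : Measure ℝ)) (μd := volume) (g := fun p r => r + p.1) (by unfold Function.uncurry; fun_prop) (Eventually.of_forall fun p => map_add_right_eq_self _ _)
  exact (Measure.measurePreserving_swap.comp h).comp Measure.measurePreserving_swap
theorem SS_int (f : ℝ × ℝ × EE N → ℝ) : ∫ ω, f (SS ω) = ∫ ω, f ω := SS_mp.integral_comp (SSe (N := N)).measurableEmbedding f
def ro (j : ℕ) (r : ℝ) : ℝ := kr j (r - 2 / ((j:ℝ) + 1))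
theorem ro_cd (j : ℕ) : ContDiff ℝ 2 (ro j) := ContDiff.comp (g := kr j) (bmp ℝ j).contDiff_normed (by fun_prop)
theorem ro_nn (j : ℕ) (r : ℝ) : 0 ≤ ro j r := kr_nn j _
theorem ro_int (j : ℕ) : ∫ r, ro j r = 1 := by unfold ro; rw [integral_sub_right_eq_self (kr j)]; exact kr_int j
theorem ro_supp {j : ℕ} {r : ℝ} (h : ro j r ≠ 0) : 0 < r ∧ r ≤ 3 / ((j:ℝ) + 1) := by
  have h' : ‖r - 2 / ((j:ℝ) + 1)‖ ≤ 1 / ((j:ℝ) + 1) := by by_contra h'; exact h (kr_supp h')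
  rw [Real.norm_eq_abs, abs_le] at h'
  have : 0 < 1 / ((j:ℝ) + 1) := by positivity
  have e2 : 2 / ((j:ℝ) + 1) = 2 * (1 / ((j:ℝ) + 1)) := by ring
  have e3 : 3 / ((j:ℝ) + 1) = 3 * (1 / ((j:ℝ) + 1)) := by ring
  rw [e3]; rw [e2] at h'; constructor <;> linarith
theorem ro_cs (j : ℕ) : HasCompactSupport (ro j) := HasCompactSupport.intro (isCompact_Icc (a := 0) (b := 3 / ((j:ℝ) + 1))) fun r hr => by
  by_contra h; exact hr ⟨(ro_supp h).1.le, (ro_supp h).2⟩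
theorem ro_i (j : ℕ) : Integrable (ro j) := (ro_cd j).continuous.integrable_of_hasCompactSupport (ro_cs j)
theorem ro_lim {φ : ℝ → ℝ} {l η : ℝ} (i : ∀ j, Integrable (fun r => ro j r * φ r)) {t0 : ℝ} (ht : 0 < t0) (h : ∀ᵐ r, 0 < r → r < t0 → |φ r - l| ≤ η) :
    ∀ᶠ j in atTop, |(∫ r, ro j r * φ r) - l| ≤ η := by
  have e : Tendsto (fun j : ℕ => 3 * (1 / ((j:ℝ) + 1))) atTop (𝓝 0) := by simpa using (tendsto_one_div_add_atTop_nhds_zero_nat (𝕜 := ℝ)).const_mul 3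
  filter_upwards [e.eventually_lt_const ht] with j hj
  have : (∫ r, ro j r * φ r) - l = ∫ r, ro j r * (φ r - l) := by
    simp only [mul_sub]; rw [integral_sub (i j) ((ro_i j).mul_const l), integral_mul_const, ro_int, one_mul]
  rw [this, ← Real.norm_eq_abs]
  have e2 : η = ∫ r, ro j r * η := by rw [integral_mul_const, ro_int, one_mul]
  rw [e2]
  refine norm_integral_le_of_norm_le ((ro_i j).mul_const η) ?_
  filter_upwards [h] with r hr
  rw [norm_mul, Real.norm_of_nonneg (ro_nn j r)]
  by_cases h0 : ro j r = 0
  · simp [h0]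
  · have := ro_supp h0
    exact mul_le_mul_of_nonneg_left (hr this.1 (this.2.trans_lt (by linarith [show 3 / ((j:ℝ)+1) = 3 * (1 / ((j:ℝ)+1)) by ring]))) (ro_nn j r)
theorem Lim {α β κ : ℝ × EE N → ℝ} (hα : Bm α) (hβ : Bm β) (hκ : Bm κ) (hc : HasCompactSupport κ) :
    Tendsto (fun j => ∫ ω, cc ω * |α ω.2 - β (TT ω).2| * (κ ω.2 * ro j (ω.1 - ω.2.1))) atTop (𝓝 (∫ p in HH N, |α p - β p| * κ p)) := by
  obtain ⟨A, hA⟩ := hα.2; obtain ⟨B, hB⟩ := hβ.2; obtain ⟨D, hD⟩ := hκ.2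
  set φ : ℝ → ℝ := fun r => ∫ p, (HH N).indicator (fun p => |α p - β (p + (r, 0))| * κ p) p with hφ
  have mq : ∀ r : ℝ, Measurable fun p : ℝ × EE N => p + (r, 0) := fun r => by fun_prop
  have bs : ∀ r, Bm ((HH N).indicator (fun p => |α p - β (p + (r, 0))| * κ p)) := fun r => (((hα.sub ⟨hβ.1.comp (mq r), B, fun p => hB _⟩).comp continuous_abs).mul hκ).ind HH_meas
  have zz : ∀ r, ∀ p ∉ tsupport κ, (HH N).indicator (fun p => |α p - β (p + (r, 0))| * κ p) p = 0 := fun r p hp => by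
    by_cases h : p ∈ HH N <;> simp [h, image_eq_zero_of_notMem_tsupport hp]
  have is : ∀ r, Integrable ((HH N).indicator (fun p => |α p - β (p + (r, 0))| * κ p)) := fun r => int1 (bs r).l2l (HasCompactSupport.intro hc (zz r))
  have I : ∀ j, Integrable (fun ω : ℝ × ℝ × EE N => ro j ω.1 * (HH N).indicator (fun p => |α p - β (p + (ω.1, 0))| * κ p) ω.2) := fun j => by
    have mm : Measurable fun ω : ℝ × ℝ × EE N => ω.2 + (ω.1, 0) := by fun_prop
    refine ((ro_i j).mul_prod ((int1 hκ.l2l hc).abs.const_mul (A + B))).mono' (((ro_cd j).continuous.measurable.comp measurable_fst).mul ?_).aestronglyMeasurable (Eventually.of_forall fun ω => ?_)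
    · have : (fun ω : ℝ × ℝ × EE N => (HH N).indicator (fun p => |α p - β (p + (ω.1, 0))| * κ p) ω.2) = (Prod.snd ⁻¹' HH N).indicator (fun ω => |α ω.2 - β (ω.2 + (ω.1, 0))| * κ ω.2) := by
        ext ω; rfl
      rw [this]
      exact (((((hα.1.comp measurable_snd).sub (hβ.1.comp mm)).abs).mul (hκ.1.comp measurable_snd))).indicator (measurable_snd HH_meas)
    · rw [norm_mul, Real.norm_of_nonneg (ro_nn j _)]
      refine mul_le_mul_of_nonneg_left ?_ (ro_nn j _)
      refine (norm_indicator_le_norm_self _ _).trans ?_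
      rw [Real.norm_eq_abs, abs_mul, abs_abs]
      exact mul_le_mul_of_nonneg_right ((abs_sub _ _).trans (add_le_add (hA _) (hB _))) (abs_nonneg _)
  have E : ∀ j, ∫ ω, cc ω * |α ω.2 - β (TT ω).2| * (κ ω.2 * ro j (ω.1 - ω.2.1)) = ∫ r, ro j r * φ r := fun j => by
    have I' := I j
    rw [Measure.volume_eq_prod] at I'
    rw [← SS_int]
    refine Eq.trans ?_ ((integral_prod _ I').trans ?_)
    · congr 1; ext ⟨r, t, x⟩
      by_cases h0 : ro j r = 0
      · simp [SS, h0]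
      · have hr := (ro_supp h0).1
        by_cases ht : 0 < t
        · simp [SS, TT, cc, HH, ht, add_pos ht hr, add_comm r t]; ring
        · simp [SS, cc, HH, ht]
    · simp only [hφ, integral_const_mul]
  simp only [E]
  have e0 : (∫ p in HH N, |α p - β p| * κ p) = φ 0 := by
    rw [hφ, ← integral_indicator HH_meas]; simp [show ((0:ℝ), (0 : EE N)) = 0 from rfl]
  rw [e0, Metric.tendsto_nhds]
  intro ε hε
  set K := tsupport κ + Metric.closedBall (0 : ℝ × EE N) 1 with hK
  have kK : IsCompact K := IsCompact.add hc (isCompact_closedBall _ _)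
  have tr := (trans_L1 (int1 (hβ.l2l.ind kK.measurableSet) (cs_ind kK))).const_mul (D + 1)
  have cr : Tendsto (fun r : ℝ => (r, (0 : EE N))) (𝓝 0) (𝓝 0) := by
    have : Continuous (fun r : ℝ => (r, (0 : EE N))) := by fun_prop
    exact this.tendsto 0
  have tr2 := tr.comp cr
  rw [mul_zero] at tr2
  obtain ⟨t0, ht0, h⟩ := Metric.eventually_nhds_iff.1 (tr2.eventually_lt_const (half_pos hε))
  have D0 := (abs_nonneg _).trans (hD 0)
  have key := ro_lim (φ := φ) (l := φ 0) (η := ε / 2) (fun j => by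
    have I' := I j
    rw [Measure.volume_eq_prod] at I'
    have := I'.integral_prod_left
    simpa only [integral_const_mul] using this) (lt_min ht0 one_pos) (Eventually.of_forall fun r hr hr2 => by
    have hr3 := h (y := r) (by simpa [abs_of_pos hr] using hr2.trans_le (min_le_left _ _))
    refine le_trans ?_ hr3.le
    have iT : Integrable (fun p => |K.indicator β (p + (r, 0)) - K.indicator β p|) := by
      have := int1 (hβ.l2l.ind kK.measurableSet) (cs_ind kK)
      exact (isub (this.comp_add_right _) this).abs
    simp only [hφ, Function.comp]
    rw [← integral_sub (is r) (is 0), ← integral_const_mul, ← Real.norm_eq_abs]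
    refine norm_integral_le_of_norm_le (iT.const_mul _) (Eventually.of_forall fun p => ?_)
    by_cases hp : p ∈ tsupport κ
    · have k1 : p ∈ K := ⟨p, hp, 0, by simp, by simp⟩
      have k2 : p + (r, 0) ∈ K := ⟨p, hp, (r, 0), by simpa [Prod.norm_def, abs_of_pos hr] using hr2.le.trans (min_le_right _ _), rfl⟩
      rw [indicator_of_mem k1, indicator_of_mem k2]
      by_cases hh : p ∈ HH N
      · rw [indicator_of_mem hh, indicator_of_mem hh, ← sub_mul, norm_mul, mul_comm]
        refine mul_le_mul ((hD p).trans (by linarith)) ?_ (abs_nonneg _) (by linarith)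
        have e : p + ((0:ℝ), (0 : EE N)) = p := by ext <;> simp
        rw [e]
        refine (abs_abs_sub_abs_le_abs_sub _ _).trans (le_of_eq ?_)
        rw [abs_sub_comm]; congr 1; ring
      · rw [indicator_of_notMem hh, indicator_of_notMem hh]; simp; positivity
    · rw [zz r p hp, zz 0 p hp]; simp; positivity)
  filter_upwards [key] with j hj
  rw [Real.dist_eq]; linarith
end Par
end

section
namespace Par
variable {N : ℕ} {m q C δ : ℝ} {V u : EE N → ℝ} {a b : ℝ × EE N → ℝ} {g k : ℝ × EE N → EE N} {θ : ℝ → ℝ} {χ : EE N → ℝ}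
def Ps (θ ρ : ℝ → ℝ) (χ : EE N → ℝ) (ω : ℝ × ℝ × EE N) : ℝ := θ ω.2.1 * ρ (ω.1 - ω.2.1) * χ ω.2.2
variable {ρ : ℝ → ℝ}
theorem Ps_cd {n : WithTop ℕ∞} (h1 : ContDiff ℝ n θ) (h2 : ContDiff ℝ n ρ) (h3 : ContDiff ℝ n χ) : ContDiff ℝ n (Ps θ ρ χ) := by
  unfold Ps
  exact ((h1.comp (by fun_prop)).mul (h2.comp (by fun_prop))).mul (h3.comp (by fun_prop))
theorem Ps_cs (h1 : HasCompactSupport θ) (h2 : HasCompactSupport ρ) (h3 : HasCompactSupport χ) : HasCompactSupport (Ps θ ρ χ) := by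
  refine HasCompactSupport.intro (((h2.isCompact.prod (h1.isCompact.prod h3.isCompact)).image (show Continuous (SS (N := N)) by unfold SS; fun_prop))) fun ω hω => ?_
  by_contra h
  have h' : θ ω.2.1 ≠ 0 ∧ ρ (ω.1 - ω.2.1) ≠ 0 ∧ χ ω.2.2 ≠ 0 := by unfold Ps at h; simp at h; tauto
  exact hω ⟨(ω.1 - ω.2.1, ω.2), ⟨subset_tsupport _ h'.2.1, subset_tsupport _ h'.1, subset_tsupport _ h'.2.2⟩, by simp [SS]⟩
theorem Ps_x (h1 : Differentiable ℝ θ) (h2 : Differentiable ℝ ρ) (h3 : Differentiable ℝ χ) (v : EE N) (ω : ℝ × ℝ × EE N) :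
    fderiv ℝ (Ps θ ρ χ) ω (0, 0, v) = Ps θ ρ (fun x => fderiv ℝ χ x v) ω := by
  refine fd_dir (by unfold Ps; fun_prop) ?_
  have h : HasDerivAt (fun r : ℝ => χ (ω.2.2 + r • v)) (fderiv ℝ χ ω.2.2 v) 0 := (h3 _).hasFDerivAt.hasLineDerivAt v
  simpa [Ps] using h.const_mul (θ ω.2.1 * ρ (ω.1 - ω.2.1))
theorem Ps_s (h1 : Differentiable ℝ θ) (h2 : Differentiable ℝ ρ) (h3 : Differentiable ℝ χ) (ω : ℝ × ℝ × EE N) :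
    fderiv ℝ (Ps θ ρ χ) ω (1, 0, 0) = Ps θ (deriv ρ) χ ω := by
  refine fd_dir (by unfold Ps; fun_prop) ?_
  have e : HasDerivAt (fun r : ℝ => ω.1 + r - ω.2.1) 1 0 := ((hasDerivAt_id 0).const_add _).sub_const _
  have h : HasDerivAt (fun r : ℝ => ρ (ω.1 + r - ω.2.1)) (deriv ρ (ω.1 - ω.2.1) * 1) 0 := HasDerivAt.comp (h₂ := ρ) 0 (by simpa using (h2 _).hasDerivAt) e
  simpa [Ps] using (h.const_mul (θ ω.2.1)).mul_const (χ ω.2.2)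
theorem Ps_d (h1 : Differentiable ℝ θ) (h2 : Differentiable ℝ ρ) (s t : ℝ) : HasDerivAt (fun t => θ t * ρ (s - t)) (deriv θ t * ρ (s - t) - θ t * deriv ρ (s - t)) t := by
  have e : HasDerivAt (fun r : ℝ => s - r) (-1) t := (hasDerivAt_id t).const_sub s
  have h : HasDerivAt (fun r : ℝ => ρ (s - r)) (deriv ρ (s - t) * -1) t := HasDerivAt.comp (h₂ := ρ) t (h2 _).hasDerivAt e
  exact ((h1 t).hasDerivAt.mul h).congr_deriv (by ring)
theorem Ps_t (h1 : Differentiable ℝ θ) (h2 : Differentiable ℝ ρ) (h3 : Differentiable ℝ χ) (ω : ℝ × ℝ × EE N) :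
    fderiv ℝ (Ps θ ρ χ) ω (0, 1, 0) = Ps (deriv θ) ρ χ ω - Ps θ (deriv ρ) χ ω := by
  refine fd_dir (by unfold Ps; fun_prop) ?_
  have e : HasDerivAt (fun r : ℝ => ω.2.1 + r) 1 0 := (hasDerivAt_id 0).const_add _
  have h := HasDerivAt.comp (h₂ := fun t => θ t * ρ (ω.1 - t)) (0:ℝ) (by simpa using Ps_d h1 h2 ω.1 ω.2.1) e
  have h' := h.mul_const (χ ω.2.2)
  simp only [Function.comp, mul_one] at h'
  unfold Ps
  convert! h' using 1
  · ext r; simp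
  · ring
theorem d_cs {f : ℝ → ℝ} (h : HasCompactSupport f) : HasCompactSupport (deriv f) := HasCompactSupport.deriv h
theorem thirdz (ha : Dt N m q C V u a g) (h1 : ContDiff ℝ 2 θ) (h2 : HasCompactSupport θ) (h3 : Continuous χ) (j : ℕ) :
    ∫ ω : ℝ × ℝ × EE N, cc ω * |u ω.2.2 - a ω.2| * Ps θ (deriv (ro j)) χ ω = 0 := by
  rw [← SS_int]
  have z : ∫ r, deriv (ro j) r = 0 := integral_eq_zero_of_hasDerivAt_of_integrable (fun x => ((ro_cd j).differentiable two_ne_zero x).hasDerivAt)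
    (((ro_cd j).continuous_deriv one_le_two).integrable_of_hasCompactSupport (d_cs (ro_cs j))) (ro_i j)
  have := integral_prod_mul (μ := (volume : Measure ℝ)) (ν := (volume : Measure (ℝ × EE N))) (deriv (ro j)) (fun p => (HH N).indicator (fun p => |u p.2 - a p| * θ p.1 * χ p.2) p)
  rw [z, zero_mul] at this
  refine Eq.trans ?_ this
  refine integral_congr_ae (Eventually.of_forall ?_)
  rintro ⟨r, t, x⟩
  by_cases h0 : deriv (ro j) r = 0
  · simp [SS, Ps, h0]
  · have hr : 0 ≤ r := by
      have : tsupport (ro j) ⊆ Ici 0 := closure_minimal (fun r hr => (ro_supp hr).1.le) isClosed_Ici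
      exact this (support_deriv_subset h0)
    by_cases ht : 0 < t
    · simp [SS, Ps, cc, HH, ht, add_pos_of_nonneg_of_pos hr ht]; ring
    · simp [SS, cc, HH, ht]
theorem secondz (ha : Dt N m q C V u b g) (h1 : ContDiff ℝ 2 θ) (h2 : HasCompactSupport θ) (h3 : Continuous χ) (h4 : HasCompactSupport χ) (j : ℕ) :
    ∫ ω : ℝ × ℝ × EE N, cc ω * |u ω.2.2 - b (TT ω).2| * (Ps (deriv θ) (ro j) χ ω - Ps θ (deriv (ro j)) χ ω) = -(θ 0 * ∫ r, ro j r * ∫ x, |b (r, x) - u x| * χ x) := by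
  have r1 := (ro_cd j).differentiable two_ne_zero
  have t1 := h1.differentiable two_ne_zero
  have bb := (ha.ub.sub ha.am).comp continuous_abs
  have cT := (Bm.cc (h1.continuous_deriv one_le_two) (d_cs h2))
  have cp : ∀ {θ ρ : ℝ → ℝ}, Continuous θ → Continuous ρ → Continuous (Ps θ ρ χ) := fun a b => by unfold Ps; fun_prop
  have c1 := cp (h1.continuous_deriv one_le_two) (ro_cd j).continuous
  have c2 := cp h1.continuous ((ro_cd j).continuous_deriv one_le_two)
  have I : Integrable (fun ω : ℝ × ℝ × EE N => cc ω * |u ω.2.2 - b (TT ω).2| * (Ps (deriv θ) (ro j) χ ω - Ps θ (deriv (ro j)) χ ω)) := by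
    have s := (Ps_cs (d_cs h2) (ro_cs j) h4).sub (Ps_cs h2 (d_cs (ro_cs j)) h4)
    exact int1 (((cc_bm.mul (Bm.tt (Bm.lift bb)))).mul (Bm.cc (c1.sub c2) s)).l2l s.mul_left
  rw [← TT_int]
  have I' : Integrable (fun ω : ℝ × ℝ × EE N => cc (TT ω) * |u (TT ω).2.2 - b (TT (TT ω)).2| * (Ps (deriv θ) (ro j) χ (TT ω) - Ps θ (deriv (ro j)) χ (TT ω))) := TT_mp.integrable_comp_of_integrable I
  rw [Measure.volume_eq_prod] at I' ⊢
  rw [integral_prod_symm _ I']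
  have e : ∀ p : ℝ × EE N, (∫ t, cc (TT (t, p)) * |u (TT (t, p)).2.2 - b (TT (TT (t, p))).2| * (Ps (deriv θ) (ro j) χ (TT (t, p)) - Ps θ (deriv (ro j)) χ (TT (t, p)))) = -(θ 0) * (ro j p.1 * (|b p - u p.2| * χ p.2)) := by
    rintro ⟨s, x⟩
    by_cases hs : 0 < s
    · have d := HasCompactSupport.integral_Ioi_deriv_eq (f := fun t => θ t * ro j (s - t)) ((h1.mul ((ro_cd j).comp (by fun_prop))).of_le one_le_two) h2.mul_right 0
      rw [sub_zero, ← integral_indicator measurableSet_Ioi] at d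
      refine Eq.trans ?_ (show (|b (s, x) - u x| * χ x) * -(θ 0 * ro j s) = _ by ring)
      rw [← d, ← integral_const_mul]
      congr 1; ext t
      by_cases ht : 0 < t
      · simp only [TT, cc, Ps, indicator, mem_Ioi, ht, hs, if_true, and_self, (Ps_d t1 r1 s t).deriv]
        rw [abs_sub_comm]; ring
      · simp [TT, cc, ht]
    · have : ro j s = 0 := by by_contra h; exact hs (ro_supp h).1
      simp [TT, cc, hs, this]
  simp only [e]
  rw [integral_const_mul, neg_mul]
  congr 2
  have J : Integrable (fun p : ℝ × EE N => ro j p.1 * (|b p - u p.2| * χ p.2)) (volume.prod volume) := by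
    have := ((ro_i j).mul_prod (h3.integrable_of_hasCompactSupport (μ := volume) h4)).bdd_mul (c := 2 * C) (f := fun p => |b p - u p.2|) ((ha.am.sub ha.ub).1.abs.aestronglyMeasurable) (Eventually.of_forall fun p => by
      rw [Real.norm_eq_abs, abs_abs, abs_le]; constructor <;> linarith [ha.u0 p.2, ha.uC p.2, ha.ws.b0 p, ha.aC p])
    refine this.congr (Eventually.of_forall fun p => ?_)
    simp; ring
  refine (integral_prod _ J).trans ?_
  simp only [integral_const_mul]
def Tr (u : EE N → ℝ) (b : ℝ × EE N → ℝ) : Prop := ∀ η > 0, ∃ t0 > 0, ∀ᵐ t : ℝ, 0 < t → t < t0 → ∫ x, |b (t,x) - u x| * xi x ≤ η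
theorem Kr3 (ha : Dt N m q C V u a g) (hb : Dt N m q C V u b k) (hT : Tr u b) (h1 : ContDiff ℝ 2 θ) (h2 : HasCompactSupport θ) (h0 : ∀ t, 0 ≤ θ t)
    (h3 : ContDiff ℝ 2 χ) (h4 : HasCompactSupport χ) (h5 : ∀ x, 0 ≤ χ x) (h6 : ∀ x, χ x ≤ xi x) :
    -(∑ i, ∫ p in HH N, |Aa m a p - Aa m b p| * (θ p.1 * fderiv ℝ (fun x => fderiv ℝ χ x (ee i)) p.2 (ee i))) ≤ ∫ p in HH N, |a p - b p| * (deriv θ p.1 * χ p.2) := by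
  have t1 := h1.differentiable two_ne_zero
  have x1 := h3.differentiable two_ne_zero
  have xd : ∀ i, ContDiff ℝ 1 (fun x => fderiv ℝ χ x (ee i)) := fun i => (h3.fderiv_right (m := 1) le_rfl).clm_apply contDiff_const
  have xc : ∀ i, HasCompactSupport (fun x => fderiv ℝ χ x (ee i)) := fun i => fd_cs h4 _
  have bt : ∀ {θ : ℝ → ℝ} {χ : EE N → ℝ}, Continuous θ → Continuous χ → HasCompactSupport θ → HasCompactSupport χ → Continuous (fun p : ℝ × EE N => θ p.1 * χ p.2) ∧ HasCompactSupport (fun p : ℝ × EE N => θ p.1 * χ p.2) := by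
    intro θ χ a b c d
    refine ⟨by fun_prop, HasCompactSupport.intro (c.isCompact.prod d.isCompact) fun p hp => ?_⟩
    by_contra h
    exact hp ⟨subset_tsupport _ (left_ne_zero_of_mul h), subset_tsupport _ (right_ne_zero_of_mul h)⟩
  have Y : Tendsto (fun j => θ 0 * ∫ r, ro j r * ∫ x, |b (r, x) - u x| * χ x) atTop (𝓝 (θ 0 * 0)) := by
    refine Tendsto.const_mul _ (Metric.tendsto_nhds.2 fun ε hε => ?_)
    obtain ⟨t0, ht0, h⟩ := hT (ε / 2) (half_pos hε)
    have J : ∀ j, Integrable (fun p : ℝ × EE N => ro j p.1 * (|b p - u p.2| * χ p.2)) (volume.prod volume) := fun j => by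
      have := bt (ro_cd j).continuous h3.continuous (ro_cs j) h4
      exact (int1 (((hb.am.sub hb.ub).comp continuous_abs).mul (Bm.cc this.1 this.2)).l2l this.2.mul_left).congr (Eventually.of_forall fun p => by dsimp; ring)
    have key := ro_lim (φ := fun r => ∫ x, |b (r, x) - u x| * χ x) (l := 0) (η := ε / 2) (fun j => by
      simpa only [integral_const_mul] using (J j).integral_prod_left) ht0 (by
      filter_upwards [h] with r hr p1 p2
      refine le_trans ?_ (hr p1 p2)
      rw [sub_zero, abs_of_nonneg (integral_nonneg fun x => mul_nonneg (abs_nonneg _) (h5 x))]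
      refine integral_mono_of_nonneg (Eventually.of_forall fun x => mul_nonneg (abs_nonneg _) (h5 x)) ?_ (Eventually.of_forall fun x => mul_le_mul_of_nonneg_left (h6 x) (abs_nonneg _))
      refine xi_int0.bdd_mul (c := 2 * C) (((hb.ws.bm.comp (by fun_prop)).sub hb.um).abs.aestronglyMeasurable) (Eventually.of_forall fun x => ?_)
      rw [Real.norm_eq_abs, abs_abs, abs_le]; constructor <;> linarith [hb.u0 x, hb.uC x, hb.ws.b0 (r, x), hb.aC (r, x)])
    filter_upwards [key] with j hj
    rw [Real.dist_eq]; linarith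
  have L := (tendsto_finsetSum Finset.univ fun i _ => Lim ha.Ab hb.Ab (Bm.cc (bt h1.continuous (fd_c (xd i) (ee i)) h2 (fd_cs (xc i) _)).1 (bt h1.continuous (fd_c (xd i) (ee i)) h2 (fd_cs (xc i) _)).2) (bt h1.continuous (fd_c (xd i) (ee i)) h2 (fd_cs (xc i) _)).2).neg
  have dd := bt (h1.continuous_deriv one_le_two) h3.continuous (d_cs h2) h4
  have R := (Lim ha.am hb.am (Bm.cc dd.1 dd.2) dd.2).add Y
  rw [mul_zero, add_zero] at R
  refine le_of_tendsto_of_tendsto' L R fun j => ?_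
  have r1 := (ro_cd j).differentiable two_ne_zero
  have K := Kr2 ha hb (Ps_cd h1 (ro_cd j) h3) (Ps_cs h2 (ro_cs j) h4) (fun ω => mul_nonneg (mul_nonneg (h0 _) (ro_nn j _)) (h5 _))
  have e1 : ∀ i, d1 (Ps θ (ro j) χ) i = Ps θ (ro j) (fun x => fderiv ℝ χ x (ee i)) := fun i => funext fun ω => Ps_x t1 r1 x1 _ _
  have e2 : ∀ i ω, d2 (Ps θ (ro j) χ) i ω = Ps θ (ro j) (fun x => fderiv ℝ (fun x => fderiv ℝ χ x (ee i)) x (ee i)) ω := fun i ω => by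
    unfold d2; rw [e1, Ps_x t1 r1 ((xd i).differentiable one_ne_zero)]
  simp only [e2, Ps_t t1 r1 x1, Ps_s t1 r1 x1] at K
  refine le_trans (le_of_eq ?_) (K.trans (le_of_eq ?_))
  · congr 1; refine Finset.sum_congr rfl fun i _ => ?_
    congr 1; ext ω; unfold FF Ps; ring
  · have A := secondz hb h1 h2 h3.continuous h4 j
    have B := thirdz ha h1 h2 h3.continuous j
    have cp : ∀ {θ ρ : ℝ → ℝ}, Continuous θ → Continuous ρ → Continuous (Ps θ ρ χ) := fun a b => by unfold Ps; have := h3.continuous; fun_prop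
    have c1 := cp (h1.continuous_deriv one_le_two) (ro_cd j).continuous
    have c2 := cp h1.continuous ((ro_cd j).continuous_deriv one_le_two)
    have s1 := Ps_cs (d_cs h2) (ro_cs j) h4
    have s2 := Ps_cs h2 (d_cs (ro_cs j)) h4
    have X := cc_bm.mul (((Bm.lift ha.am).sub (Bm.tt (Bm.lift hb.am))).comp continuous_abs)
    have YY := cc_bm.mul (Bm.tt (Bm.lift ((hb.ub.sub hb.am).comp continuous_abs)))
    have ZZ := cc_bm.mul (Bm.lift ((ha.ub.sub ha.am).comp continuous_abs))
    have i1 := int1 (X.mul (Bm.cc (c1.sub c2) (s1.sub s2))).l2l (s1.sub s2).mul_left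
    have i2 := int1 (YY.mul (Bm.cc (c1.sub c2) (s1.sub s2))).l2l (s1.sub s2).mul_left
    have i3 := int1 (X.mul (Bm.cc c2 s2)).l2l s2.mul_left
    have i4 := int1 (ZZ.mul (Bm.cc c2 s2)).l2l s2.mul_left
    have o1 : ∀ ω, E0 u a b ω = cc ω * |a ω.2 - b (TT ω).2| - cc ω * |u ω.2.2 - b (TT ω).2| := fun ω => by
      unfold E0 cc
      by_cases h : 0 < ω.1 <;> by_cases h' : 0 < ω.2.1 <;> simp [h, h']
      rw [ha.ws.off ω.2 h']; simp
    have o2 : ∀ ω, E0 u b a (TT ω) = cc ω * |a ω.2 - b (TT ω).2| - cc ω * |u ω.2.2 - a ω.2| := fun ω => by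
      unfold E0 cc
      rw [TT_TT]
      by_cases h : 0 < ω.1 <;> by_cases h' : 0 < ω.2.1 <;> simp [h, h', TT, abs_sub_comm]
      rw [hb.ws.off (ω.1, ω.2.2) h]; simp [abs_sub_comm]
    have w1 : (∫ ω, E0 u a b ω * (Ps (deriv θ) (ro j) χ ω - Ps θ (deriv (ro j)) χ ω)) = (∫ ω, cc ω * |a ω.2 - b (TT ω).2| * (Ps (deriv θ) (ro j) χ ω - Ps θ (deriv (ro j)) χ ω)) - ∫ ω, cc ω * |u ω.2.2 - b (TT ω).2| * (Ps (deriv θ) (ro j) χ ω - Ps θ (deriv (ro j)) χ ω) :=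
      Eq.trans (by congr 1; ext ω; rw [o1, sub_mul]) (integral_sub i1 i2)
    have w2 : (∫ ω, E0 u b a (TT ω) * Ps θ (deriv (ro j)) χ ω) = (∫ ω, cc ω * |a ω.2 - b (TT ω).2| * Ps θ (deriv (ro j)) χ ω) - ∫ ω, cc ω * |u ω.2.2 - a ω.2| * Ps θ (deriv (ro j)) χ ω :=
      Eq.trans (by congr 1; ext ω; rw [o2, sub_mul]) (integral_sub i3 i4)
    have w3 := integral_add i1 i3
    rw [w1, w2, A, B]
    have w4 : (∫ ω, cc ω * |a ω.2 - b (TT ω).2| * (deriv θ ω.2.1 * χ ω.2.2 * ro j (ω.1 - ω.2.1))) = _ := Eq.trans (by congr 1; ext ω; dsimp; unfold Ps; ring) w3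
    dsimp at w4 ⊢
    rw [w4]; ring
end Par
end

section
namespace Par
variable {N : ℕ} {m q C δ : ℝ} {V u : EE N → ℝ} {a b : ℝ × EE N → ℝ} {g k : ℝ × EE N → EE N} {θ : ℝ → ℝ} {χ : EE N → ℝ}
theorem tcut (l T : ℝ) : ∃ θ : ℝ → ℝ, ContDiff ℝ 2 θ ∧ HasCompactSupport θ ∧ (∀ t, 0 ≤ θ t) ∧ (∀ t > 0, deriv θ t ≤ -(l * θ t)) ∧ ∀ t, 0 < t → t < T → 0 < θ t := by
  set s := Real.smoothTransition with hs
  have sc : ContDiff ℝ 2 s := Real.smoothTransition.contDiff (n := 2)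
  refine ⟨fun t => Real.exp (-(l * t)) * s (T - t) * s (t + 2), ?_, ?_, ?_, ?_, ?_⟩
  · exact ((by fun_prop : ContDiff ℝ 2 fun t => Real.exp (-(l * t))).mul (sc.comp (by fun_prop))).mul (sc.comp (by fun_prop))
  · refine HasCompactSupport.intro (isCompact_Icc (a := -2) (b := T)) fun t ht => ?_
    by_cases h : t < -2
    · simp [hs, Real.smoothTransition.zero_of_nonpos (show t + 2 ≤ 0 by linarith)]
    · have : T < t := by by_contra h'; exact ht ⟨not_lt.1 h, not_lt.1 h'⟩
      simp [hs, Real.smoothTransition.zero_of_nonpos (show T - t ≤ 0 by linarith)]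
  · exact fun t => mul_nonneg (mul_nonneg (Real.exp_pos _).le (Real.smoothTransition.nonneg _)) (Real.smoothTransition.nonneg _)
  · intro t ht
    have e : (fun t => Real.exp (-(l * t)) * s (T - t) * s (t + 2)) =ᶠ[𝓝 t] fun t => Real.exp (-(l * t)) * s (T - t) := by
      filter_upwards [lt_mem_nhds ht] with r hr
      rw [hs, Real.smoothTransition.one_of_one_le (by linarith : 1 ≤ r + 2), mul_one]
    have a1 : HasDerivAt (fun t => Real.exp (-(l * t))) (Real.exp (-(l * t)) * -(l * 1)) t := (((hasDerivAt_id t).const_mul l).neg).exp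
    have a2 : HasDerivAt (fun t => s (T - t)) (deriv s (T - t) * -1) t := HasDerivAt.comp (h₂ := s) t ((sc.differentiable two_ne_zero) _).hasDerivAt ((hasDerivAt_id t).const_sub T)
    have a3 : deriv (fun t => Real.exp (-(l * t)) * s (T - t)) t = _ := (a1.mul a2).deriv
    have a4 := e.eq_of_nhds
    dsimp only at a4 ⊢
    rw [e.deriv_eq, a3, a4]
    have : 0 ≤ deriv s (T - t) := Real.smoothTransition.monotone.deriv_nonneg
    have := mul_nonneg (Real.exp_pos (-(l * t))).le this
    nlinarith
  · exact fun t h1 h2 => mul_pos (mul_pos (Real.exp_pos _) (Real.smoothTransition.pos_of_pos (by linarith))) (Real.smoothTransition.pos_of_pos (by linarith))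
theorem fcut : ∃ D ≥ (0:ℝ), ∀ n : ℕ, ∃ f : ℝ → ℝ, ContDiff ℝ 2 f ∧ (∀ y, 0 ≤ f y ∧ f y ≤ (Real.cosh y)⁻¹) ∧ (∀ y, |deriv (deriv f) y| ≤ D * (Real.cosh y)⁻¹) ∧ (∀ y, |y| ≤ (n:ℝ) + 1 → f y = (Real.cosh y)⁻¹) ∧ ∃ R, ∀ y, R < |y| → f y = 0 := by
  let B : ContDiffBump (0:ℝ) := ⟨1, 2, one_pos, one_lt_two⟩
  have bc : ContDiff ℝ 2 B := B.contDiff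
  have bd : ContDiff ℝ 1 (deriv B) := bc.deriv' (n := 1)
  obtain ⟨D1, h1⟩ := (B.hasCompactSupport.deriv (𝕜 := ℝ)).exists_bound_of_continuous bd.continuous
  obtain ⟨D2, h2⟩ := (B.hasCompactSupport.deriv (𝕜 := ℝ)).deriv.exists_bound_of_continuous (bd.continuous_deriv le_rfl)
  have p1 := (norm_nonneg _).trans (h1 0); have p2 := (norm_nonneg _).trans (h2 0)
  refine ⟨2 + 2 * D1 + D2, by positivity, fun n => ?_⟩
  set c : ℝ := 1 / ((n:ℝ) + 1) with hc
  have c0 : 0 < c := by positivity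
  have c1 : c ≤ 1 := by rw [hc, div_le_one (by positivity)]; linarith [n.cast_nonneg (α := ℝ)]
  have F1 : ∀ y, HasDerivAt (fun y => (Real.cosh y)⁻¹) (-(Real.sinh y) / Real.cosh y ^ 2) y := fun y => (Real.hasDerivAt_cosh y).inv (Real.cosh_pos y).ne'
  have F2 : ∀ y, HasDerivAt (fun y => -(Real.sinh y) / Real.cosh y ^ 2) ((-(Real.cosh y) * Real.cosh y ^ 2 - -(Real.sinh y) * (2 * Real.cosh y * Real.sinh y)) / (Real.cosh y ^ 2) ^ 2) y := fun y => by
    have := (Real.hasDerivAt_sinh y).neg.div ((Real.hasDerivAt_cosh y).pow 2) (pow_ne_zero 2 (Real.cosh_pos y).ne')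
    exact this.congr_deriv (by simp)
  have lc : ∀ {G : ℝ → ℝ}, Differentiable ℝ G → ∀ y, HasDerivAt (fun y => G (c * y)) (deriv G (c * y) * c) y := fun {G} hG y => by
    have := HasDerivAt.comp (h₂ := G) y (hG (c * y)).hasDerivAt ((hasDerivAt_id y).const_mul c)
    exact this.congr_deriv (by simp)
  have e1 : deriv (fun y => (Real.cosh y)⁻¹ * B (c * y)) = fun y => -(Real.sinh y) / Real.cosh y ^ 2 * B (c * y) + (Real.cosh y)⁻¹ * (deriv B (c * y) * c) :=
    funext fun y => ((F1 y).mul (lc (bc.differentiable two_ne_zero) y)).deriv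
  have cn : ContDiff ℝ 2 fun y => (Real.cosh y)⁻¹ := Real.contDiff_cosh.inv fun y => (Real.cosh_pos y).ne'
  refine ⟨fun y => (Real.cosh y)⁻¹ * B (c * y), cn.mul (bc.comp (by fun_prop)), fun y => ?_, fun y => ?_, fun y hy => ?_, 2 / c, fun y hy => ?_⟩
  · have := inv_pos.2 (Real.cosh_pos y)
    exact ⟨mul_nonneg this.le B.nonneg, mul_le_of_le_one_right this.le B.le_one⟩
  · have := ((F2 y).mul (lc (bc.differentiable two_ne_zero) y)).add ((F1 y).mul ((lc (bd.differentiable one_ne_zero) y).mul_const c))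
    have e2 : deriv (deriv (fun y => (Real.cosh y)⁻¹ * B (c * y))) y = _ := (congrArg (fun h => deriv h y) e1).trans this.deriv
    rw [e2]
    have k0 := Real.cosh_pos y
    have sq := Real.cosh_sq y
    set K := (Real.cosh y)⁻¹ with hK
    have K0 : 0 < K := inv_pos.2 k0
    have s1 : |(-(Real.sinh y) / Real.cosh y ^ 2)| ≤ K := by
      rw [abs_div, abs_neg, abs_of_pos (by positivity : 0 < Real.cosh y ^ 2), div_le_iff₀ (by positivity), hK]
      rw [show (Real.cosh y)⁻¹ * Real.cosh y ^ 2 = Real.cosh y by field_simp]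
      exact abs_le_of_sq_le_sq (by linarith) k0.le
    have s2 : |(-(Real.cosh y) * Real.cosh y ^ 2 - -(Real.sinh y) * (2 * Real.cosh y * Real.sinh y)) / (Real.cosh y ^ 2) ^ 2| ≤ 2 * K := by
      rw [abs_div, abs_of_pos (by positivity : 0 < (Real.cosh y ^ 2) ^ 2), div_le_iff₀ (by positivity), hK]
      rw [show 2 * (Real.cosh y)⁻¹ * (Real.cosh y ^ 2) ^ 2 = Real.cosh y * (2 * Real.cosh y ^ 2) by field_simp]
      rw [show -(Real.cosh y) * Real.cosh y ^ 2 - -(Real.sinh y) * (2 * Real.cosh y * Real.sinh y) = Real.cosh y * (2 * Real.sinh y ^ 2 - Real.cosh y ^ 2) by ring, abs_mul, abs_of_pos k0]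
      refine mul_le_mul_of_nonneg_left (abs_le.2 ⟨?_, ?_⟩) k0.le <;> nlinarith [sq_nonneg (Real.sinh y)]
    have b0 : |B (c * y)| ≤ 1 := by rw [abs_of_nonneg B.nonneg]; exact B.le_one
    have b1 : |deriv B (c * y) * c| ≤ D1 := by rw [abs_mul, abs_of_pos c0]; exact (mul_le_of_le_one_right (abs_nonneg _) c1).trans (h1 _)
    have b2 : |deriv (deriv B) (c * y) * c * c| ≤ D2 := by
      rw [abs_mul, abs_mul, abs_of_pos c0]; exact (mul_le_of_le_one_right (by positivity) c1).trans ((mul_le_of_le_one_right (abs_nonneg _) c1).trans (h2 _))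
    have t1 := mul_le_mul s2 b0 (abs_nonneg _) (by positivity)
    have t2 := mul_le_mul s1 b1 (abs_nonneg _) K0.le
    have t3 := mul_le_mul (abs_of_pos K0).le b2 (abs_nonneg _) K0.le
    rw [← abs_mul] at t1 t2 t3
    refine (abs_add_le _ _).trans ((add_le_add (abs_add_le _ _) (abs_add_le _ _)).trans ?_)
    linarith
  · have : B (c * y) = 1 := B.one_of_mem_closedBall (by
      rw [mem_closedBall_zero_iff, Real.norm_eq_abs, abs_mul, abs_of_pos c0]
      exact (mul_le_mul_of_nonneg_left hy c0.le).trans (by rw [hc]; field_simp; exact le_rfl))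
    simp [this]
  · have : B (c * y) = 0 := B.zero_of_le_dist (by
      rw [dist_zero_right, Real.norm_eq_abs, abs_mul, abs_of_pos c0]
      rw [div_lt_iff₀ c0] at hy; show 2 ≤ _; linarith)
    simp [this]
theorem prod_fd {h : Fin N → ℝ → ℝ} (hd : ∀ j, Differentiable ℝ (h j)) (i : Fin N) (x : EE N) :
    fderiv ℝ (fun x : EE N => ∏ j, h j (x j)) x (ee i) = ∏ j, Function.update h i (deriv (h i)) j (x j) := by
  refine fd_dir ?_ ?_
  · have : ∀ j, Differentiable ℝ fun x : EE N => h j (x j) := fun j => (hd j).comp (EuclideanSpace.proj (𝕜 := ℝ) j).differentiable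
    exact (HasFDerivAt.finsetProd fun j _ => (this j x).hasFDerivAt).differentiableAt
  · have e : HasDerivAt (fun r : ℝ => h i (x i + r)) (deriv (h i) (x i)) 0 := by
      exact (HasDerivAt.comp (h₂ := h i) (h₂' := deriv (h i) (x i)) (0:ℝ) (by simpa using (hd i (x i)).hasDerivAt) ((hasDerivAt_id (0:ℝ)).const_add (x i))).congr_deriv (by simp)
    have e2 := e.mul_const (∏ j ∈ Finset.univ.erase i, h j (x j))
    refine (e2.congr_of_eventuallyEq (Eventually.of_forall fun r => ?_)).congr_deriv ?_
    · rw [← Finset.mul_prod_erase _ _ (Finset.mem_univ i)]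
      congr 1
      · simp [ee]
      · refine Finset.prod_congr rfl fun j hj => ?_
        simp [ee, Finset.ne_of_mem_erase hj]
    · rw [← Finset.mul_prod_erase _ (fun j => Function.update h i (deriv (h i)) j (x j)) (Finset.mem_univ i)]
      congr 1
      · simp
      · exact Finset.prod_congr rfl fun j hj => by simp [Finset.ne_of_mem_erase hj]
theorem scut : ∃ D ≥ (0:ℝ), ∀ n : ℕ, ∃ χ : EE N → ℝ, ContDiff ℝ 2 χ ∧ HasCompactSupport χ ∧ (∀ x, 0 ≤ χ x) ∧ (∀ x, χ x ≤ xi x) ∧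
    (∀ i x, |fderiv ℝ (fun x => fderiv ℝ χ x (ee i)) x (ee i)| ≤ D * xi x) ∧ ∀ x, ‖x‖ ≤ (n:ℝ) → χ x = xi x := by
  obtain ⟨D, hD, H⟩ := fcut
  refine ⟨D, hD, fun n => ?_⟩
  obtain ⟨f, f1, f2, f3, f4, R, hR⟩ := H n
  have fd : Differentiable ℝ f := f1.differentiable two_ne_zero
  have fdd : Differentiable ℝ (deriv f) := (f1.deriv' (n := 1)).differentiable one_ne_zero
  refine ⟨fun x => ∏ j, f (x j), ?_, ?_, fun x => Finset.prod_nonneg fun j _ => (f2 _).1, fun x => Finset.prod_le_prod (fun j _ => (f2 _).1) fun j _ => (f2 _).2, fun i x => ?_, fun x hx => ?_⟩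
  · exact contDiff_prod fun j _ => f1.comp (EuclideanSpace.proj (𝕜 := ℝ) j).contDiff
  · refine HasCompactSupport.intro (isCompact_closedBall (0 : EE N) (∑ j : Fin N, R)) fun x hx => ?_
    by_contra h
    refine hx (mem_closedBall_zero_iff.2 ((norm_le_sum x).trans (Finset.sum_le_sum fun j _ => ?_)))
    by_contra h'
    exact h (Finset.prod_eq_zero (Finset.mem_univ j) (hR _ (not_le.1 h')))
  · have a1 : (fun x => fderiv ℝ (fun x : EE N => ∏ j, f (x j)) x (ee i)) = fun x => ∏ j, Function.update (fun _ => f) i (deriv f) j (x j) := funext fun x => prod_fd (h := fun _ => f) (fun _ => fd) i x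
    rw [a1, prod_fd (fun j => by by_cases hj : j = i <;> [(subst hj; simpa using fdd); simpa [hj] using fd]), Finset.abs_prod]
    unfold xi
    rw [← Finset.mul_prod_erase _ _ (Finset.mem_univ i), ← Finset.mul_prod_erase _ _ (Finset.mem_univ i), ← mul_assoc]
    refine mul_le_mul ?_ (Finset.prod_le_prod (fun j _ => abs_nonneg _) fun j hj => ?_) (Finset.prod_nonneg fun j _ => abs_nonneg _) (by have := Real.cosh_pos (x i); positivity)
    · simpa using f3 (x i)
    · simpa [Finset.ne_of_mem_erase hj, abs_of_nonneg (f2 (x j)).1] using (f2 (x j)).2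
  · exact Finset.prod_congr rfl fun j _ => f4 _ (by have := PiLp.norm_apply_le x j; rw [Real.norm_eq_abs] at this; linarith)
theorem Uniq (ha : Dt N m q C V u a g) (hb : Dt N m q C V u b k) (hT : Tr u b) : ∀ᵐ p : ℝ × EE N, 0 < p.1 → a p = b p := by
  obtain ⟨D, hD, H⟩ := scut (N := N)
  choose χ c1 c2 c3 c4 c5 c6 using H
  have C0 : 0 ≤ C := (ha.u0 0).trans (ha.uC 0)
  set L := m * C ^ (m - 1) with hL
  have L0 : 0 ≤ L := mul_nonneg (by linarith [ha.hm]) (Real.rpow_nonneg C0 _)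
  have main : ∀ T : ℕ, ∀ᵐ p : ℝ × EE N, 0 < p.1 → p.1 < T → a p = b p := fun T => by
    obtain ⟨θ, t1, t2, t3, t4, t5⟩ := tcut (N * (L * D) + 1) T
    have bw := (ha.am.sub hb.am).comp continuous_abs
    have W : ∀ {τ : ℝ → ℝ} {η : EE N → ℝ}, Continuous τ → HasCompactSupport τ → Integrable η → Integrable (fun p : ℝ × EE N => |a p - b p| * (τ p.1 * η p.2)) (volume.restrict (HH N)) := fun {τ η} x y z => by
      obtain ⟨A, hA⟩ := bw.2
      exact Integrable.restrict (Integrable.bdd_mul (c := A) ((x.integrable_of_hasCompactSupport y).mul_prod z) bw.1.aestronglyMeasurable (Eventually.of_forall hA))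
    have ixi := W t1.continuous t2 xi_int0
    have tend : Tendsto (fun n => ∫ p in HH N, |a p - b p| * (θ p.1 * χ n p.2)) atTop (𝓝 (∫ p in HH N, |a p - b p| * (θ p.1 * xi p.2))) := by
      refine tendsto_integral_of_dominated_convergence _ (fun n => (W t1.continuous t2 ((c1 n).continuous.integrable_of_hasCompactSupport (c2 n))).aestronglyMeasurable) ixi (fun n => Eventually.of_forall fun p => ?_) (Eventually.of_forall fun p => ?_)
      · rw [Real.norm_of_nonneg (mul_nonneg (abs_nonneg _) (mul_nonneg (t3 _) (c3 n _)))]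
        exact mul_le_mul_of_nonneg_left (mul_le_mul_of_nonneg_left (c4 n _) (t3 _)) (abs_nonneg _)
      · refine tendsto_const_nhds.congr' ?_
        filter_upwards [eventually_ge_atTop ⌈‖p.2‖⌉₊] with n hn
        rw [c6 n p.2 (Nat.ceil_le.1 hn)]
    have le : (N * (L * D) + 1) * (∫ p in HH N, |a p - b p| * (θ p.1 * xi p.2)) ≤ N * (L * D) * ∫ p in HH N, |a p - b p| * (θ p.1 * xi p.2) := by
      refine le_of_tendsto' (tend.const_mul _) fun n => ?_
      have K := Kr3 ha hb hT t1 t2 t3 (c1 n) (c2 n) (c3 n) (c4 n)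
      have iχ := (c1 n).continuous.integrable_of_hasCompactSupport (μ := volume) (c2 n)
      have r : (∫ p in HH N, |a p - b p| * (deriv θ p.1 * χ n p.2)) ≤ ∫ p in HH N, -(N * (L * D) + 1) * (|a p - b p| * (θ p.1 * χ n p.2)) := by
        refine setIntegral_mono_on (W (t1.continuous_deriv one_le_two) (d_cs t2) iχ) ((W t1.continuous t2 iχ).const_mul _) HH_meas fun p hp => ?_
        have := mul_le_mul_of_nonneg_left (mul_le_mul_of_nonneg_right (t4 p.1 hp) (c3 n p.2)) (abs_nonneg (a p - b p))
        refine this.trans (le_of_eq (by ring))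
      rw [integral_const_mul] at r
      have s : ∀ i, (∫ p in HH N, |Aa m a p - Aa m b p| * (θ p.1 * fderiv ℝ (fun x => fderiv ℝ (χ n) x (ee i)) p.2 (ee i))) ≤ (L * D) * ∫ p in HH N, |a p - b p| * (θ p.1 * xi p.2) := fun i => by
        rw [← integral_const_mul]
        refine (Real.le_norm_self _).trans (norm_integral_le_of_norm_le (ixi.const_mul _) ?_)
        filter_upwards [ae_restrict_mem HH_meas] with p hp
        unfold Aa
        rw [indicator_of_mem hp, indicator_of_mem hp, Real.norm_eq_abs, abs_mul, abs_abs, abs_mul, abs_of_nonneg (t3 p.1)]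
        have k1 := pow_lip ha.hm (a p) (b p) (ha.ws.b0 p) (ha.aC p) (hb.ws.b0 p) (hb.aC p)
        have k2 := mul_le_mul_of_nonneg_left (c5 n i p.2) (t3 p.1)
        refine (mul_le_mul k1 k2 (mul_nonneg (t3 _) (abs_nonneg _)) (by positivity)).trans (le_of_eq (by rw [hL]; ring))
      have s2 := Finset.sum_le_sum fun i (_ : i ∈ Finset.univ) => s i
      rw [Finset.sum_const, Finset.card_univ, Fintype.card_fin, nsmul_eq_mul] at s2
      linarith
    have nn : 0 ≤ᵐ[volume.restrict (HH N)] fun p => |a p - b p| * (θ p.1 * xi p.2) := Eventually.of_forall fun p => mul_nonneg (abs_nonneg _) (mul_nonneg (t3 _) (xi_pos _).le)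
    have z := (integral_eq_zero_iff_of_nonneg_ae nn ixi).1 (le_antisymm (by linarith) (integral_nonneg_of_ae nn))
    rw [Filter.EventuallyEq, ae_restrict_iff' HH_meas] at z
    filter_upwards [z] with p hp h1 h2
    have := hp h1
    have k := mul_pos (t5 p.1 h1 h2) (xi_pos p.2)
    simp only [Pi.zero_apply, mul_eq_zero, k.ne', or_false] at this
    simp only [(t5 p.1 h1 h2).ne', (xi_pos p.2).ne', or_false, abs_eq_zero] at this
    linarith
  filter_upwards [ae_all_iff.2 main] with p hp h
  obtain ⟨n, hn⟩ := exists_nat_gt p.1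
  exact hp n h hn
end Par
end

end

open Filter Topology
set_option linter.all false
namespace Par
variable {N : ℕ} {m q C : ℝ} {V u u' : EE N → ℝ} {b : ℝ × EE N → ℝ} {g : ℝ × EE N → EE N} {ζ : ℝ × EE N → ℝ} {T : ℝ}

theorem fub {F : ℝ × EE N → ℝ} (hF : Integrable F) (hz : ∀ p, T < p.1 → F p = 0) : ∫ s in Ioo 0 T, ∫ x, F (s, x) = ∫ p in HH N, F p := by
  rw [setIntegral_eq_of_subset_of_forall_sdiff_eq_zero (s := Ioc 0 T ×ˢ univ) HH_meas (fun p hp => hp.1.1) (fun p hp => hz p (by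
    by_contra h; exact hp.2 ⟨⟨hp.1, not_lt.1 h⟩, trivial⟩)), Measure.volume_eq_prod, setIntegral_prod _ hF.integrableOn, integral_Ioc_eq_integral_Ioo]
  simp
theorem tz (h : ∀ s x, T ≤ s → ζ (s, x) = 0) (p : ℝ × EE N) (hp : T < p.1) : fderiv ℝ ζ p = 0 := by
  have : ζ =ᶠ[𝓝 p] fun _ => 0 := by
    filter_upwards [continuous_fst.continuousAt.eventually (lt_mem_nhds hp)] with r hr
    exact h r.1 r.2 hr.le
  rw [this.fderiv_eq]; simp
theorem tb (h : HasCompactSupport ζ) : ∃ T > 0, ∀ s x, T ≤ s → ζ (s, x) = 0 := by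
  obtain ⟨R, hR⟩ := h.isCompact.isBounded.subset_closedBall 0
  refine ⟨|R| + 1, by positivity, fun s x hs => image_eq_zero_of_notMem_tsupport fun hp => ?_⟩
  have h1 := mem_closedBall_zero_iff.1 (hR hp)
  have h2 := (norm_fst_le (s, x)).trans h1
  rw [Real.norm_eq_abs] at h2
  linarith [le_abs_self s, le_abs_self R]

structure Ok (m q : ℝ) (V u : EE N → ℝ) (b : ℝ × EE N → ℝ) (g : ℝ × EE N → EE N) : Prop where
  m0 : 0 ≤ m
  q0 : 0 ≤ q
  hb : Bm b
  hu : Bm fun p : ℝ × EE N => u p.2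
  hV : Continuous V
  hg : ∀ i, L2l fun p => g p i
theorem Ok.i1 (h : Ok m q V u b g) (h1 : ContDiff ℝ 1 ζ) (h2 : HasCompactSupport ζ) (v : ℝ × EE N) : Integrable fun p => b p ^ m * fderiv ℝ ζ p v :=
  int2 (h.hb.comp (Real.continuous_rpow_const h.m0)).l2l (fd_bm h1 h2 v).l2l (fd_cs h2 _)
theorem Ok.i2 (h : Ok m q V u b g) (h1 : ContDiff ℝ 1 ζ) (h2 : HasCompactSupport ζ) (i : Fin N) : Integrable fun p => g p i * ζ p :=
  int2 (h.hg i) (Bm.cc h1.continuous h2).l2l h2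
theorem Ok.i3 (h : Ok m q V u b g) (h1 : ContDiff ℝ 1 ζ) (h2 : HasCompactSupport ζ) : Integrable fun p => (u p.2 - b p) * fderiv ℝ ζ p (1, 0) + fderiv ℝ ζ p (0, g p) + V p.2 * b p ^ q * ζ p := by
  have e : ∀ p, fderiv ℝ ζ p (0, g p) = ∑ i, g p i * fderiv ℝ ζ p (0, ee i) := fun p => by
    rw [fd_inner]; simp [Gz, PiLp.inner_apply, mul_comm]
  simp only [e]
  exact ((int2 (h.hu.sub h.hb).l2l (fd_bm h1 h2 (1, 0)).l2l (fd_cs h2 _)).fun_add (integrable_finsetSum _ fun i _ => int2 (h.hg i) (fd_bm h1 h2 (0, ee i)).l2l (fd_cs h2 _))).fun_add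
    (int2 ((c_l2l (h.hV.comp continuous_snd)).mul_bm (h.hb.comp (Real.continuous_rpow_const h.q0))) (Bm.cc h1.continuous h2).l2l h2)

theorem fromWS (h : Dt N m q C V u b g) : IsWeakSolution N m q V u (fun t x => b (t, x)) := by
  have O : Ok m q V u b g := ⟨by linarith [h.hm], h.hq.le, h.am, h.ub, h.hV, h.gl⟩
  refine ⟨h.ws.bm, fun t x => h.ws.b0 _, ⟨C, fun t x => h.aC _⟩, fun t x => g (t, x), h.ws.gm, fun T hT => ⟨fun K hK => ?_, fun ζ h1 h2 h3 i => ?_, fun ζ h1 h2 h3 => ?_⟩⟩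
  · have e := (h.ws.g2 (Icc 0 T ×ˢ K) (isCompact_Icc.prod hK)).mono_set (prod_mono_left Ioo_subset_Icc_self)
    have := e.lintegral_lt_top
    rw [Measure.volume_eq_prod, ← Measure.prod_restrict, lintegral_prod _ (by have := h.ws.gm; fun_prop)] at this
    exact this
  · have h3' : ∀ s x, T ≤ s → ζ (s, x) = 0 := fun s x hs => h3 s x fun h => absurd h.2 (not_lt.2 hs)
    refine (fub (O.i1 h1 h2 _) fun p hp => by rw [tz h3' p hp]; simp).trans ((h.ws.grad ζ h1 h2 i).trans ?_)
    rw [← fub (O.i2 h1 h2 i) fun p hp => by rw [h3' p.1 p.2 hp.le, mul_zero]]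
  · exact (fub (O.i3 h1 h2) fun p hp => by rw [tz h3 p hp, show ζ p = 0 from h3 p.1 p.2 hp.le]; simp).trans (h.ws.eq ζ h1 h2)

theorem isw_congr {w : ℝ → EE N → ℝ} (h : IsWeakSolution N m q V u w) (e : u =ᵐ[volume] u') : IsWeakSolution N m q V u' w := by
  obtain ⟨a1, a2, a3, g, a4, a5⟩ := h
  refine ⟨a1, a2, a3, g, a4, fun T hT => ⟨(a5 T hT).1, (a5 T hT).2.1, fun ζ h1 h2 h3 => ((a5 T hT).2.2 ζ h1 h2 h3).symm.trans ?_ |>.symm⟩⟩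
  congr 1; ext s
  refine integral_congr_ae ?_
  filter_upwards [e] with x hx
  rw [hx]

theorem toWS (hm : 1 < m) (hq : 0 < q) (hV : Continuous V) (um : Measurable u) (u0 : ∀ x, 0 ≤ u x) (uC : ∀ x, u x ≤ C) {w : ℝ → EE N → ℝ} (h : IsWeakSolution N m q V u w) :
    ∃ b g, WS N m q V u b g ∧ (∃ C, ∀ p, b p ≤ C) ∧ ∀ p : ℝ × EE N, 0 < p.1 → b p = w p.1 p.2 := by
  classical
  obtain ⟨a1, a2, ⟨C', a3⟩, g, a4, a5⟩ := h
  set G : ℝ × EE N → EE N := (HH N).indicator (Function.uncurry g) with hG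
  set b : ℝ × EE N → ℝ := (HH N).piecewise (Function.uncurry w) fun p => u p.2 with hb
  have bm : Measurable b := Measurable.piecewise HH_meas a1 (um.comp measurable_snd)
  have Gm : Measurable G := a4.indicator HH_meas
  have bH : ∀ p ∈ HH N, b p = w p.1 p.2 := fun p hp => piecewise_eq_of_mem _ _ _ hp
  have GH : ∀ p ∈ HH N, G p = g p.1 p.2 := fun p hp => indicator_of_mem hp _
  have off : ∀ p ∉ HH N, b p = u p.2 := fun p hp => piecewise_eq_of_notMem _ _ _ hp
  have b0 : ∀ p, 0 ≤ b p := fun p => by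
    by_cases hp : p ∈ HH N
    · rw [bH p hp]; exact a2 _ _
    · rw [off p hp]; exact u0 _
  have bC : ∀ p, b p ≤ max C C' := fun p => by
    by_cases hp : p ∈ HH N
    · rw [bH p hp]; exact (a3 _ _).trans (le_max_right _ _)
    · rw [off p hp]; exact (uC _).trans (le_max_left _ _)
  have g2 : ∀ K : Set (ℝ × EE N), IsCompact K → IntegrableOn (fun p => ‖G p‖ ^ 2) K := fun K hK => by
    obtain ⟨R, hR⟩ := (hK.image continuous_fst).isBounded.subset_closedBall 0
    have fin := (a5 (|R| + 1) (by positivity)).1 _ (hK.image continuous_snd)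
    have e : ∫⁻ p in Ioo 0 (|R| + 1) ×ˢ (Prod.snd '' K), ENNReal.ofReal (‖Function.uncurry g p‖ ^ 2) < ⊤ := by
      rw [Measure.volume_eq_prod, ← Measure.prod_restrict, lintegral_prod _ (by fun_prop)]; exact fin
    refine ⟨(Gm.norm.pow_const 2).aestronglyMeasurable, ?_⟩
    rw [hasFiniteIntegral_iff_ofReal (Eventually.of_forall fun p => by positivity)]
    refine lt_of_le_of_lt ?_ e
    rw [← lintegral_indicator hK.measurableSet, ← lintegral_indicator (measurableSet_Ioo.prod (hK.image continuous_snd).measurableSet)]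
    refine lintegral_mono fun p => ?_
    by_cases hp : p ∈ HH N
    · by_cases hk : p ∈ K
      · have : p ∈ Ioo 0 (|R| + 1) ×ˢ (Prod.snd '' K) := ⟨⟨hp, by
          have := mem_closedBall_zero_iff.1 (hR ⟨p, hk, rfl⟩)
          rw [Real.norm_eq_abs] at this
          linarith [le_abs_self p.1, le_abs_self R]⟩, p, hk, rfl⟩
        rw [indicator_of_mem hk, indicator_of_mem this, hG, indicator_of_mem hp]
      · rw [indicator_of_notMem hk]; exact bot_le
    · have : G p = 0 := indicator_of_notMem hp _
      by_cases hk : p ∈ K <;> simp [hk, this]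
  have O : Ok m q V u b G := ⟨by linarith, hq.le, ⟨bm, _, fun p => by rw [abs_of_nonneg (b0 p)]; exact bC p⟩, ⟨um.comp measurable_snd, C, fun p => by rw [abs_of_nonneg (u0 _)]; exact uC _⟩, hV, fun i => by
    have k : Measurable (fun p => G p i) := (by fun_prop : Measurable fun x : EE N => x i).comp Gm
    refine ⟨k, fun K hK => (g2 K hK).mono' (k.pow_const 2).aestronglyMeasurable (Eventually.of_forall fun p => ?_)⟩
    rw [norm_pow]; exact pow_le_pow_left₀ (norm_nonneg _) (PiLp.norm_apply_le _ i) 2⟩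
  refine ⟨b, G, ⟨bm, Gm, b0, off, fun p hp => indicator_of_notMem hp _, g2, fun ζ h1 h2 i => ?_, fun ζ h1 h2 => ?_⟩, ⟨_, bC⟩, bH⟩
  · obtain ⟨T, hT, hz⟩ := tb h2
    have sd : ∀ n : ℕ, ContDiff ℝ 1 fun p : ℝ × EE N => Real.smoothTransition (n * p.1) := fun n => (st_cd n).comp (by fun_prop)
    have st : ∀ p ∈ HH N, Tendsto (fun n : ℕ => Real.smoothTransition (n * p.1)) atTop (𝓝 1) := fun p hp => by
      have := st_lim p.1; rwa [if_pos (show 0 < p.1 from hp)] at this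
    have fz : ∀ (n : ℕ) p, fderiv ℝ (fun p : ℝ × EE N => Real.smoothTransition (n * p.1) * ζ p) p (0, ee i) = Real.smoothTransition (n * p.1) * fderiv ℝ ζ p (0, ee i) := fun n p => by
      refine fd_dir (((sd n).mul h1).differentiable one_ne_zero p) ?_
      have := ((h1.differentiable one_ne_zero p).hasFDerivAt.hasLineDerivAt (0, ee i))
      have := HasDerivAt.const_mul (Real.smoothTransition (n * p.1)) this
      simpa using this
    have E : ∀ n : ℕ, (∫ p in HH N, Real.smoothTransition (n * p.1) * (b p ^ m * fderiv ℝ ζ p (0, ee i))) = -∫ p in HH N, Real.smoothTransition (n * p.1) * (G p i * ζ p) := fun n => by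
      have z1 := (sd n).mul h1
      have z2 : HasCompactSupport (fun p : ℝ × EE N => Real.smoothTransition (n * p.1) * ζ p) := h2.mul_left
      have z3 : ∀ s x, T ≤ s → (fun p : ℝ × EE N => Real.smoothTransition (n * p.1) * ζ p) (s, x) = 0 := fun s x hs => by simp [hz s x hs]
      have k := (a5 T hT).2.1 _ z1 z2 (fun s x hs => by
        by_cases h : 0 < s
        · exact z3 s x (by by_contra h'; exact hs ⟨h, not_le.1 h'⟩)
        · simp [Real.smoothTransition.zero_of_nonpos (mul_nonpos_of_nonneg_of_nonpos n.cast_nonneg (not_lt.1 h))]) i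
      have k1 := fub (T := T) (O.i1 z1 z2 (0, ee i)) fun p hp => by rw [tz z3 p hp]; simp
      have k2 := fub (T := T) (O.i2 z1 z2 i) fun p hp => by rw [show ζ p = 0 from hz p.1 p.2 hp.le, mul_zero, mul_zero]
      have c1 : (∫ s in Ioo 0 T, ∫ x, b (s, x) ^ m * fderiv ℝ (fun p : ℝ × EE N => Real.smoothTransition (n * p.1) * ζ p) (s, x) (0, ee i)) = _ :=
        (setIntegral_congr_fun measurableSet_Ioo fun s hs => by simp only [bH (s, _) hs.1]; rfl).trans k
      have c2 : (∫ s in Ioo 0 T, ∫ x, G (s, x) i * (Real.smoothTransition (n * s) * ζ (s, x))) = ∫ s in Ioo 0 T, ∫ x, g s x i * (Real.smoothTransition (n * s) * ζ (s, x)) :=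
        setIntegral_congr_fun measurableSet_Ioo fun s hs => by simp only [GH (s, _) hs.1]
      rw [k1] at c1
      simp only [fz] at c1
      refine Eq.trans ?_ (c1.trans ?_)
      · congr 1; ext p; ring
      · refine (congrArg Neg.neg (c2.symm.trans k2)).trans ?_
        congr 2; ext p; ring
    have L : ∀ {F : ℝ × EE N → ℝ}, Integrable F → Tendsto (fun n : ℕ => ∫ p in HH N, Real.smoothTransition (n * p.1) * F p) atTop (𝓝 (∫ p in HH N, F p)) := fun {F} hF => by
      refine tendsto_integral_of_dominated_convergence _ (fun n => ((sd n).continuous.aestronglyMeasurable.mul hF.1).restrict) hF.norm.restrict (fun n => Eventually.of_forall fun p => ?_) ?_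
      · rw [norm_mul]; exact mul_le_of_le_one_left (norm_nonneg _) (st_abs _)
      · filter_upwards [ae_restrict_mem HH_meas] with p hp
        simpa using (st p hp).mul_const (F p)
    exact tendsto_nhds_unique ((L (O.i1 h1 h2 _)).congr E) (L (O.i2 h1 h2 i)).neg
  · obtain ⟨T, hT, hz⟩ := tb h2
    refine (fub (T := T) (O.i3 h1 h2) fun p hp => by rw [tz hz p hp, show ζ p = 0 from hz p.1 p.2 hp.le]; simp).symm.trans (Eq.trans ?_ ((a5 T hT).2.2 ζ h1 h2 hz))
    refine setIntegral_congr_fun measurableSet_Ioo fun s hs => ?_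
    dsimp only; congr 1; ext x; rw [bH (s, x) hs.1, GH (s, x) hs.1]

theorem Dt.mono (h : Dt N m q C V u b g) {C' : ℝ} (hC : C ≤ C') : Dt N m q C' V u b g := ⟨h.ws, h.hm, h.hq, h.hV, h.hV0, h.um, h.u0, fun x => (h.uC x).trans hC, fun x => (h.aC x).trans hC⟩
theorem exi (hN : 1 ≤ N) (hm : 1 < m) (hq0 : 0 < q) (hq1 : q < 1) {σ : ℝ} (hσ : 0 < σ) (um : Measurable u) (u0 : ∀ x, 0 ≤ u x) (uC : ∀ x, u x ≤ C) :
    ∃ b g, Dt N m q C (Vp N σ) u b g ∧ Tr u b := by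
  obtain ⟨P, rfl, rfl, rfl⟩ := Par_exists hN hm hq0 hq1 ((u0 0).trans (uC 0))
  obtain ⟨b, g, h1, h2, h3⟩ := construct (P := P) ⟨um, fun x => ⟨u0 x, uC x⟩⟩ hσ
  exact ⟨b, g, ⟨h1, hm, hq0, Vp_cont hσ, Vp_nonneg, um, u0, uC, h2⟩, h3⟩
end Par

/-- **Well-posedness (part of Theorem 2.1 of the paper).**
For `N ≥ 1`, `m > 1`, `q ∈ (0,1)`, `σ > 0` and non-negative `u₀ ∈ L^∞(ℝᴺ)`, there is a
non-negative weak solution `u` of `∂ₜ u = Δ(uᵐ) − |x|^σ u^q` with `u(0) = u₀`, it is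
unique (any two weak solutions agree a.e. on `(0,∞)×ℝᴺ`), and it satisfies
`‖u(t)‖_∞ ≤ ‖u₀‖_∞` for a.e. `t ≥ 0`. -/
theorem well_posedness
    (N : ℕ) (hN : 1 ≤ N) (m q σ : ℝ) (hm : 1 < m) (hq0 : 0 < q) (hq1 : q < 1)
    (hσ0 : 0 < σ)
    (u0 : EuclideanSpace ℝ (Fin N) → ℝ) (hu0 : IsBddNonneg N u0) :
    (∃ u : ℝ → EuclideanSpace ℝ (Fin N) → ℝ,
        IsWeakSolution N m q (fun x => ‖x‖ ^ σ) u0 u ∧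
        ∀ᵐ t : ℝ, 0 ≤ t → eLpNormEssSup (u t) volume ≤ eLpNormEssSup u0 volume) ∧
    ∀ u1 u2 : ℝ → EuclideanSpace ℝ (Fin N) → ℝ,
      IsWeakSolution N m q (fun x => ‖x‖ ^ σ) u0 u1 →
      IsWeakSolution N m q (fun x => ‖x‖ ^ σ) u0 u2 →
      ∀ᵐ p : ℝ × EuclideanSpace ℝ (Fin N), 0 < p.1 → u1 p.1 p.2 = u2 p.1 p.2 := by
  obtain ⟨um, up, C, uC⟩ := hu0
  constructor
  · have fin : eLpNormEssSup u0 volume < ⊤ := eLpNormEssSup_lt_top_of_ae_bound (C := C) (Eventually.of_forall fun x => by rw [Real.norm_of_nonneg (up x)]; exact uC x)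
    set M := (eLpNormEssSup u0 volume).toReal with hM
    have ae : (fun x => min (u0 x) M) =ᵐ[volume] u0 := by
      filter_upwards [ae_le_eLpNormEssSup (f := u0) (μ := volume)] with x hx
      refine min_eq_left ?_
      have := ENNReal.toReal_mono fin.ne hx
      rwa [toReal_enorm, Real.norm_of_nonneg (up x)] at this
    obtain ⟨b, g, h, -⟩ := Par.exi (u := fun x => min (u0 x) M) (C := M) hN hm hq0 hq1 hσ0 (um.min measurable_const) (fun x => le_min (up x) ENNReal.toReal_nonneg) (fun x => min_le_right _ _)
    refine ⟨_, Par.isw_congr (Par.fromWS h) ae, Eventually.of_forall fun t _ => ?_⟩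
    rw [← ENNReal.ofReal_toReal fin.ne]
    exact eLpNormEssSup_le_of_ae_bound (Eventually.of_forall fun x => by rw [Real.norm_of_nonneg (h.ws.b0 _)]; exact h.aC _)
  · obtain ⟨b, k, h, hT⟩ := Par.exi hN hm hq0 hq1 hσ0 um up uC
    have key : ∀ w, IsWeakSolution N m q (fun x => ‖x‖ ^ σ) u0 w → ∀ᵐ p : ℝ × EuclideanSpace ℝ (Fin N), 0 < p.1 → w p.1 p.2 = b p := fun w hw => by
      obtain ⟨a, g, h1, ⟨C', h2⟩, h3⟩ := Par.toWS hm hq0 h.hV um up uC (V := Par.Vp N σ) hw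
      have ha : Par.Dt N m q (max C C') (Par.Vp N σ) u0 a g := ⟨h1, hm, hq0, h.hV, h.hV0, um, up, fun x => (uC x).trans (le_max_left _ _), fun p => (h2 p).trans (le_max_right _ _)⟩
      filter_upwards [Par.Uniq ha (h.mono (le_max_left _ _)) hT] with p hp h0
      rw [← h3 p h0, hp h0]
    intro u1 u2 h1 h2
    filter_upwards [key u1 h1, key u2 h2] with p p1 p2 h0
    rw [p1 h0, p2 h0]
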